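/- Let d ≥ 2 and c ∈ (1, 1+c₂(d)). Let τ(n) = (c/σ(b)) m^{d−1/c} if Wn−b = m^d for some m ∈ ℕ^c with m ≤ x, τ(n) = 0 otherwise; and let μ(n) = m^{d−1}/σ(b) if Wn−b = m^d for some integer m with 1 ≤ m ≤ x, μ(n) = 0 otherwise. Then uniformly for α ∈ [0,1), τ̂(α) = μ̂(α) + O(x^{d − (1−θ(d,c))/c + ε}), where θ(2,c) = (4c+7)/13, θ(3,c) = (15c+14)/30, θ(d,c) = ((1+c)/2)(1−h(d)) for 4 ≤ d ≤ 11, ((1+c)/2)(1−k(d)) for even d ≥ 12, and ((1+c)/2)(1−l(d)) for odd d ≥ 12. -/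

import Mathlib

open scoped BigOperators Classical
open Real

noncomputable section

/-- `e(t) = e^{2πit}`. -/
def eC (t : ℝ) : ℂ := Complex.exp (2 * Real.pi * Complex.I * t)

/-- The Piatetski-Shapiro set `ℕ^c = {⌊n^c⌋ : n ∈ ℕ}`. -/
def PS (c : ℝ) : Set ℕ := {m | ∃ n : ℕ, 0 < n ∧ m = ⌊(n : ℝ) ^ c⌋₊}

/-- The Fourier transform `f̂(α) = ∑_{n ∈ ℤ} f(n) e(αn)` of a finitely
supported function on `ℤ`. -/
def FT (f : ℤ → ℂ) (α : ℝ) : ℂ := ∑ᶠ n : ℤ, f n * eC (α * n)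

/-- `w = (1/2) log log x`. -/
def wps (x : ℕ) : ℝ := Real.log (Real.log x) / 2

/-- `W = 4 d³ ∏_{p ≤ w} p`. -/
def Wps (d x : ℕ) : ℕ :=
  4 * d ^ 3 * ∏ p ∈ Finset.filter Nat.Prime (Finset.Iic ⌊wps x⌋₊), p

/-- `σ(b) = #{z ∈ [W] : z^d ≡ -b (mod W)}`. -/
def sigmaPS (d W b : ℕ) : ℕ :=
  ((Finset.Icc 1 W).filter fun z => (z ^ d + b) % W = 0).card

/-- `N = ⌊x^d / W⌋ + 1`. -/
def Nps (d x : ℕ) : ℕ := ⌊(x : ℝ) ^ d / (Wps d x : ℝ)⌋₊ + 1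

/-- `b ∈ [W]` and `-b ∈ (ℤ/Wℤ)^{×d}`. -/
def bSpec (d x b : ℕ) : Prop :=
  b ∈ Finset.Icc 1 (Wps d x) ∧
    ∃ z : (ZMod (Wps d x))ˣ, (z : ZMod (Wps d x)) ^ d = -(b : ZMod (Wps d x))

/-- `S(d) = 2⌊d²/2⌋`. -/
def Sd (d : ℕ) : ℕ := 2 * (d ^ 2 / 2)

def hD (d : ℕ) : ℝ := 1 / ((d : ℝ) * ((d : ℝ) + 1) ^ 2 - 1)
def kD (d : ℕ) : ℝ := 2 / (27 * (d : ℝ) ^ 2 - 14)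
def lD (d : ℕ) : ℝ := 2 / (27 * (d : ℝ) ^ 2 - 5)

/-- `θ(d, c)`. -/
def θdc (d : ℕ) (c : ℝ) : ℝ :=
  if d = 2 then (4 * c + 7) / 13
  else if d = 3 then (15 * c + 14) / 30
  else if d ≤ 11 then (1 + c) / 2 * (1 - hD d)
  else if 2 ∣ d then (1 + c) / 2 * (1 - kD d)
  else (1 + c) / 2 * (1 - lD d)

/-- `c₂(d)`. -/
def c2ps (d : ℕ) : ℝ :=
  if d = 2 then 1 / 54
  else if d = 3 then 1 / 495
  else if d ≤ 11 then 2 * hD d / (4 * (Sd d : ℝ) + 1 - hD d)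
  else if 2 ∣ d then 2 * kD d / (4 * (Sd d : ℝ) + 1 - kD d)
  else 2 * lD d / (4 * (Sd d : ℝ) + 1 - lD d)

/-- The majorant `ν = ν_b` from the density transfer lemma, characterized by
its defining property. -/
def nuSpec (d x : ℕ) (c : ℝ) (b : ℕ) (ν : ℤ → ℝ) : Prop :=
  (∀ n : ℤ, ∀ p : ℕ, p.Prime → p ∈ PS c → p ≤ x →
      (Wps d x : ℤ) * n - (b : ℤ) = (p : ℤ) ^ d →
      ν n = c * (Nat.totient (Wps d x) : ℝ) /
          ((sigmaPS d (Wps d x) b : ℝ) * (Wps d x : ℝ)) *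
          (p : ℝ) ^ ((d : ℝ) - 1 / c) * Real.log p) ∧
  (∀ n : ℤ, (¬ ∃ p : ℕ, p.Prime ∧ p ∈ PS c ∧ p ≤ x ∧
      (Wps d x : ℤ) * n - (b : ℤ) = (p : ℤ) ^ d) → ν n = 0)

/-- The majorant `τ`, characterized by its defining property. -/
def tauSpec (d x : ℕ) (c : ℝ) (b : ℕ) (τ : ℤ → ℝ) : Prop :=
  (∀ n : ℤ, ∀ m : ℕ, m ∈ PS c → m ≤ x →
      (Wps d x : ℤ) * n - (b : ℤ) = (m : ℤ) ^ d →
      τ n = c / (sigmaPS d (Wps d x) b : ℝ) * (m : ℝ) ^ ((d : ℝ) - 1 / c)) ∧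
  (∀ n : ℤ, (¬ ∃ m : ℕ, m ∈ PS c ∧ m ≤ x ∧
      (Wps d x : ℤ) * n - (b : ℤ) = (m : ℤ) ^ d) → τ n = 0)

/-- The function `μ`, characterized by its defining property. -/
def muSpec (d x : ℕ) (b : ℕ) (μ : ℤ → ℝ) : Prop :=
  (∀ n : ℤ, ∀ m : ℕ, 1 ≤ m → m ≤ x →
      (Wps d x : ℤ) * n - (b : ℤ) = (m : ℤ) ^ d →
      μ n = (m : ℝ) ^ (d - 1) / (sigmaPS d (Wps d x) b : ℝ)) ∧
  (∀ n : ℤ, (¬ ∃ m : ℕ, 1 ≤ m ∧ m ≤ x ∧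
      (Wps d x : ℤ) * n - (b : ℤ) = (m : ℤ) ^ d) → μ n = 0)

section Aux
open Finset

lemma vm_newton {R : Type*} [CommRing R] {k : ℕ} (x y : Fin k → R)
    (hu : ∀ j : ℕ, 1 ≤ j → j ≤ k → IsUnit (j : R))
    (h : ∀ j : ℕ, 1 ≤ j → j ≤ k → ∑ i, x i ^ j = ∑ i, y i ^ j) (T : R) :
    ∏ i, (T - x i) = ∏ i, (T - y i) := by
  have key : ∀ j : ℕ, j ≤ k → MvPolynomial.aeval x (MvPolynomial.esymm (Fin k) R j) =
      MvPolynomial.aeval y (MvPolynomial.esymm (Fin k) R j) := by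
    intro j
    induction j using Nat.strong_induction_on with
    | _ j ih =>
      intro hj
      rcases Nat.eq_zero_or_pos j with rfl | hj0
      · simp
      have hx := congrArg (MvPolynomial.aeval x) (MvPolynomial.mul_esymm_eq_sum (Fin k) R j)
      have hy := congrArg (MvPolynomial.aeval y) (MvPolynomial.mul_esymm_eq_sum (Fin k) R j)
      simp only [map_mul, map_sum, map_pow, map_neg, map_one, map_natCast] at hx hy
      have : (j : R) * MvPolynomial.aeval x (MvPolynomial.esymm (Fin k) R j) =
          (j : R) * MvPolynomial.aeval y (MvPolynomial.esymm (Fin k) R j) := by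
        rw [hx, hy]
        congr 1
        apply sum_congr rfl
        intro q hq
        rw [mem_filter] at hq
        have hq1 := HasAntidiagonal.mem_antidiagonal.1 hq.1
        have hq2 := hq.2
        rw [ih q.1 hq.2 (by omega)]
        congr 1
        simp only [MvPolynomial.psum, map_sum, map_pow, MvPolynomial.aeval_X]
        exact h q.2 (by omega) (by omega)
      exact (hu j hj0 hj).mul_left_cancel this
  have e1 : ∀ z : Fin k → R, ∏ i, (T - z i) = ∑ j ∈ range (k + 1),
      (-1) ^ j * (MvPolynomial.aeval z (MvPolynomial.esymm (Fin k) R j) * T ^ (k - j)) := by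
    intro z
    have := congrArg (Polynomial.eval T)
      (Multiset.prod_X_sub_X_eq_sum_esymm (Multiset.map z univ.val))
    simp only [Multiset.map_map, Function.comp_def, Multiset.card_map, card_val,
      card_univ, Fintype.card_fin, Polynomial.eval_finsetSum, Polynomial.eval_mul,
      Polynomial.eval_pow, Polynomial.eval_neg, Polynomial.eval_one, Polynomial.eval_C,
      Polynomial.eval_X] at this
    rw [show (Multiset.map (fun x => Polynomial.X - Polynomial.C (z x)) univ.val).prod
      = ∏ i, (Polynomial.X - Polynomial.C (z i)) from rfl, Polynomial.eval_prod] at this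
    simp only [Polynomial.eval_sub, Polynomial.eval_X, Polynomial.eval_C] at this
    rw [this]
    apply sum_congr rfl
    intro j _
    rw [MvPolynomial.aeval_esymm_eq_multiset_esymm]
  rw [e1, e1]
  apply sum_congr rfl
  intro j hj
  rw [key j (by have := mem_range.1 hj; omega)]

lemma vm_unique {k p m : ℕ} (hp : p.Prime) (hk : k < p) (x y : Fin k → ℤ)
    (h : ∀ j : ℕ, j < k → ((p : ℤ) ^ m) ∣ ∑ i, x i ^ (j + 1) - ∑ i, y i ^ (j + 1))
    (hd : ∀ i l, i ≠ l → ¬ (p : ℤ) ∣ x l - y i) (l : Fin k) : (p : ℤ) ^ m ∣ x l - y l := by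
  have hcast : ∀ z : ℤ, ((p : ℤ) ^ m ∣ z) ↔ ((z : ZMod (p ^ m)) = 0) := by
    intro z
    rw [ZMod.intCast_zmod_eq_zero_iff_dvd]; push_cast; rfl
  have hunit : ∀ z : ℤ, ¬ (p : ℤ) ∣ z → IsUnit (z : ZMod (p ^ m)) := by
    intro z hz
    have hc : IsCoprime z ((p ^ m : ℕ) : ℤ) := by
      push_cast
      apply IsCoprime.pow_right
      exact ((Nat.prime_iff_prime_int.1 hp).coprime_iff_not_dvd.2 hz).symm
    obtain ⟨u, v, huv⟩ := hc
    have := congrArg (Int.cast : ℤ → ZMod (p ^ m)) huv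
    push_cast at this
    have h0 : ((p : ZMod (p ^ m)) ^ m) = 0 := by
      rw [← Nat.cast_pow]; exact ZMod.natCast_self _
    rw [h0, mul_zero, add_zero] at this
    exact IsUnit.of_mul_eq_one _ (by rw [mul_comm]; exact this)
  have hn := vm_newton (fun i => (x i : ZMod (p ^ m))) (fun i => (y i : ZMod (p ^ m)))
    (by
      intro j hj hjk
      have := hunit (j : ℤ) (by
        intro hdv
        have := Int.le_of_dvd (by omega) hdv
        omega)
      simpa using this)
    (by
      intro j hj hjk
      have := (hcast _).1 (h (j - 1) (by omega))
      rw [Nat.sub_add_cancel hj] at this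
      push_cast at this
      exact sub_eq_zero.1 this) (x l)
  have h0 : ∏ i, ((x l : ZMod (p ^ m)) - x i) = 0 :=
    prod_eq_zero (mem_univ l) (sub_self _)
  rw [h0, ← mul_prod_erase _ _ (mem_univ l)] at hn
  have hu : IsUnit (∏ i ∈ univ.erase l, ((x l : ZMod (p ^ m)) - y i)) := by
    apply prod_induction _ IsUnit (fun a b => IsUnit.mul) isUnit_one
    intro i hi
    have := hunit _ (hd i l (ne_of_mem_erase hi))
    simpa using this
  rw [hcast]
  push_cast
  exact (hu.mul_left_eq_zero).1 hn.symm

/-- translation of power sums divisibility -/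
lemma vm_shift {k : ℕ} {ι κ : Type*} [Fintype ι] [Fintype κ] (M : ℤ) (x : ι → ℤ) (y : κ → ℤ)
    (c : ℤ) (hcard : Fintype.card ι = Fintype.card κ)
    (h : ∀ j : ℕ, j < k → M ∣ ∑ i, x i ^ (j + 1) - ∑ i, y i ^ (j + 1)) :
    ∀ j : ℕ, j < k → M ∣ ∑ i, (x i + c) ^ (j + 1) - ∑ i, (y i + c) ^ (j + 1) := by
  intro j hj
  simp only [add_pow]
  rw [sum_comm, sum_comm (γ := κ), ← sum_sub_distrib]
  apply dvd_sum
  intro r hr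
  rw [mem_range] at hr
  have : ∑ i, x i ^ r * c ^ (j + 1 - r) * ((j + 1).choose r : ℤ)
      - ∑ i, y i ^ r * c ^ (j + 1 - r) * ((j + 1).choose r : ℤ)
      = (∑ i, x i ^ r - ∑ i, y i ^ r) * (c ^ (j + 1 - r) * ((j + 1).choose r : ℤ)) := by
    rw [sub_mul, sum_mul, sum_mul]; simp only [mul_assoc]
  rw [this]
  apply Dvd.dvd.mul_right
  rcases Nat.eq_zero_or_pos r with rfl | hr0
  · simp [hcard]
  · have := h (r - 1) (by omega)
    rwa [Nat.sub_add_cancel hr0] at this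

lemma vm_count {k p a b : ℕ} (hp : p.Prime) (hk : k < p) (hab : a ≤ b)
    (ξ η : ℤ) (t : Fin k → ℤ) (ht : ∀ i l, i ≠ l → ¬ (p : ℤ) ∣ t l - t i) (x' : Fin k → ℤ)
    (S : Finset (Fin k → ZMod (p ^ (k * b))))
    (hS : ∀ ω ∈ S, ∃ x : Fin k → ℤ, (∀ i, (x i : ZMod (p ^ (k * b))) = ω i) ∧
      (∀ i, (p : ℤ) ^ (a + 1) ∣ x i - (ξ + (p : ℤ) ^ a * t i)) ∧
      ∀ j < k, (p : ℤ) ^ ((j + 1) * b) ∣ ∑ i, (x i - η) ^ (j + 1) - ∑ i, (x' i - η) ^ (j + 1)) :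
    S.card ≤ p ^ ((k * (k - 1) / 2) * (a + b)) := by
  have hp0 : (0 : ℤ) < p := by exact_mod_cast hp.pos
  choose! X hX1 hX2 hX3 using hS
  -- the rescaled variables
  have hT : ∀ ω ∈ S, ∀ i, ∃ v, X ω i = ξ + (p : ℤ) ^ a * v ∧ (p : ℤ) ∣ v - t i := by
    intro ω hω i
    obtain ⟨e, he⟩ := hX2 ω hω i
    refine ⟨t i + p * e, ?_, by simp⟩
    rw [pow_succ] at he
    linear_combination he
  choose! V hV1 hV2 using hT
  have hC : ∀ ω ∈ S, ∀ j < k, ∃ e, ∑ i, (X ω i - η) ^ (j + 1) - ∑ i, (x' i - η) ^ (j + 1)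
      = (p : ℤ) ^ ((j + 1) * b) * e := fun ω hω j hj => hX3 ω hω j hj
  choose! E hE using hC
  let code : (Fin k → ZMod (p ^ (k * b))) → (Fin k → ℤ × ℤ) := fun ω j =>
    (E ω j % (p : ℤ) ^ ((k - 1 - j) * b),
      (∑ i, V ω i ^ ((j : ℕ) + 1)) % (p : ℤ) ^ (k * b - a) / (p : ℤ) ^ (k * b - (j + 1) * a))
  let Tg : Finset (Fin k → ℤ × ℤ) := Fintype.piFinset fun j : Fin k =>
    Ico (0 : ℤ) ((p : ℤ) ^ ((k - 1 - (j : ℕ)) * b)) ×ˢ Ico (0 : ℤ) ((p : ℤ) ^ ((j : ℕ) * a))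
  have hle : ∀ j : Fin k, ((j : ℕ) + 1) * a ≤ k * b := fun j => Nat.mul_le_mul j.2 hab
  have hmaps : ∀ ω ∈ S, code ω ∈ Tg := by
    intro ω _
    simp only [Tg, Fintype.mem_piFinset, mem_product, mem_Ico, code]
    intro j
    have hj := hle j
    refine ⟨⟨Int.emod_nonneg _ (by positivity), Int.emod_lt_of_pos _ (by positivity)⟩,
      Int.ediv_nonneg (Int.emod_nonneg _ (by positivity)) (by positivity), ?_⟩
    apply Int.ediv_lt_of_lt_mul (by positivity)
    rw [← pow_add]
    have : (j : ℕ) * a + (k * b - ((j : ℕ) + 1) * a) = k * b - a := by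
      rw [add_mul] at *; omega
    rw [this]
    exact Int.emod_lt_of_pos _ (by positivity)
  have hinj : Set.InjOn code S := by
    intro ω hω ω' hω' hcode
    have hω : ω ∈ S := hω
    have hω' : ω' ∈ S := hω'
    have h1 : ∀ j < k, (p : ℤ) ^ (k * b) ∣ ∑ i, (X ω i - η) ^ (j + 1) - ∑ i, (X ω' i - η) ^ (j + 1) := by
      intro j hj
      have c1 := congrArg Prod.fst (congrFun hcode ⟨j, hj⟩)
      simp only [code] at c1
      have c2 := Int.emod_emod_of_dvd
      have c3 : (p : ℤ) ^ ((k - 1 - j) * b) ∣ E ω j - E ω' j := Int.ModEq.dvd (Eq.symm c1)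
      have : ∑ i, (X ω i - η) ^ (j + 1) - ∑ i, (X ω' i - η) ^ (j + 1)
          = (p : ℤ) ^ ((j + 1) * b) * (E ω j - E ω' j) := by
        linear_combination hE ω hω j hj - hE ω' hω' j hj
      rw [this]
      have e : k * b = (j + 1) * b + (k - 1 - j) * b := by
        rw [← add_mul]; congr 1; omega
      rw [e, pow_add]
      exact mul_dvd_mul_left _ c3
    have h2 := vm_shift (k := k) _ _ _ (η - ξ) rfl h1
    have h3 : ∀ j < k, (p : ℤ) ^ (k * b - a) ∣ ∑ i, V ω i ^ (j + 1) - ∑ i, V ω' i ^ (j + 1) := by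
      intro j hj
      have h4 := h2 j hj
      have hj' := hle ⟨j, hj⟩
      simp only at hj'
      have e1 : ∀ ω ∈ S, ∑ i, (X ω i - η + (η - ξ)) ^ (j + 1)
          = (p : ℤ) ^ ((j + 1) * a) * ∑ i, V ω i ^ (j + 1) := by
        intro ω hω
        rw [mul_sum]
        apply sum_congr rfl
        intro i _
        rw [hV1 ω hω i, mul_comm (j + 1) a, pow_mul, ← mul_pow]
        congr 1
        ring
      rw [e1 ω hω, e1 ω' hω', ← mul_sub, show k * b = (j + 1) * a + (k * b - (j + 1) * a) by omega,
        pow_add] at h4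
      have h5 := (mul_dvd_mul_iff_left (by positivity)).1 h4
      have c1 := congrArg Prod.snd (congrFun hcode ⟨j, hj⟩)
      simp only [code] at c1
      set A := ∑ i, V ω i ^ (j + 1)
      set B := ∑ i, V ω' i ^ (j + 1)
      have hdv : (p : ℤ) ^ (k * b - (j + 1) * a) ∣ (p : ℤ) ^ (k * b - a) :=
        pow_dvd_pow _ (by rw [add_mul] at *; omega)
      have m1 : (A % (p : ℤ) ^ (k * b - a)) % (p : ℤ) ^ (k * b - (j + 1) * a)
          = (B % (p : ℤ) ^ (k * b - a)) % (p : ℤ) ^ (k * b - (j + 1) * a) := by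
        rw [Int.emod_emod_of_dvd _ hdv, Int.emod_emod_of_dvd _ hdv]
        exact (Int.ModEq.symm (Int.modEq_of_dvd h5))
      have : A % (p : ℤ) ^ (k * b - a) = B % (p : ℤ) ^ (k * b - a) := by
        rw [← Int.emod_add_mul_ediv (A % (p : ℤ) ^ (k * b - a)) ((p : ℤ) ^ (k * b - (j + 1) * a)), m1, c1,
          Int.emod_add_mul_ediv]
      exact Int.ModEq.dvd this.symm
    have h6 := vm_unique hp hk _ _ h3 (by
      intro i l hil hdv
      apply ht i l hil
      have a1 := hV2 ω hω l
      have a2 := hV2 ω' hω' i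
      have e : t l - t i = (V ω l - V ω' i) - (V ω l - t l) + (V ω' i - t i) := by ring
      rw [e]; exact dvd_add (dvd_sub hdv a1) a2)
    funext i
    rw [← hX1 ω hω i, ← hX1 ω' hω' i]
    rw [ZMod.intCast_eq_intCast_iff]
    apply Int.ModEq.symm
    apply Int.modEq_of_dvd
    rw [hV1 ω hω i, hV1 ω' hω' i]
    obtain ⟨e, he⟩ := h6 i
    have hka : a ≤ k * b := by
      have := i.2
      calc a ≤ 1 * b := by omega
        _ ≤ k * b := Nat.mul_le_mul_right _ (by omega)
    refine ⟨e, ?_⟩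
    push_cast
    rw [show (p : ℤ) ^ (k * b) = (p : ℤ) ^ a * (p : ℤ) ^ (k * b - a) by
      rw [← pow_add]; congr 1; omega]
    linear_combination (p : ℤ) ^ a * he
  have := card_le_card_of_injOn code hmaps hinj
  refine this.trans (le_of_eq ?_)
  simp only [Tg, Fintype.card_piFinset, card_product, Int.card_Ico, sub_zero]
  have e : ∀ n : ℕ, ((p : ℤ) ^ n).toNat = p ^ n := by
    intro n; rw [← Nat.cast_pow, Int.toNat_natCast]
  simp only [e, ← pow_add]
  rw [prod_pow_eq_pow_sum]
  congr 1
  rw [sum_add_distrib, ← sum_mul, ← sum_mul]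
  rw [Fin.sum_univ_eq_sum_range (fun j => k - 1 - j), Fin.sum_univ_eq_sum_range (fun j => j),
    sum_range_reflect (fun j => j), sum_range_id]
  ring

lemma addChar_sum {Q : ℕ} [NeZero Q] {ι : Type*} (s : Finset ι) (f : ι → ZMod Q) :
    (ZMod.stdAddChar (∑ i ∈ s, f i) : ℂ) = ∏ i ∈ s, ZMod.stdAddChar (f i) := by
  induction s using Finset.induction_on with
  | empty => simp
  | insert a s ha ih => rw [sum_insert ha, prod_insert ha, AddChar.map_add_eq_mul, ih]

def vF {k : ℕ} (Q : ℕ) [NeZero Q] (A : Finset ℤ) (a : Fin k → ZMod Q) : ℂ :=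
  ∑ z ∈ A, ZMod.stdAddChar (∑ j, a j * (z : ZMod Q) ^ ((j : ℕ) + 1))

lemma v_orth {k Q : ℕ} [NeZero Q] (v : Fin k → ZMod Q) :
    ∑ a : Fin k → ZMod Q, (ZMod.stdAddChar (∑ j, a j * v j) : ℂ) =
      if v = 0 then ((Q : ℂ) ^ k) else 0 := by
  have h1 : ∀ a : Fin k → ZMod Q, (ZMod.stdAddChar (∑ j, a j * v j) : ℂ)
      = ∏ j, ZMod.stdAddChar (a j * v j) := by
    intro a
    rw [addChar_sum]
  simp only [h1]
  have h2 := prod_univ_sum (fun _ : Fin k => (univ : Finset (ZMod Q)))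
    (fun j b => (ZMod.stdAddChar (b * v j) : ℂ))
  rw [Fintype.piFinset_univ] at h2
  rw [← h2]
  have h3 : ∀ j, ∑ b : ZMod Q, (ZMod.stdAddChar (b * v j) : ℂ) = if v j = 0 then (Q : ℂ) else 0 := by
    intro j
    rw [AddChar.sum_mulShift (v j) (ZMod.isPrimitive_stdAddChar Q), ZMod.card]
    split_ifs <;> simp
  simp only [h3]
  split_ifs with hv
  · subst hv; simp
  · obtain ⟨j, hj⟩ := Function.ne_iff.1 hv
    exact prod_eq_zero (mem_univ j) (if_neg hj)

lemma v_prod {k Q : ℕ} [NeZero Q] {ι : Type*} [Fintype ι] (A : ι → Finset ℤ)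
    (a : Fin k → ZMod Q) : ∏ i, vF Q (A i) a = ∑ x ∈ Fintype.piFinset A,
      ZMod.stdAddChar (∑ j, a j * (((∑ i, x i ^ ((j : ℕ) + 1) : ℤ)) : ZMod Q)) := by
  unfold vF
  rw [prod_univ_sum]
  apply sum_congr rfl
  intro x _
  rw [← addChar_sum]
  congr 1
  rw [sum_comm]
  apply sum_congr rfl
  intro j _
  push_cast
  rw [mul_sum]

def vPairs {ι : Type*} [Fintype ι] (k : ℕ) (A A' : ι → Finset ℤ) : Finset ((ι → ℤ) × (ι → ℤ)) :=
  (Fintype.piFinset A ×ˢ Fintype.piFinset A').filter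
    fun xy => ∀ j < k, ∑ i, xy.1 i ^ (j + 1) = ∑ i, xy.2 i ^ (j + 1)

lemma v_corr {k Q X : ℕ} [NeZero Q] {ι : Type*} [Fintype ι] (A A' : ι → Finset ℤ)
    (hA : ∀ i, A i ⊆ Ico 0 (X : ℤ)) (hA' : ∀ i, A' i ⊆ Ico 0 (X : ℤ))
    (hQ : Fintype.card ι * X ^ k < Q) :
    ∑ a : Fin k → ZMod Q, (∏ i, vF Q (A i) a) * (starRingEnd ℂ) (∏ i, vF Q (A' i) a)
      = (Q : ℂ) ^ k * (vPairs k A A').card := by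
  simp only [v_prod, map_sum, sum_mul_sum]
  rw [sum_comm]
  rw [vPairs, card_filter, sum_product]
  simp only [Nat.cast_sum, Nat.cast_ite, Nat.cast_one, Nat.cast_zero]
  rw [mul_sum]
  apply sum_congr rfl
  intro x hx
  rw [mul_sum, sum_comm]
  apply sum_congr rfl
  intro y hy
  rw [Fintype.mem_piFinset] at hx hy
  have hx' := fun i => mem_Ico.1 (hA i (hx i))
  have hy' := fun i => mem_Ico.1 (hA' i (hy i))
  have h1 : ∀ a : Fin k → ZMod Q,
      (ZMod.stdAddChar (∑ j, a j * (((∑ i, x i ^ ((j : ℕ) + 1) : ℤ)) : ZMod Q)) : ℂ) *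
      (starRingEnd ℂ) (ZMod.stdAddChar (∑ j, a j * (((∑ i, y i ^ ((j : ℕ) + 1) : ℤ)) : ZMod Q)))
      = ZMod.stdAddChar (∑ j, a j *
        ((((∑ i, x i ^ ((j : ℕ) + 1) : ℤ)) : ZMod Q) - (((∑ i, y i ^ ((j : ℕ) + 1) : ℤ)) : ZMod Q))) := by
    intro a
    rw [← AddChar.map_neg_eq_conj, ← AddChar.map_add_eq_mul]
    congr 1
    rw [← sub_eq_add_neg, ← sum_sub_distrib]
    apply sum_congr rfl
    intro j _
    ring
  simp only [h1]
  rw [v_orth]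
  rw [mul_ite, mul_one, mul_zero]
  apply if_congr _ rfl rfl
  constructor
  · intro h j hj
    have h2 := congrFun h ⟨j, hj⟩
    simp only [Pi.zero_apply] at h2
    rw [← Int.cast_sub, ZMod.intCast_zmod_eq_zero_iff_dvd] at h2
    have hb : ∀ z : ι → ℤ, (∀ i, 0 ≤ z i ∧ z i < X) →
        0 ≤ ∑ i, z i ^ (j + 1) ∧ ∑ i, z i ^ (j + 1) ≤ Fintype.card ι * (X : ℤ) ^ k := by
      intro z hz
      constructor
      · exact sum_nonneg fun i _ => pow_nonneg (hz i).1 _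
      · have : ∀ i ∈ univ, z i ^ (j + 1) ≤ (X : ℤ) ^ k := by
          intro i _
          have h3 := hz i
          calc z i ^ (j + 1) ≤ (X : ℤ) ^ (j + 1) := pow_le_pow_left₀ h3.1 h3.2.le _
            _ ≤ (X : ℤ) ^ k := pow_le_pow_right₀ (by omega) (by omega)
        have := sum_le_card_nsmul _ _ _ this
        simpa using this
    have b1 := hb x hx'
    have b2 := hb y hy'
    have hQ' : (Fintype.card ι : ℤ) * (X : ℤ) ^ k < Q := by exact_mod_cast hQ
    have := Int.eq_zero_of_abs_lt_dvd h2 (by rw [abs_lt]; constructor <;> linarith)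
    linarith
  · intro h
    funext j
    simp [h j j.2]

/-- number of Vinogradov solutions with variables in `A` -/
def vJ (k s : ℕ) (A : Finset ℤ) : ℕ := (vPairs (ι := Fin s) k (fun _ => A) (fun _ => A)).card

lemma v_moment {k Q X s : ℕ} [NeZero Q] (A : Finset ℤ)
    (hA : A ⊆ Ico 0 (X : ℤ)) (hQ : s * X ^ k < Q) :
    ∑ a : Fin k → ZMod Q, ‖vF Q A a‖ ^ (2 * s) = (Q : ℝ) ^ k * vJ k s A := by
  have := v_corr (k := k) (Q := Q) (X := X) (ι := Fin s) (fun _ => A) (fun _ => A) (fun _ => hA) (fun _ => hA)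
    (by simpa using hQ)
  have h2 : ∀ a : Fin k → ZMod Q, (∏ _i : Fin s, vF Q A a) * (starRingEnd ℂ) (∏ _i : Fin s, vF Q A a)
      = ((‖vF Q A a‖ ^ (2 * s) : ℝ) : ℂ) := by
    intro a
    rw [Complex.mul_conj, Complex.normSq_eq_norm_sq, norm_prod]
    simp [pow_mul, mul_comm]
  simp only [h2] at this
  have h3 : ((∑ a : Fin k → ZMod Q, ‖vF Q A a‖ ^ (2 * s) : ℝ) : ℂ) = (((Q : ℝ) ^ k * vJ k s A : ℝ) : ℂ) := by
    push_cast
    push_cast at this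
    exact this
  exact_mod_cast h3

/-- affine invariance -/
lemma v_affine {k s : ℕ} (A B : Finset ℤ) (q c : ℤ) (hq : q ≠ 0)
    (h : ∀ z ∈ A, ∃ w ∈ B, z = c + q * w) : vJ k s A ≤ vJ k s B := by
  choose! w hw hz using h
  unfold vJ
  apply card_le_card_of_injOn (fun xy => ((fun i => w (xy.1 i)), (fun i => w (xy.2 i))))
  · intro xy hxy
    simp only [vPairs, coe_filter, mem_product, Fintype.mem_piFinset, Set.mem_ofPred_eq] at hxy ⊢
    obtain ⟨⟨h1, h2⟩, h3⟩ := hxy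
    refine ⟨⟨fun i => hw _ (h1 i), fun i => hw _ (h2 i)⟩, ?_⟩
    have hs := vm_shift (k := k) 0 xy.1 xy.2 (-c) rfl (by intro j hj; rw [h3 j hj]; simp)
    intro j hj
    have h4 := hs j hj
    rw [zero_dvd_iff] at h4
    have e : ∀ z ∈ A, (z + -c) ^ (j + 1) = q ^ (j + 1) * w z ^ (j + 1) := by
      intro z hzA
      rw [← mul_pow]; congr 1; linear_combination hz z hzA
    rw [sum_congr rfl (fun i _ => e _ (h1 i)), sum_congr rfl (fun i _ => e _ (h2 i)),
      ← mul_sum, ← mul_sum, ← mul_sub] at h4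
    have := (mul_eq_zero.1 h4).resolve_left (pow_ne_zero _ hq)
    linarith
  · intro xy hxy xy' hxy' heq
    simp only [vPairs, coe_filter, mem_product, Fintype.mem_piFinset, Set.mem_ofPred_eq] at hxy hxy'
    simp only [Prod.mk.injEq] at heq
    ext i
    · rw [hz _ (hxy.1.1 i), hz _ (hxy'.1.1 i), congrFun heq.1 i]
    · rw [hz _ (hxy.1.2 i), hz _ (hxy'.1.2 i), congrFun heq.2 i]

/-- broad-narrow -/
lemma broad_narrow {k p n : ℕ} (hk : 1 ≤ k) (hp : 1 ≤ p) (hn : 1 ≤ n) (g : Fin p → ℝ) (hg : ∀ t, 0 ≤ g t) (F : ℝ)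
    (hF0 : 0 ≤ F) (hF : F ≤ ∑ t, g t) :
    F ^ (k * n) ≤ (2 * k : ℝ) ^ (k * n) * ∑ t, g t ^ (k * n) +
      (2 * p : ℝ) ^ (k * n) * ∑ t ∈ (univ : Finset (Fin k → Fin p)).filter
        (fun t => Function.Injective t), ∏ i, g (t i) ^ n := by
  have hp0 : (0 : ℝ) < p := by exact_mod_cast hp
  have hk0 : (0 : ℝ) < k := by exact_mod_cast hk
  have hn1 : (0 : ℝ) ≤ (2 * k : ℝ) ^ (k * n) * ∑ t, g t ^ (k * n) :=
    mul_nonneg (by positivity) (sum_nonneg fun t _ => pow_nonneg (hg t) _)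
  have hn2' : ∀ t : Fin k → Fin p, 0 ≤ ∏ i, g (t i) ^ n :=
    fun t => prod_nonneg fun i _ => pow_nonneg (hg _) _
  have hn2 : (0 : ℝ) ≤ (2 * p : ℝ) ^ (k * n) * ∑ t ∈ (univ : Finset (Fin k → Fin p)).filter
        (fun t => Function.Injective t), ∏ i, g (t i) ^ n :=
    mul_nonneg (by positivity) (sum_nonneg fun t _ => hn2' t)
  rcases hF0.eq_or_lt with h0 | hFpos
  · rw [← h0, zero_pow (by positivity)]; linarith
  set L := univ.filter (fun t => F / (2 * p) ≤ g t) with hL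
  by_cases hc : k ≤ L.card
  · obtain ⟨L', hL', hcard⟩ := exists_subset_card_eq hc
    let t : Fin k → Fin p := fun i => (L'.orderEmbOfFin hcard) i
    have ht : Function.Injective t := (L'.orderEmbOfFin hcard).injective
    have h1 : ∀ i, F / (2 * p) ≤ g (t i) := fun i =>
      (mem_filter.1 (hL' (orderEmbOfFin_mem L' hcard i))).2
    have h2 : (F / (2 * p)) ^ (k * n) ≤ ∏ i, g (t i) ^ n := by
      have : (F / (2 * p)) ^ (k * n) = ∏ _i : Fin k, (F / (2 * p)) ^ n := by
        simp [mul_comm k n, pow_mul]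
      rw [this]
      exact prod_le_prod (fun i _ => by positivity)
        (fun i _ => pow_le_pow_left₀ (by positivity) (h1 i) _)
    have h3 : ∏ i, g (t i) ^ n ≤ ∑ t ∈ (univ : Finset (Fin k → Fin p)).filter
        (fun t => Function.Injective t), ∏ i, g (t i) ^ n :=
      single_le_sum (f := fun t : Fin k → Fin p => ∏ i, g (t i) ^ n)
        (fun t _ => hn2' t) (mem_filter.2 ⟨mem_univ _, ht⟩)
    have h4 : F ^ (k * n) = (2 * p : ℝ) ^ (k * n) * (F / (2 * p)) ^ (k * n) := by
      rw [← mul_pow]; congr 1; field_simp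
    rw [h4]
    have := mul_le_mul_of_nonneg_left (h2.trans h3) (by positivity : (0 : ℝ) ≤ (2 * p : ℝ) ^ (k * n))
    linarith
  · push Not at hc
    have h1 : ∑ t ∈ univ.filter (fun t => ¬ F / (2 * p) ≤ g t), g t ≤ F / 2 := by
      calc _ ≤ ∑ t ∈ univ.filter (fun t => ¬ F / (2 * p) ≤ g t), F / (2 * p) :=
            sum_le_sum fun t ht => (not_le.1 (mem_filter.1 ht).2).le
        _ = (univ.filter (fun t => ¬ F / (2 * p) ≤ g t)).card * (F / (2 * p)) := by
            rw [sum_const, nsmul_eq_mul]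
        _ ≤ p * (F / (2 * p)) := by
            apply mul_le_mul_of_nonneg_right _ (by positivity)
            have := card_le_univ (univ.filter (fun t => ¬ F / (2 * p) ≤ g t))
            rw [Fintype.card_fin] at this
            exact_mod_cast this
        _ = F / 2 := by field_simp
    have h2 := sum_filter_add_sum_filter_not univ (fun t => F / (2 * p) ≤ g t) g
    have h3 : F / 2 ≤ ∑ t ∈ L, g t := by rw [hL]; linarith
    have h4 : ∃ t ∈ L, F / (2 * k) ≤ g t := by
      by_contra hcon
      push Not at hcon
      have hne : L.Nonempty := by
        by_contra hne
        rw [not_nonempty_iff_eq_empty] at hne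
        rw [hne, sum_empty] at h3; linarith
      have : ∑ t ∈ L, g t < ∑ t ∈ L, F / (2 * k) := sum_lt_sum_of_nonempty hne hcon
      rw [sum_const, nsmul_eq_mul] at this
      have h5 : (L.card : ℝ) * (F / (2 * k)) ≤ k * (F / (2 * k)) :=
        mul_le_mul_of_nonneg_right (by exact_mod_cast hc.le) (by positivity)
      have h6 : k * (F / (2 * k)) = F / 2 := by field_simp
      linarith
    obtain ⟨t, -, ht⟩ := h4
    have h5 : (F / (2 * k)) ^ (k * n) ≤ ∑ t, g t ^ (k * n) :=
      (pow_le_pow_left₀ (by positivity) ht _).trans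
        (single_le_sum (f := fun t => g t ^ (k * n)) (fun t _ => pow_nonneg (hg t) _) (mem_univ t))
    have h6 : F ^ (k * n) = (2 * k : ℝ) ^ (k * n) * (F / (2 * k)) ^ (k * n) := by
      rw [← mul_pow]; congr 1; field_simp
    rw [h6]
    have := mul_le_mul_of_nonneg_left h5 (by positivity : (0 : ℝ) ≤ (2 * k : ℝ) ^ (k * n))
    linarith

/-- AM-GM for products of k nonneg numbers -/
lemma amgm_prod {k : ℕ} (hk : 1 ≤ k) (g : Fin k → ℝ) (hg : ∀ i, 0 ≤ g i) :
    ∏ i, g i ≤ (1 / k) * ∑ i, g i ^ k := by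
  have hk0 : (0 : ℝ) < k := by exact_mod_cast hk
  have := geom_mean_le_arith_mean_weighted univ (fun _ : Fin k => (1 / k : ℝ))
    (fun i => g i ^ k) (fun i _ => by positivity) (by simp; field_simp) (fun i _ => pow_nonneg (hg i) _)
  rw [← mul_sum] at this
  convert this using 1
  apply prod_congr rfl
  intro i _
  rw [← rpow_natCast, ← rpow_mul (hg i)]
  field_simp
  simp

lemma holder_w {ι : Type*} (s : Finset ι) (u v : ι → ℝ) (hu : ∀ i, 0 ≤ u i) (hv : ∀ i, 0 ≤ v i)
    (θ : ℝ) (h0 : 0 < θ) (h1 : θ < 1) :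
    ∑ i ∈ s, u i ^ θ * v i ^ (1 - θ) ≤ (∑ i ∈ s, u i) ^ θ * (∑ i ∈ s, v i) ^ (1 - θ) := by
  have hpq : (1 / θ).HolderConjugate (1 / (1 - θ)) := by
    rw [holderConjugate_iff]
    constructor
    · rw [lt_div_iff₀ h0]; linarith
    · simp
  have := inner_le_Lp_mul_Lq_of_nonneg s hpq (f := fun i => u i ^ θ) (g := fun i => v i ^ (1 - θ))
    (fun i _ => rpow_nonneg (hu i) _) (fun i _ => rpow_nonneg (hv i) _)
  have e1 : ∀ i, (u i ^ θ) ^ (1 / θ) = u i := by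
    intro i; rw [← rpow_mul (hu i)]; field_simp; simp
  have e2 : ∀ i, (v i ^ (1 - θ)) ^ (1 / (1 - θ)) = v i := by
    intro i
    have : 1 - θ ≠ 0 := by linarith
    rw [← rpow_mul (hv i)]; field_simp; simp
  simp only [e1, e2, one_div_one_div] at this
  exact this

def cls (X p b : ℕ) (η : ℤ) : Finset ℤ := (Ico 0 (X : ℤ)).filter fun z => (p : ℤ) ^ b ∣ z - η

lemma cls_sub (X p b : ℕ) (η : ℤ) : cls X p b η ⊆ Ico 0 (X : ℤ) := filter_subset _ _

lemma cls_split {k Q : ℕ} [NeZero Q] (X p b : ℕ) (hp : 0 < p) (η : ℤ) (a : Fin k → ZMod Q) :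
    vF Q (cls X p b η) a = ∑ t : Fin p, vF Q (cls X p (b + 1) (η + (p : ℤ) ^ b * (t : ℕ))) a := by
  unfold vF
  have hp' : (0 : ℤ) < p := by exact_mod_cast hp
  have hpb : (p : ℤ) ^ b ≠ 0 := by positivity
  rw [← sum_biUnion]
  · apply sum_congr _ (fun _ _ => rfl)
    ext z
    simp only [cls, mem_biUnion, mem_filter, mem_univ, true_and]
    constructor
    · rintro ⟨hz, e, he⟩
      refine ⟨⟨(e % p).toNat, ?_⟩, hz, e / p, ?_⟩
      · have := Int.emod_lt_of_pos e hp'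
        have := Int.emod_nonneg e hp'.ne'
        omega
      · simp only
        rw [Int.toNat_of_nonneg (Int.emod_nonneg e hp'.ne'), pow_succ]
        have := Int.emod_add_mul_ediv e p
        linear_combination he - (p : ℤ) ^ b * this
    · rintro ⟨t, hz, e, he⟩
      refine ⟨hz, (t : ℕ) + p * e, ?_⟩
      rw [pow_succ] at he
      linear_combination he
  · intro t _ t' _ hne
    rw [Function.onFun, disjoint_left]
    intro z hz hz'
    simp only [cls, mem_filter] at hz hz'
    apply hne
    have h1 := dvd_sub hz'.2 hz.2
    have e : z - (η + (p : ℤ) ^ b * (t' : ℕ)) - (z - (η + (p : ℤ) ^ b * (t : ℕ))) =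
      (p : ℤ) ^ b * ((t : ℕ) - (t' : ℕ)) := by ring
    rw [e, pow_succ, mul_dvd_mul_iff_left hpb] at h1
    have h2 := Int.eq_zero_of_abs_lt_dvd h1 (by
      have := t.2; have := t'.2
      rw [abs_lt]; constructor <;> omega)
    apply Fin.ext; omega

/-- residues mod `p^m` refining `ξ` mod `p^b` -/
def refi (p m b : ℕ) [NeZero (p ^ m)] (ξ : ℤ) : Finset (ZMod (p ^ m)) :=
  univ.filter fun ω => (p : ℤ) ^ b ∣ (ω.val : ℤ) - ξ

lemma refi_card (p m b : ℕ) [NeZero (p ^ m)] (hp : 0 < p) (hbm : b ≤ m) (ξ : ℤ) :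
    (refi p m b ξ).card ≤ p ^ (m - b) := by
  have hpb : 0 < p ^ b := by positivity
  have := card_le_card_of_injOn (s := refi p m b ξ) (t := range (p ^ (m - b)))
    (fun ω => ω.val / p ^ b) (by
      intro ω _
      simp only [coe_range, Set.mem_Iio]
      apply Nat.div_lt_of_lt_mul
      rw [← pow_add]
      have := ZMod.val_lt ω
      rwa [show b + (m - b) = m by omega]) (by
      intro ω hω ω' hω' h
      simp only [refi, coe_filter, mem_univ, true_and, Set.mem_ofPred_eq] at hω hω'
      apply ZMod.val_injective
      have h1 := dvd_sub hω hω'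
      rw [sub_sub_sub_cancel_right] at h1
      have h2 : ω'.val ≡ ω.val [MOD p ^ b] := by
        rw [Nat.modEq_iff_dvd]; push_cast; exact h1
      simp only at h
      have a1 := Nat.mod_add_div ω.val (p ^ b)
      have a2 := Nat.mod_add_div ω'.val (p ^ b)
      rw [h] at a1
      rw [h2] at a2
      omega)
  simpa using this

lemma cls_refi {k Q : ℕ} [NeZero Q] (X p m b : ℕ) [NeZero (p ^ m)] (hbm : b ≤ m) (ξ : ℤ)
    (a : Fin k → ZMod Q) :
    vF Q (cls X p b ξ) a = ∑ ω ∈ refi p m b ξ, vF Q (cls X p m (ω.val : ℤ)) a := by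
  have hval : ∀ z : ℤ, (p : ℤ) ^ m ∣ z - ((z : ZMod (p ^ m)).val : ℤ) := by
    intro z
    have : ((z - ((z : ZMod (p ^ m)).val : ℤ) : ℤ) : ZMod (p ^ m)) = 0 := by
      push_cast; simp
    rw [ZMod.intCast_zmod_eq_zero_iff_dvd] at this
    exact_mod_cast this
  unfold vF
  rw [← sum_biUnion]
  · apply sum_congr _ (fun _ _ => rfl)
    ext z
    simp only [cls, refi, mem_biUnion, mem_filter, mem_univ, true_and]
    constructor
    · rintro ⟨hz, he⟩
      refine ⟨(z : ZMod (p ^ m)), ?_, hz, hval z⟩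
      have := dvd_sub he ((pow_dvd_pow (p : ℤ) hbm).trans (hval z))
      rwa [sub_sub_sub_cancel_left] at this
    · rintro ⟨ω, h1, hz, h2⟩
      refine ⟨hz, ?_⟩
      have := dvd_add ((pow_dvd_pow (p : ℤ) hbm).trans h2) h1
      simpa using this
  · intro ω _ ω' _ hne
    rw [Function.onFun, disjoint_left]
    intro z hz hz'
    simp only [cls, mem_filter] at hz hz'
    apply hne
    have key : ∀ ω : ZMod (p ^ m), (p : ℤ) ^ m ∣ z - (ω.val : ℤ) → (z : ZMod (p ^ m)) = ω := by
      intro ω h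
      have h1 : ((z - (ω.val : ℤ) : ℤ) : ZMod (p ^ m)) = 0 := by
        rw [ZMod.intCast_zmod_eq_zero_iff_dvd]; exact_mod_cast h
      push_cast at h1
      rw [ZMod.natCast_zmod_val] at h1
      exact sub_eq_zero.1 h1
    rw [← key ω hz.2, key ω' hz'.2]

lemma almost_orth {α β : Type*} [Fintype α] (Ω : Finset β) (g : β → α → ℂ) (R : ℕ)
    (hR : ∀ ω' ∈ Ω, (Ω.filter fun ω => ∑ a, g ω a * (starRingEnd ℂ) (g ω' a) ≠ 0).card ≤ R) :
    ∑ a, ‖∑ ω ∈ Ω, g ω a‖ ^ 2 ≤ R * ∑ ω ∈ Ω, ∑ a, ‖g ω a‖ ^ 2 := by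
  set c : β → β → ℂ := fun ω ω' => ∑ a, g ω a * (starRingEnd ℂ) (g ω' a) with hc
  set N : β → ℝ := fun ω => ∑ a, ‖g ω a‖ ^ 2 with hN
  have h1 : ((∑ a, ‖∑ ω ∈ Ω, g ω a‖ ^ 2 : ℝ) : ℂ) = ∑ ω ∈ Ω, ∑ ω' ∈ Ω, c ω ω' := by
    have e : ∀ a, ((‖∑ ω ∈ Ω, g ω a‖ ^ 2 : ℝ) : ℂ)
        = ∑ ω ∈ Ω, ∑ ω' ∈ Ω, g ω a * (starRingEnd ℂ) (g ω' a) := by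
      intro a
      rw [← Complex.normSq_eq_norm_sq, ← Complex.mul_conj, map_sum, sum_mul_sum]
    rw [Complex.ofReal_sum]
    simp only [e]
    rw [sum_comm]
    apply sum_congr rfl
    intro ω _
    rw [sum_comm]
  have h2 : ∀ ω ω', ‖c ω ω'‖ ≤ (N ω + N ω') / 2 := by
    intro ω ω'
    simp only [hc, hN]
    refine (norm_sum_le _ _).trans ?_
    rw [← sum_add_distrib, sum_div]
    apply sum_le_sum
    intro a _
    rw [norm_mul, RCLike.norm_conj]
    nlinarith [sq_nonneg (‖g ω a‖ - ‖g ω' a‖)]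
  have hsymm : ∀ ω ω', c ω ω' ≠ 0 → c ω' ω ≠ 0 := by
    intro ω ω' h h0
    apply h
    have : c ω ω' = (starRingEnd ℂ) (c ω' ω) := by
      simp only [hc, map_sum, map_mul, Complex.conj_conj]
      exact sum_congr rfl fun a _ => mul_comm _ _
    rw [this, h0, map_zero]
  have hN0 : ∀ ω, 0 ≤ N ω := fun ω => sum_nonneg fun a _ => by positivity
  have h3 : ∑ a, ‖∑ ω ∈ Ω, g ω a‖ ^ 2 ≤ ∑ ω ∈ Ω, ∑ ω' ∈ Ω, ‖c ω ω'‖ := by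
    have : ‖((∑ a, ‖∑ ω ∈ Ω, g ω a‖ ^ 2 : ℝ) : ℂ)‖ = ∑ a, ‖∑ ω ∈ Ω, g ω a‖ ^ 2 := by
      rw [Complex.norm_real, norm_of_nonneg (sum_nonneg fun a _ => by positivity)]
    rw [← this, h1]
    refine (norm_sum_le _ _).trans (sum_le_sum fun ω _ => norm_sum_le _ _)
  refine h3.trans ?_
  have h4 : ∑ ω ∈ Ω, ∑ ω' ∈ Ω, ‖c ω ω'‖ ≤
      ∑ ω ∈ Ω, ∑ ω' ∈ Ω, ((if c ω ω' ≠ 0 then N ω else 0) / 2 + (if c ω ω' ≠ 0 then N ω' else 0) / 2) := by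
    apply sum_le_sum; intro ω _
    apply sum_le_sum; intro ω' _
    by_cases h : c ω ω' = 0
    · simp [h]
    · rw [if_pos h, if_pos h]; have := h2 ω ω'; linarith
  refine h4.trans ?_
  have h5 : ∀ ω' ∈ Ω, ∑ ω ∈ Ω, (if c ω ω' ≠ 0 then N ω' else 0) ≤ R * N ω' := by
    intro ω' hω'
    rw [← sum_filter, sum_const, nsmul_eq_mul]
    exact mul_le_mul_of_nonneg_right (by exact_mod_cast hR ω' hω') (hN0 _)
  have h6 : ∑ ω ∈ Ω, ∑ ω' ∈ Ω, (if c ω ω' ≠ 0 then N ω else 0) ≤ R * ∑ ω ∈ Ω, N ω := by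
    rw [mul_sum]
    apply sum_le_sum
    intro ω hω
    refine le_trans (sum_le_sum fun ω' _ => ?_) (h5 ω hω)
    by_cases h : c ω ω' = 0
    · rw [if_neg (by simpa using h)]; split_ifs; exact hN0 _; exact le_rfl
    · rw [if_pos h, if_pos (hsymm _ _ h)]
  have h7 : ∑ ω ∈ Ω, ∑ ω' ∈ Ω, (if c ω ω' ≠ 0 then N ω' else 0) ≤ R * ∑ ω ∈ Ω, N ω := by
    rw [sum_comm, mul_sum]
    exact sum_le_sum h5
  simp only [sum_add_distrib, ← sum_div]
  linarith

def pInj {k : ℕ} (p : ℕ) (t : Fin k → ℤ) : Prop := ∀ i l, i ≠ l → ¬ (p : ℤ) ∣ t l - t i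

lemma kstar_orth {k p a b X Q : ℕ} [NeZero Q] (hp : p.Prime) (hk : k < p) (hk2 : 2 ≤ k)
    (hab : a < b) (ξ η : ℤ) (t u : Fin k → ℤ) (ht : pInj p t) [NeZero (p ^ (k * b))]
    (hQ : (k + k * k) * X ^ k < Q) :
    ∑ α : Fin k → ZMod Q, (∏ i, ‖vF Q (cls X p (a + 1) (ξ + (p : ℤ) ^ a * t i)) α‖ ^ 2) *
        (∏ i, ‖vF Q (cls X p (b + 1) (η + (p : ℤ) ^ b * u i)) α‖ ^ (2 * k))
      ≤ (p ^ ((k * (k - 1) / 2) * (a + b)) : ℕ) *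
        ∑ ω ∈ Fintype.piFinset (fun i => refi p (k * b) (a + 1) (ξ + (p : ℤ) ^ a * t i)),
          ∑ α : Fin k → ZMod Q, (∏ i, ‖vF Q (cls X p (k * b) ((ω i).val : ℤ)) α‖ ^ 2) *
        (∏ i, ‖vF Q (cls X p (b + 1) (η + (p : ℤ) ^ b * u i)) α‖ ^ (2 * k)) := by
  set Ω := Fintype.piFinset (fun i => refi p (k * b) (a + 1) (ξ + (p : ℤ) ^ a * t i)) with hΩ
  have hle : a + 1 ≤ k * b := by nlinarith
  let A : (Fin k → ZMod (p ^ (k * b))) → (Fin k ⊕ (Fin k × Fin k)) → Finset ℤ := fun ω =>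
    Sum.elim (fun i => cls X p (k * b) ((ω i).val : ℤ)) (fun q => cls X p (b + 1) (η + (p : ℤ) ^ b * u q.1))
  let g : (Fin k → ZMod (p ^ (k * b))) → (Fin k → ZMod Q) → ℂ := fun ω α => ∏ i, vF Q (A ω i) α
  have hg : ∀ ω α, g ω α = (∏ i, vF Q (cls X p (k * b) ((ω i).val : ℤ)) α) *
      ∏ i, vF Q (cls X p (b + 1) (η + (p : ℤ) ^ b * u i)) α ^ k := by
    intro ω α
    simp only [g, Fintype.prod_sum_type, A, Sum.elim_inl, Sum.elim_inr, Fintype.prod_prod_type]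
    simp
  have hgn : ∀ ω α, ‖g ω α‖ ^ 2 = (∏ i, ‖vF Q (cls X p (k * b) ((ω i).val : ℤ)) α‖ ^ 2) *
        (∏ i, ‖vF Q (cls X p (b + 1) (η + (p : ℤ) ^ b * u i)) α‖ ^ (2 * k)) := by
    intro ω α
    rw [hg, norm_mul, mul_pow, norm_prod, norm_prod, ← prod_pow, ← prod_pow]
    congr 1
    apply prod_congr rfl
    intro i _
    rw [norm_pow, ← pow_mul, mul_comm k 2]
  have hsum : ∀ α, ∑ ω ∈ Ω, g ω α = (∏ i, vF Q (cls X p (a + 1) (ξ + (p : ℤ) ^ a * t i)) α) *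
      ∏ i, vF Q (cls X p (b + 1) (η + (p : ℤ) ^ b * u i)) α ^ k := by
    intro α
    simp only [hg, ← sum_mul]
    congr 1
    simp only [cls_refi X p (k * b) (a + 1) hle]
    rw [prod_univ_sum]
  have hsn : ∀ α, ‖∑ ω ∈ Ω, g ω α‖ ^ 2 = (∏ i, ‖vF Q (cls X p (a + 1) (ξ + (p : ℤ) ^ a * t i)) α‖ ^ 2) *
        (∏ i, ‖vF Q (cls X p (b + 1) (η + (p : ℤ) ^ b * u i)) α‖ ^ (2 * k)) := by
    intro α
    rw [hsum, norm_mul, mul_pow, norm_prod, norm_prod, ← prod_pow, ← prod_pow]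
    congr 1
    apply prod_congr rfl
    intro i _
    rw [norm_pow, ← pow_mul, mul_comm k 2]
  have hA : ∀ ω i, A ω i ⊆ Ico 0 (X : ℤ) := by
    rintro ω (i | i) <;> exact cls_sub _ _ _ _
  have key := almost_orth Ω g (p ^ ((k * (k - 1) / 2) * (a + b))) (by
    intro ω' _
    apply vm_count (a := a) (b := b) (k := k) (p := p) hp hk hab.le ξ η t ht (fun i => ((ω' i).val : ℤ))
    intro ω hω
    rw [mem_filter] at hω
    obtain ⟨hωΩ, hne⟩ := hω
    simp only [g] at hne
    rw [v_corr (A ω) (A ω') (hA ω) (hA ω') (by simpa using hQ)] at hne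
    have hpos : (vPairs k (A ω) (A ω')).Nonempty := by
      rw [← card_ne_zero]
      intro h0; apply hne; rw [h0]; simp
    obtain ⟨⟨x, y⟩, hxy⟩ := hpos
    simp only [vPairs, mem_filter, mem_product, Fintype.mem_piFinset] at hxy
    obtain ⟨⟨hx, hy⟩, hxy⟩ := hxy
    have hxl : ∀ i, (p : ℤ) ^ (k * b) ∣ x (Sum.inl i) - ((ω i).val : ℤ) := fun i =>
      (mem_filter.1 (hx (Sum.inl i))).2
    have hyl : ∀ i, (p : ℤ) ^ (k * b) ∣ y (Sum.inl i) - ((ω' i).val : ℤ) := fun i =>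
      (mem_filter.1 (hy (Sum.inl i))).2
    have hr : ∀ (ω : Fin k → ZMod (p ^ (k * b))) (x : (Fin k ⊕ (Fin k × Fin k)) → ℤ), (∀ i, x i ∈ A ω i) → ∀ q : Fin k × Fin k, (p : ℤ) ^ b ∣ x (Sum.inr q) - η := by
      intro ω x hx q
      have h1 := (mem_filter.1 (hx (Sum.inr q))).2
      have h2 := (pow_dvd_pow (p : ℤ) (Nat.le_succ b)).trans h1
      have h3 := dvd_add h2 (dvd_mul_right ((p : ℤ) ^ b) (u q.1))
      have e : x (Sum.inr q) - (η + (p : ℤ) ^ b * u q.1) + (p : ℤ) ^ b * u q.1 = x (Sum.inr q) - η := by ring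
      rwa [e] at h3
    refine ⟨fun i => x (Sum.inl i), ?_, ?_, ?_⟩
    · intro i
      have h1 : ((x (Sum.inl i) - ((ω i).val : ℤ) : ℤ) : ZMod (p ^ (k * b))) = 0 := by
        rw [ZMod.intCast_zmod_eq_zero_iff_dvd]; exact_mod_cast hxl i
      push_cast at h1
      rw [ZMod.natCast_zmod_val] at h1
      exact sub_eq_zero.1 h1
    · intro i
      have h1 := (mem_filter.1 (Fintype.mem_piFinset.1 hωΩ i)).2
      have := dvd_add ((pow_dvd_pow (p : ℤ) hle).trans (hxl i)) h1
      simpa using this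
    · intro j hj
      have hs := vm_shift (k := k) 0 x y (-η) rfl (by intro j hj; rw [hxy j hj]; simp) j hj
      rw [zero_dvd_iff] at hs
      simp only [Fintype.sum_sum_type, ← sub_eq_add_neg] at hs
      have hb1 : ∀ (ω : Fin k → ZMod (p ^ (k * b))) (x : (Fin k ⊕ (Fin k × Fin k)) → ℤ), (∀ i, x i ∈ A ω i) →
          (p : ℤ) ^ ((j + 1) * b) ∣ ∑ q, (x (Sum.inr q) - η) ^ (j + 1) := by
        intro ω x hx
        apply dvd_sum
        intro q _
        rw [mul_comm, pow_mul]
        exact pow_dvd_pow_of_dvd (hr ω x hx q) _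
      have hb2 : (p : ℤ) ^ ((j + 1) * b) ∣ ∑ i, (y (Sum.inl i) - η) ^ (j + 1) - ∑ i, (((ω' i).val : ℤ) - η) ^ (j + 1) := by
        rw [← sum_sub_distrib]
        apply dvd_sum
        intro i _
        have h1 := sub_dvd_pow_sub_pow (y (Sum.inl i) - η) (((ω' i).val : ℤ) - η) (j + 1)
        rw [sub_sub_sub_cancel_right] at h1
        exact ((pow_dvd_pow (p : ℤ) (Nat.mul_le_mul_right b hj)).trans (hyl i)).trans h1
      have e : ∑ i, (x (Sum.inl i) - η) ^ (j + 1) - ∑ i, (((ω' i).val : ℤ) - η) ^ (j + 1)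
        = (∑ i, (y (Sum.inl i) - η) ^ (j + 1) - ∑ i, (((ω' i).val : ℤ) - η) ^ (j + 1))
          + ∑ q, (y (Sum.inr q) - η) ^ (j + 1) - ∑ q, (x (Sum.inr q) - η) ^ (j + 1) := by
        linear_combination hs
      rw [e]
      exact dvd_sub (dvd_add hb2 (hb1 ω' y hy)) (hb1 ω x hx))
  simp only [hsn, hgn] at key
  exact key

def Kint (k X p Q : ℕ) [NeZero Q] (a b : ℕ) (ξ η : ℤ) (t : Fin k → ℤ) : ℝ :=
  ∑ α : Fin k → ZMod Q, (∏ i, ‖vF Q (cls X p (a + 1) (ξ + (p : ℤ) ^ a * t i)) α‖ ^ 2) *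
    ‖vF Q (cls X p b η) α‖ ^ (k * (2 * k))

def KB (k X p Q : ℕ) [NeZero Q] (a b : ℕ) (B : ℝ) : Prop :=
  ∀ ξ η t, pInj (k := k) p t → Kint k X p Q a b ξ η t ≤ B

def KSB (k X p Q : ℕ) [NeZero Q] (a b : ℕ) (B : ℝ) : Prop :=
  ∀ ξ η (t u : Fin k → ℤ), pInj (k := k) p t → pInj p u →
    ∑ α : Fin k → ZMod Q, (∏ i, ‖vF Q (cls X p (a + 1) (ξ + (p : ℤ) ^ a * t i)) α‖ ^ 2) *
        (∏ i, ‖vF Q (cls X p (b + 1) (η + (p : ℤ) ^ b * u i)) α‖ ^ (2 * k)) ≤ B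

/-- induction hypothesis package -/
def IHB (k X p Q H : ℕ) [NeZero Q] (M e : ℝ) : Prop :=
  ∀ b, 1 ≤ b → b ≤ H → ∀ η, ∑ α : Fin k → ZMod Q, ‖vF Q (cls X p b η) α‖ ^ (2 * (k * (k + 1))) ≤
    M * (p : ℝ) ^ (1 - e * b)

lemma rpow_mix {M P : ℝ} (hM : 0 < M) (hP : 0 < P) (x y θ : ℝ) :
    (M * P ^ x) ^ θ * (M * P ^ y) ^ (1 - θ) = M * P ^ (θ * x + (1 - θ) * y) := by
  rw [mul_rpow hM.le (by positivity), mul_rpow hM.le (by positivity), ← rpow_mul hP.le,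
    ← rpow_mul hP.le, rpow_add hP, mul_comm x, mul_comm y]
  have : M ^ θ * M ^ (1 - θ) = M := by rw [← rpow_add hM]; simp
  linear_combination (P ^ (θ * x) * P ^ ((1 - θ) * y)) * this

lemma kb_triv {k X p Q H : ℕ} [NeZero Q] {M e : ℝ} (hk : 2 ≤ k) (hM : 0 < M) (hp : 0 < p)
    (ih : IHB k X p Q H M e) {a b : ℕ} (ha : a + 1 ≤ H) (hb1 : 1 ≤ b) (hb : b ≤ H) (he : 0 ≤ e) :
    KB k X p Q a b (M * (p : ℝ) ^ (1 - e * (a + k * b) / (k + 1))) := by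
  intro ξ η t _
  have hP : (1 : ℝ) ≤ p := by exact_mod_cast hp
  have hk0 : (0 : ℝ) < k := by positivity
  set B := M * (p : ℝ) ^ (1 - e * (a + k * b) / (k + 1)) with hB
  have h1 : ∀ i : Fin k, ∑ α : Fin k → ZMod Q, ‖vF Q (cls X p (a + 1) (ξ + (p : ℤ) ^ a * t i)) α‖ ^ (2 * k) *
    ‖vF Q (cls X p b η) α‖ ^ (k * (2 * k)) ≤ B := by
    intro i
    have hw := holder_w univ (fun α : Fin k → ZMod Q =>
        ‖vF Q (cls X p (a + 1) (ξ + (p : ℤ) ^ a * t i)) α‖ ^ (2 * (k * (k + 1))))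
      (fun α => ‖vF Q (cls X p b η) α‖ ^ (2 * (k * (k + 1)))) (fun _ => by positivity) (fun _ => by positivity)
      (1 / (k + 1)) (by positivity) (by rw [div_lt_one (by positivity)]; linarith)
    have e1 : ∀ r : ℝ, 0 ≤ r → (r ^ (2 * (k * (k + 1)))) ^ (1 / (k + 1) : ℝ) = r ^ (2 * k) := by
      intro r hr
      rw [← rpow_natCast, ← rpow_mul hr, ← rpow_natCast]
      congr 1; push_cast; field_simp
    have e2 : ∀ r : ℝ, 0 ≤ r → (r ^ (2 * (k * (k + 1)))) ^ (1 - 1 / (k + 1) : ℝ) = r ^ (k * (2 * k)) := by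
      intro r hr
      rw [← rpow_natCast, ← rpow_mul hr, ← rpow_natCast]
      congr 1; push_cast; field_simp; ring
    simp only [e1 _ (norm_nonneg _), e2 _ (norm_nonneg _)] at hw
    refine hw.trans ?_
    have hθ : (0 : ℝ) ≤ 1 - 1 / (k + 1) := by
      rw [sub_nonneg, div_le_one (by positivity)]; linarith
    refine (mul_le_mul (rpow_le_rpow (sum_nonneg fun _ _ => by positivity)
      (ih (a + 1) (by omega) ha _) (by positivity)) (rpow_le_rpow (sum_nonneg fun _ _ => by positivity)
      (ih b hb1 hb _) hθ) (by positivity) (by positivity)).trans ?_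
    rw [rpow_mix hM (by positivity), hB]
    apply mul_le_mul_of_nonneg_left _ hM.le
    apply rpow_le_rpow_of_exponent_le hP
    push_cast
    have : (1 / ((k : ℝ) + 1)) * (1 - e * (a + 1)) + (1 - 1 / (k + 1)) * (1 - e * b)
      = 1 - e * (a + k * b) / (k + 1) - e / (k + 1) := by field_simp; ring
    rw [this]
    have : 0 ≤ e / (k + 1) := by positivity
    linarith
  unfold Kint
  calc _ ≤ ∑ α : Fin k → ZMod Q, (1 / k : ℝ) * ∑ i, (‖vF Q (cls X p (a + 1) (ξ + (p : ℤ) ^ a * t i)) α‖ ^ (2 * k) *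
    ‖vF Q (cls X p b η) α‖ ^ (k * (2 * k))) := by
        apply sum_le_sum
        intro α _
        rw [← sum_mul, ← mul_assoc (1 / (k : ℝ))]
        apply mul_le_mul_of_nonneg_right _ (by positivity)
        refine (amgm_prod (by omega) _ (fun i => by positivity)).trans (le_of_eq ?_)
        simp only [← pow_mul]
    _ = (1 / k : ℝ) * ∑ i, ∑ α : Fin k → ZMod Q, (‖vF Q (cls X p (a + 1) (ξ + (p : ℤ) ^ a * t i)) α‖ ^ (2 * k) *
    ‖vF Q (cls X p b η) α‖ ^ (k * (2 * k))) := by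
        rw [← mul_sum, sum_comm]
    _ ≤ (1 / k : ℝ) * ∑ i : Fin k, B := by
        apply mul_le_mul_of_nonneg_left (sum_le_sum fun i _ => h1 i) (by positivity)
    _ = B := by simp; field_simp

lemma ksb_of_kb {k X p Q H : ℕ} [NeZero Q] {M e E : ℝ} (hk : 2 ≤ k) (hM : 0 < M) (hp : p.Prime) (hkp : k < p)
    (ih : IHB k X p Q H M e) {a b : ℕ} (hab : a < b) (hb : b + 1 ≤ H)
    (hQ : (k + k * k) * X ^ k < Q)
    (hK : KB k X p Q b (k * b) (M * (p : ℝ) ^ E)) :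
    KSB k X p Q a b (M * (p : ℝ) ^ ((k * (k - 1) / 2 : ℝ) * (a + b) + k * (k * b - a - 1) + (1 / k) * E
      + (1 - 1 / k) * (1 - e * (b + 1)))) := by
  intro ξ η t u ht hu
  have hPpos : (0 : ℝ) < p := by exact_mod_cast hp.pos
  have hk0 : (0 : ℝ) < k := by positivity
  have : NeZero (p ^ (k * b)) := ⟨(pow_pos hp.pos _).ne'⟩
  set B := M * (p : ℝ) ^ ((1 / k) * E + (1 - 1 / k) * (1 - e * (b + 1))) with hB
  have hBpos : 0 < B := by positivity
  set G : (Fin k → ZMod Q) → ℝ := fun α => ∏ i, ‖vF Q (cls X p (b + 1) (η + (p : ℤ) ^ b * u i)) α‖ with hG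
  have hG0 : ∀ α, 0 ≤ G α := fun α => prod_nonneg fun i _ => norm_nonneg _
  have hGn : ∀ α n, ∏ i, ‖vF Q (cls X p (b + 1) (η + (p : ℤ) ^ b * u i)) α‖ ^ n = G α ^ n := by
    intro α n; rw [hG, prod_pow]
  have hG2 : ∑ α, G α ^ (2 * k + 2) ≤ M * (p : ℝ) ^ (1 - e * (b + 1)) := by
    calc ∑ α, G α ^ (2 * k + 2) ≤ ∑ α, (1 / k : ℝ) * ∑ i, ‖vF Q (cls X p (b + 1) (η + (p : ℤ) ^ b * u i)) α‖ ^ (2 * (k * (k + 1))) := by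
          apply sum_le_sum
          intro α _
          rw [← hGn]
          refine (amgm_prod (by omega) _ (fun i => by positivity)).trans (le_of_eq ?_)
          simp only [← pow_mul]
          congr 1; apply sum_congr rfl; intro i _; congr 1; ring
      _ = (1 / k : ℝ) * ∑ i, ∑ α, ‖vF Q (cls X p (b + 1) (η + (p : ℤ) ^ b * u i)) α‖ ^ (2 * (k * (k + 1))) := by
          rw [← mul_sum, sum_comm]
      _ ≤ (1 / k : ℝ) * ∑ i : Fin k, M * (p : ℝ) ^ (1 - e * (b + 1)) := by
          apply mul_le_mul_of_nonneg_left (sum_le_sum fun i _ => ?_) (by positivity)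
          have := ih (b + 1) (by omega) hb (η + (p : ℤ) ^ b * u i)
          push_cast at this
          exact this
      _ = _ := by simp; field_simp
  have h1 : ∀ ω : ℤ, ∑ α : Fin k → ZMod Q, ‖vF Q (cls X p (k * b) ω) α‖ ^ (2 * k) * G α ^ (2 * k) ≤ B := by
    intro ω
    have hw := holder_w univ (fun α : Fin k → ZMod Q =>
        ‖vF Q (cls X p (k * b) ω) α‖ ^ (k * (2 * k)) * G α ^ 2)
      (fun α => G α ^ (2 * k + 2)) (fun α => by have := hG0 α; positivity) (fun α => by have := hG0 α; positivity)
      (1 / k) (by positivity) (by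
        rw [div_lt_one (by positivity)]; exact_mod_cast (by omega : 1 < k))
    have e1 : ∀ r g : ℝ, 0 ≤ r → 0 ≤ g → (r ^ (k * (2 * k)) * g ^ 2) ^ (1 / k : ℝ) * (g ^ (2 * k + 2)) ^ (1 - 1 / k : ℝ)
        = r ^ (2 * k) * g ^ (2 * k) := by
      intro r g hr hg
      rw [mul_rpow (by positivity) (by positivity), ← rpow_natCast r, ← rpow_mul hr, mul_assoc]
      rcases hg.eq_or_lt with h0 | h0
      · subst h0
        rw [zero_pow (by norm_num), zero_rpow (by positivity), zero_pow (by omega : 2 * k ≠ 0)]; simp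
      rw [← rpow_natCast g, ← rpow_natCast g, ← rpow_mul hg, ← rpow_mul hg, ← rpow_add h0,
        ← rpow_natCast, ← rpow_natCast]
      congr 2
      · push_cast; field_simp
      · push_cast; field_simp; ring
    simp only [e1 _ _ (norm_nonneg _) (hG0 _)] at hw
    refine hw.trans ?_
    have hθ : (0 : ℝ) ≤ 1 - 1 / k := by
      rw [sub_nonneg, div_le_one (by positivity)]; exact_mod_cast (by omega : 1 ≤ k)
    have hKK : ∑ α : Fin k → ZMod Q, ‖vF Q (cls X p (k * b) ω) α‖ ^ (k * (2 * k)) * G α ^ 2 ≤ M * (p : ℝ) ^ E := by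
      have := hK η ω u hu
      unfold Kint at this
      simp only [hGn] at this
      refine (le_of_eq ?_).trans this
      exact sum_congr rfl fun α _ => mul_comm _ _
    refine (mul_le_mul (rpow_le_rpow (sum_nonneg fun α _ => by have := hG0 α; positivity) hKK (by positivity))
      (rpow_le_rpow (sum_nonneg fun α _ => by have := hG0 α; positivity) hG2 hθ)
      (rpow_nonneg (sum_nonneg fun α _ => by have := hG0 α; positivity) _) (by positivity)).trans ?_
    rw [rpow_mix hM hPpos]
  have h2 := kstar_orth (X := X) (Q := Q) hp hkp hk hab ξ η t u ht hQ
  refine h2.trans ?_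
  have h3 : ∀ ω : Fin k → ZMod (p ^ (k * b)), ∑ α : Fin k → ZMod Q, (∏ i, ‖vF Q (cls X p (k * b) ((ω i).val : ℤ)) α‖ ^ 2) *
        (∏ i, ‖vF Q (cls X p (b + 1) (η + (p : ℤ) ^ b * u i)) α‖ ^ (2 * k)) ≤ B := by
    intro ω
    simp only [hGn]
    calc _ ≤ ∑ α : Fin k → ZMod Q, (1 / k : ℝ) * ∑ i, (‖vF Q (cls X p (k * b) ((ω i).val : ℤ)) α‖ ^ (2 * k) * G α ^ (2 * k)) := by
          apply sum_le_sum
          intro α _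
          rw [← sum_mul, ← mul_assoc (1 / (k : ℝ))]
          apply mul_le_mul_of_nonneg_right _ (by have := hG0 α; positivity)
          refine (amgm_prod (by omega) _ (fun i => by positivity)).trans (le_of_eq ?_)
          simp only [← pow_mul]
      _ = (1 / k : ℝ) * ∑ i, ∑ α : Fin k → ZMod Q, (‖vF Q (cls X p (k * b) ((ω i).val : ℤ)) α‖ ^ (2 * k) * G α ^ (2 * k)) := by
          rw [← mul_sum, sum_comm]
      _ ≤ (1 / k : ℝ) * ∑ i : Fin k, B := by
          apply mul_le_mul_of_nonneg_left (sum_le_sum fun i _ => h1 _) (by positivity)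
      _ = B := by simp; field_simp
  have hle : a + 1 ≤ k * b := by nlinarith
  have h4 : ((Fintype.piFinset (fun i => refi p (k * b) (a + 1) (ξ + (p : ℤ) ^ a * t i))).card : ℝ)
      ≤ (p : ℝ) ^ (k * (k * b - (a + 1))) := by
    rw [Fintype.card_piFinset]
    have : ∏ i : Fin k, (refi p (k * b) (a + 1) (ξ + (p : ℤ) ^ a * t i)).card ≤ ∏ i : Fin k, p ^ (k * b - (a + 1)) :=
      prod_le_prod (fun _ _ => Nat.zero_le _) fun i _ => refi_card p _ _ hp.pos hle _
    rw [prod_const, card_univ, Fintype.card_fin, ← pow_mul, mul_comm _ k] at this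
    exact_mod_cast this
  have h5 : ∑ ω ∈ Fintype.piFinset (fun i => refi p (k * b) (a + 1) (ξ + (p : ℤ) ^ a * t i)),
          ∑ α : Fin k → ZMod Q, (∏ i, ‖vF Q (cls X p (k * b) ((ω i).val : ℤ)) α‖ ^ 2) *
        (∏ i, ‖vF Q (cls X p (b + 1) (η + (p : ℤ) ^ b * u i)) α‖ ^ (2 * k)) ≤ (p : ℝ) ^ (k * (k * b - (a + 1))) * B := by
    refine (sum_le_card_nsmul _ _ B fun ω _ => h3 ω).trans ?_
    rw [nsmul_eq_mul]
    exact mul_le_mul_of_nonneg_right h4 hBpos.le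
  refine (mul_le_mul_of_nonneg_left h5 (by positivity)).trans (le_of_eq ?_)
  rw [hB]
  push_cast
  rw [← rpow_natCast, ← rpow_natCast]
  have e3 : (((k * (k - 1) / 2 * (a + b) : ℕ)) : ℝ) = (k * (k - 1) / 2 : ℝ) * (a + b) := by
    push_cast
    rw [Nat.cast_div (Nat.even_mul_pred_self k).two_dvd (by norm_num)]
    push_cast [Nat.cast_sub (by omega : 1 ≤ k)]
    ring
  have e4 : (((k * (k * b - (a + 1)) : ℕ)) : ℝ) = k * (k * b - a - 1) := by
    push_cast [Nat.cast_sub hle]; ring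
  rw [e3, e4]
  have e5 : ∀ x y z : ℝ, (p : ℝ) ^ x * ((p : ℝ) ^ y * (M * (p : ℝ) ^ z)) = M * (p : ℝ) ^ (x + y + z) := by
    intro x y z; rw [rpow_add hPpos, rpow_add hPpos]; ring
  rw [e5]
  congr 2; ring

lemma kb_step {k X p Q : ℕ} [NeZero Q] {M E E1 E2 : ℝ} (hk : 2 ≤ k) (hM : 0 < M)
    (hp1 : 2 ≤ p) (hpk : (2 * k) ^ (k * (2 * k)) ≤ p) {a b : ℕ}
    (h1 : KB k X p Q a (b + 1) (M * (p : ℝ) ^ E1)) (h2 : KSB k X p Q a b (M * (p : ℝ) ^ E2))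
    (hE1 : E1 + 3 ≤ E) (hE2 : E2 + (2 * k ^ 2 + k + 2) ≤ E) : KB k X p Q a b (M * (p : ℝ) ^ E) := by
  intro ξ η t ht
  have hP : (2 : ℝ) ≤ p := by exact_mod_cast hp1
  have hP0 : (0 : ℝ) < p := by linarith
  unfold Kint
  set A : (Fin k → ZMod Q) → ℝ := fun α => ∏ i, ‖vF Q (cls X p (a + 1) (ξ + (p : ℤ) ^ a * t i)) α‖ ^ 2 with hA
  have hA0 : ∀ α, 0 ≤ A α := fun α => prod_nonneg fun i _ => by positivity
  set g : Fin p → (Fin k → ZMod Q) → ℝ := fun r α => ‖vF Q (cls X p (b + 1) (η + (p : ℤ) ^ b * (r : ℕ))) α‖ with hg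
  set S := (univ : Finset (Fin k → Fin p)).filter (fun t => Function.Injective t) with hS
  have hbn : ∀ α, A α * ‖vF Q (cls X p b η) α‖ ^ (k * (2 * k)) ≤
      (2 * k : ℝ) ^ (k * (2 * k)) * ∑ r, A α * g r α ^ (k * (2 * k)) +
      (2 * p : ℝ) ^ (k * (2 * k)) * ∑ r ∈ S, A α * ∏ i, g (r i) α ^ (2 * k) := by
    intro α
    have := broad_narrow (k := k) (p := p) (n := 2 * k) (by omega) (by omega) (by omega) (fun r => g r α)
      (fun r => norm_nonneg _) ‖vF Q (cls X p b η) α‖ (norm_nonneg _) (by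
        rw [cls_split X p b (by omega) η α]; exact norm_sum_le _ _)
    have := mul_le_mul_of_nonneg_left this (hA0 α)
    rw [← mul_sum, ← mul_sum]
    refine this.trans (le_of_eq ?_)
    ring
  refine (sum_le_sum fun α _ => hbn α).trans ?_
  rw [sum_add_distrib, ← mul_sum, ← mul_sum, sum_comm]
  rw [sum_comm (t := S)]
  have c1 : ∑ r : Fin p, ∑ α, A α * g r α ^ (k * (2 * k)) ≤ p * (M * (p : ℝ) ^ E1) := by
    refine (sum_le_card_nsmul _ _ (M * (p : ℝ) ^ E1) fun r _ => ?_).trans ?_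
    · exact h1 ξ (η + (p : ℤ) ^ b * (r : ℕ)) t ht
    · simp
  have c2 : ∑ r ∈ S, ∑ α, A α * ∏ i, g (r i) α ^ (2 * k) ≤ (p : ℝ) ^ k * (M * (p : ℝ) ^ E2) := by
    refine (sum_le_card_nsmul _ _ (M * (p : ℝ) ^ E2) fun r hr => ?_).trans ?_
    · refine h2 ξ η t (fun i => ((r i : ℕ) : ℤ)) ht ?_
      intro i l hil hdv
      simp only at hdv
      have hr' := (mem_filter.1 hr).2
      apply hil
      apply hr'
      have := Int.eq_zero_of_abs_lt_dvd hdv (by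
        have := (r i).2; have := (r l).2
        rw [abs_lt]; constructor <;> omega)
      apply Fin.ext; omega
    · rw [nsmul_eq_mul]
      apply mul_le_mul_of_nonneg_right _ (by positivity)
      have := card_le_univ S
      rw [Fintype.card_fun, Fintype.card_fin, Fintype.card_fin] at this
      exact_mod_cast this
  have hpk' : (2 * k : ℝ) ^ (k * (2 * k)) ≤ p := by exact_mod_cast hpk
  have h2pk : (2 : ℝ) ^ (k * (2 * k)) ≤ p := by
    refine le_trans (pow_le_pow_left₀ (by norm_num) ?_ _) hpk'
    have : (1 : ℝ) ≤ k := by exact_mod_cast (by omega : 1 ≤ k)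
    linarith
  have d1 : (2 * k : ℝ) ^ (k * (2 * k)) * ∑ r : Fin p, ∑ α, A α * g r α ^ (k * (2 * k)) ≤ M * (p : ℝ) ^ E / 2 := by
    calc _ ≤ (p : ℝ) * (p * (M * (p : ℝ) ^ E1)) := mul_le_mul hpk' c1 (sum_nonneg fun r _ => sum_nonneg fun α _ => mul_nonneg (hA0 α) (by positivity)) (by positivity)
      _ = M * (p : ℝ) ^ (E1 + 3) / p := by
        rw [rpow_add hP0, show (3 : ℝ) = ((3 : ℕ) : ℝ) by norm_num, rpow_natCast]; field_simp
      _ ≤ M * (p : ℝ) ^ (E1 + 3) / 2 := by gcongr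
      _ ≤ M * (p : ℝ) ^ E / 2 := by gcongr; linarith
  have d2 : (2 * p : ℝ) ^ (k * (2 * k)) * ∑ r ∈ S, ∑ α, A α * ∏ i, g (r i) α ^ (2 * k) ≤ M * (p : ℝ) ^ E / 2 := by
    calc _ ≤ ((p : ℝ) * (p : ℝ) ^ (k * (2 * k))) * ((p : ℝ) ^ k * (M * (p : ℝ) ^ E2)) := by
            apply mul_le_mul _ c2 (sum_nonneg fun r _ => sum_nonneg fun α _ => mul_nonneg (hA0 α) (prod_nonneg fun i _ => by positivity)) (by positivity)
            rw [mul_pow]; exact mul_le_mul_of_nonneg_right h2pk (by positivity)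
      _ = M * (p : ℝ) ^ (E2 + (2 * k ^ 2 + k + 2)) / p := by
        rw [rpow_add hP0, show (2 * k ^ 2 + k + 2 : ℝ) = ((k * (2 * k) + k + 2 : ℕ) : ℝ) by push_cast; ring, rpow_natCast]; field_simp
        ring
      _ ≤ M * (p : ℝ) ^ (E2 + (2 * k ^ 2 + k + 2)) / 2 := by gcongr
      _ ≤ M * (p : ℝ) ^ E / 2 := by gcongr; linarith
  linarith

def vE (k : ℕ) (Δ : ℝ) (n : ℕ) (a b : ℝ) : ℝ :=
  -2 * k * a - 2 * k ^ 2 * b + k * (k + 1) / 2 * a + (k ^ 2 / 2 - n * (1 - 1 / k) * Δ) * b + (4 * k ^ 2 + 2 * k + 4)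

set_option maxHeartbeats 1600000 in
lemma kb_claim {k X p Q H : ℕ} [NeZero Q] {M Δ : ℝ} (hk : 2 ≤ k) (hM : 0 < M) (hp : p.Prime) (hkp : k < p)
    (hpk : (2 * k) ^ (k * (2 * k)) ≤ p) (hΔ : 0 < Δ)
    (ih : IHB k X p Q H M (3 / 2 * k * (k + 1) + Δ)) (hQ : (k + k * k) * X ^ k < Q) (n : ℕ)
    (hn : (n : ℝ) * (1 - 1 / k) * Δ ≤ 14 * k ^ 2) :
    ∀ a b : ℕ, a < b → (21 * k) ^ n * b ≤ H → KB k X p Q a b (M * (p : ℝ) ^ vE k Δ n a b) := by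
  have hk' : (2 : ℝ) ≤ k := by exact_mod_cast hk
  have hP : (1 : ℝ) ≤ p := by exact_mod_cast hp.one_lt.le
  have hinv : (1 : ℝ) / k ≤ 1 / 2 := by gcongr
  have hinv0 : (0 : ℝ) < 1 / k := by positivity
  have mono : ∀ {a b : ℕ} {E E' : ℝ}, E ≤ E' → KB k X p Q a b (M * (p : ℝ) ^ E) → KB k X p Q a b (M * (p : ℝ) ^ E') := by
    intro a b E E' h hK ξ η t ht
    refine (hK ξ η t ht).trans ?_
    gcongr
  have htriv : ∀ a b : ℝ, 0 ≤ a → 0 ≤ b → 1 - (3 / 2 * k * (k + 1) + Δ) * (a + k * b) / (k + 1) ≤ 1 - 3 / 2 * k * (a + k * b) := by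
    intro a b ha hb
    have : (3 / 2 * k * (k + 1) + Δ) * (a + k * b) / (k + 1) = 3 / 2 * k * (a + k * b) + Δ * (a + k * b) / (k + 1) := by
      field_simp
    rw [this]
    have : 0 ≤ Δ * (a + k * b) / (k + 1) := by positivity
    linarith
  have mono2 : ∀ {a b : ℕ} {E E' : ℝ}, E ≤ E' → KSB k X p Q a b (M * (p : ℝ) ^ E) → KSB k X p Q a b (M * (p : ℝ) ^ E') := by
    intro a b E E' h hK ξ η t u ht hu
    refine (hK ξ η t u ht hu).trans ?_
    gcongr
  induction n with
  | zero =>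
    intro a b hab hb
    rw [pow_zero, one_mul] at hb
    have h0 := kb_triv hk hM hp.pos ih (a := a) (b := b) (by omega) (by omega) hb (by positivity)
    refine mono ((htriv a b (by positivity) (by positivity)).trans ?_) h0
    unfold vE
    have ha : (0 : ℝ) ≤ a := by positivity
    have : 0 ≤ (k : ℝ) ^ 2 / 2 * a := by positivity
    push_cast
    nlinarith
  | succ n ihn =>
    have hn0 : (0 : ℝ) ≤ (n : ℝ) * (1 - 1 / k) * Δ := mul_nonneg (mul_nonneg (by positivity) (by linarith)) hΔ.le
    have hΔ' : 0 ≤ (1 - 1 / k) * Δ := mul_nonneg (by linarith) hΔ.le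
    have hn' : (n : ℝ) * (1 - 1 / k) * Δ ≤ 14 * k ^ 2 := by push_cast at hn; nlinarith
    have ihn := ihn hn'
    intro a b hab hb
    have hb2 : (21 * k) ^ n * (k * (21 * b)) ≤ H := by
      rw [pow_succ] at hb; refine le_trans (le_of_eq ?_) hb; ring
    have hb3 : 21 * b ≤ H := by
      refine le_trans ?_ hb2
      calc 21 * b ≤ k * (21 * b) := Nat.le_mul_of_pos_left _ (by omega)
        _ ≤ _ := Nat.le_mul_of_pos_left _ (by positivity)
    set B : ℝ := k ^ 2 / 2 - ((n + 1 : ℕ) : ℝ) * (1 - 1 / k) * Δ with hB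
    have hBup : B ≤ k ^ 2 / 2 := by
      have : (0 : ℝ) ≤ ((n + 1 : ℕ) : ℝ) * (1 - 1 / k) * Δ := mul_nonneg (mul_nonneg (by positivity) (by linarith)) hΔ.le
      linarith
    have hBlo : -14 * (k : ℝ) ^ 2 ≤ B := by nlinarith [sq_nonneg (k : ℝ)]
    have hbR : (1 : ℝ) ≤ b := by exact_mod_cast (by omega : 1 ≤ b)
    have main : ∀ j b' : ℕ, b' + j = 21 * b → b ≤ b' →
        KB k X p Q a b' (M * (p : ℝ) ^ (vE k Δ (n + 1) a b - 3 * ((b' : ℝ) - b))) := by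
      intro j
      induction j with
      | zero =>
        intro b' hb' hbb
        have hb'' : b' = 21 * b := by omega
        subst hb''
        have h0 := kb_triv hk hM hp.pos ih (a := a) (b := 21 * b) (by omega) (by omega) hb3 (by positivity)
        refine mono ((htriv a _ (by positivity) (by positivity)).trans ?_) h0
        unfold vE
        rw [← hB]
        push_cast
        have ha : (0 : ℝ) ≤ a := by positivity
        have : 0 ≤ (k : ℝ) ^ 2 / 2 * a := by positivity
        have h1 : 0 ≤ (B + 14 * (k : ℝ) ^ 2) * b := mul_nonneg (by linarith) (by linarith)
        have h2 : 0 ≤ ((k : ℝ) ^ 2 - 4) * b := mul_nonneg (by nlinarith) (by linarith)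
        nlinarith
      | succ j ihj =>
        intro b' hb' hbb
        have hs1 := ihj (b' + 1) (by omega) (by omega)
        have hb4 : (21 * k) ^ n * (k * b') ≤ H := by
          refine le_trans ?_ hb2
          gcongr; omega
        have hKn := ihn b' (k * b') (by nlinarith) hb4
        have hs2 := ksb_of_kb hk hM hp hkp ih (a := a) (b := b') (by omega) (by omega) hQ hKn
        have hid : (k * (k - 1) / 2 : ℝ) * (a + b') + k * (k * b' - a - 1) + (1 / k) * vE k Δ n b' ((k * b' : ℕ) : ℝ)
            + (1 - 1 / k) * (1 - (3 / 2 * k * (k + 1) + Δ) * (b' + 1)) = vE k Δ (n + 1) a b'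
            - (4 * k ^ 2 + 2 * k + 4) + (1 / k) * (4 * k ^ 2 + 2 * k + 4) - k + (1 - 1 / k) * (1 - (3 / 2 * k * (k + 1) + Δ)) := by
          unfold vE
          push_cast
          field_simp
          ring
        rw [hid] at hs2
        refine kb_step hk hM hp.two_le hpk hs1 hs2 (by push_cast; linarith) ?_
        have h1 : (1 / k : ℝ) * (4 * k ^ 2 + 2 * k + 4) ≤ 1 / 2 * (4 * k ^ 2 + 2 * k + 4) := by gcongr
        have h2 : (1 - 1 / k : ℝ) * (1 - (3 / 2 * k * (k + 1) + Δ)) ≤ 0 :=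
          mul_nonpos_of_nonneg_of_nonpos (by linarith) (by
            have : (4 : ℝ) ≤ k * k := by nlinarith
            linarith)
        have h3 : vE k Δ (n + 1) a b' ≤ vE k Δ (n + 1) a b - 3 * ((b' : ℝ) - b) := by
          unfold vE
          rw [← hB]
          have hbb' : (0 : ℝ) ≤ (b' : ℝ) - b := by
            have : (b : ℝ) ≤ b' := by exact_mod_cast hbb
            linarith
          have : 0 ≤ (2 * (k : ℝ) ^ 2 - B - 3) * ((b' : ℝ) - b) := mul_nonneg (by nlinarith) hbb'
          nlinarith
        linarith
    have := main (20 * b) b (by omega) le_rfl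
    simpa using this

lemma vJ_le_triv (k s : ℕ) (A : Finset ℤ) : vJ k s A ≤ A.card ^ (2 * s) := by
  unfold vJ vPairs
  refine (card_filter_le _ _).trans ?_
  rw [card_product]
  simp [two_mul, pow_add]

set_option maxHeartbeats 3200000 in
theorem vmvt (k : ℕ) (hk : 2 ≤ k) (Δ : ℝ) (hΔ : 0 < Δ) (hΔ1 : Δ ≤ 1) :
    ∃ A : ℝ, 0 < A ∧ ∀ X : ℕ, (vJ k (k * (k + 1)) (Ico 0 (X : ℤ)) : ℝ) ≤
      A * (X : ℝ) ^ (3 / 2 * k * (k + 1) + Δ : ℝ) := by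
  set e : ℝ := 3 / 2 * k * (k + 1) + Δ with he
  have hk' : (2 : ℝ) ≤ k := by exact_mod_cast hk
  have he9 : 9 ≤ e := by rw [he]; nlinarith
  obtain ⟨p, hpbig, hp⟩ := Nat.exists_infinite_primes
    (max ((2 * k) ^ (2 * (k * (k + 1)))) (⌈(2 : ℝ) ^ e⌉₊ + 2))
  have hp1 : (2 * k) ^ (2 * (k * (k + 1))) ≤ p := (le_max_left _ _).trans hpbig
  have hp2 : (2 : ℝ) ^ e ≤ p := (Nat.le_ceil _).trans (by
    exact_mod_cast (by have := (le_max_right ((2 * k) ^ (2 * (k * (k + 1)))) (⌈(2 : ℝ) ^ e⌉₊ + 2)).trans hpbig; omega : ⌈(2 : ℝ) ^ e⌉₊ ≤ p))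
  have hpk : (2 * k) ^ (k * (2 * k)) ≤ p := by
    refine le_trans (Nat.pow_le_pow_right (by omega) ?_) hp1
    nlinarith
  have hkp : k < p := by
    refine lt_of_lt_of_le ?_ hp1
    calc k < (2 * k) ^ 1 := by rw [pow_one]; omega
      _ ≤ _ := Nat.pow_le_pow_right (by omega) (by nlinarith)
  have hinv : (1 : ℝ) / k ≤ 1 / 2 := by gcongr
  have hinv0 : (0 : ℝ) < 1 / k := by positivity
  have hstep : 0 < (1 - 1 / k : ℝ) * Δ := mul_pos (by linarith) hΔ
  -- number of steps
  set N := ⌈((k : ℝ) ^ 2 / 2 + (4 * k ^ 2 + 5 * k + 6)) / ((1 - 1 / k : ℝ) * Δ)⌉₊ with hN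
  have hN1 : (k : ℝ) ^ 2 / 2 + (4 * k ^ 2 + 5 * k + 6) ≤ N * (1 - 1 / k) * Δ := by
    have := Nat.le_ceil (((k : ℝ) ^ 2 / 2 + (4 * k ^ 2 + 5 * k + 6)) / ((1 - 1 / k : ℝ) * Δ))
    rw [div_le_iff₀ hstep] at this
    rw [mul_assoc]; exact this
  have hN2 : N * (1 - 1 / k) * Δ ≤ 14 * (k : ℝ) ^ 2 := by
    have := Nat.ceil_lt_add_one (a := ((k : ℝ) ^ 2 / 2 + (4 * k ^ 2 + 5 * k + 6)) / ((1 - 1 / k : ℝ) * Δ)) (by positivity)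
    rw [← hN] at this
    have h2 := mul_lt_mul_of_pos_right this hstep
    rw [add_mul, div_mul_cancel₀ _ hstep.ne'] at h2
    have : (1 - 1 / k : ℝ) * Δ ≤ 1 := by
      calc _ ≤ (1 : ℝ) * 1 := mul_le_mul (by linarith) hΔ1 hΔ.le (by norm_num)
        _ = 1 := by norm_num
    rw [mul_assoc]
    nlinarith
  set H := (21 * k) ^ N with hH
  have hH1 : 1 ≤ H := Nat.one_le_pow _ _ (by omega)
  have hP2 : (2 : ℝ) ≤ p := by exact_mod_cast hp.two_le
  have hP0 : (0 : ℝ) < p := by linarith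
  set s := k * (k + 1) with hs
  refine ⟨((p : ℝ) ^ (H + 1)) ^ (2 * s), by positivity, ?_⟩
  set A : ℝ := ((p : ℝ) ^ (H + 1)) ^ (2 * s) with hA
  have hA0 : 0 < A := by positivity
  intro X
  induction X using Nat.strong_induction_on with
  | _ X ihX =>
  rcases Nat.eq_zero_or_pos X with rfl | hX0
  · refine le_trans (Nat.cast_le.2 (vJ_le_triv _ _ _)) ?_
    have : 2 * s ≠ 0 := by rw [hs]; positivity
    simp [this]; positivity
  have hX1 : (1 : ℝ) ≤ X := by exact_mod_cast hX0
  rcases lt_or_ge X (p ^ (H + 1)) with hsm | hbig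
  · have h1 : (vJ k s (Ico 0 (X : ℤ)) : ℝ) ≤ A := by
      refine le_trans (Nat.cast_le.2 (vJ_le_triv _ _ _)) ?_
      rw [hA]
      push_cast
      apply pow_le_pow_left₀ (by positivity)
      simp only [Int.card_Ico, sub_zero, Int.toNat_natCast]
      exact_mod_cast hsm.le
    have h2 : (1 : ℝ) ≤ (X : ℝ) ^ e := one_le_rpow hX1 (by linarith)
    nlinarith
  -- main case
  set Q := (k + k * k) * X ^ k + 1 with hQ
  have hQs : s * X ^ k < Q := by rw [hQ, hs]; nlinarith
  have hQ0 : NeZero Q := ⟨by omega⟩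
  set M : ℝ := (Q : ℝ) ^ k * (A * (X : ℝ) ^ e) with hM
  have hQpos : (0 : ℝ) < Q := by exact_mod_cast (by omega : 0 < Q)
  have hM0 : 0 < M := by positivity
  have ih : IHB k X p Q H M e := by
    intro b hb1 hbH η
    rw [v_moment (X := X) _ (cls_sub _ _ _ _) hQs]
    set Y := X / p ^ b + 1 with hY
    have hpb : p ^ (b + 1) ≤ X := (Nat.pow_le_pow_right hp.pos (by omega)).trans hbig
    have hYX : Y < X := by
      have h1 : X / p ^ b * p ^ b ≤ X := Nat.div_mul_le_self _ _
      have h2 : 2 ≤ p ^ b := le_trans hp.two_le (Nat.le_self_pow (by omega) p)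
      have h3 : 4 ≤ p ^ (b + 1) := by rw [pow_succ]; nlinarith [hp.two_le]
      have h4 : X / p ^ b * 2 ≤ X := le_trans (Nat.mul_le_mul_left _ h2) h1
      omega
    have haff : vJ k s (cls X p b η) ≤ vJ k s (Ico 0 (Y : ℤ)) := by
      have hpz : (0 : ℤ) < (p : ℤ) ^ b := by have := hp.pos; positivity
      apply v_affine _ _ ((p : ℤ) ^ b) (η % (p : ℤ) ^ b) hpz.ne'
      intro z hz
      simp only [cls, mem_filter, mem_Ico] at hz
      obtain ⟨⟨hz0, hzX⟩, hdv⟩ := hz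
      have hm : z % (p : ℤ) ^ b = η % (p : ℤ) ^ b := (Int.ModEq.symm (Int.modEq_of_dvd hdv))
      refine ⟨z / (p : ℤ) ^ b, ?_, ?_⟩
      · rw [mem_Ico]
        refine ⟨Int.ediv_nonneg hz0 hpz.le, ?_⟩
        have : z / (p : ℤ) ^ b ≤ (X : ℤ) / (p : ℤ) ^ b := Int.ediv_le_ediv hpz hzX.le
        rw [hY]; push_cast; omega
      · rw [← hm, Int.emod_add_mul_ediv]
    have h1 := ihX Y hYX
    have hYle : (Y : ℝ) ≤ 2 * (X / (p : ℝ) ^ b) := by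
      rw [hY]; push_cast
      have h1 : ((X / p ^ b : ℕ) : ℝ) ≤ X / (p : ℝ) ^ b := by
        have := @Nat.cast_div_le ℝ _ _ _ X (p ^ b)
        push_cast at this; exact this
      have h2 : (1 : ℝ) ≤ X / (p : ℝ) ^ b := by
        rw [one_le_div (by positivity)]
        exact_mod_cast (Nat.pow_le_pow_right hp.pos (Nat.le_succ b)).trans hpb
      linarith
    have h2 : (Y : ℝ) ^ e ≤ p * ((X : ℝ) ^ e * (p : ℝ) ^ (-(e * b))) := by
      calc (Y : ℝ) ^ e ≤ (2 * (X / (p : ℝ) ^ b)) ^ e := rpow_le_rpow (by positivity) hYle (by linarith)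
        _ = 2 ^ e * ((X : ℝ) ^ e * (p : ℝ) ^ (-(e * b))) := by
          rw [mul_rpow (by norm_num) (by positivity), div_rpow (by positivity) (by positivity),
            ← rpow_natCast, ← rpow_mul hP0.le, rpow_neg hP0.le, mul_comm (b : ℝ) e]
          rfl
        _ ≤ _ := by gcongr
    have h3 : (p : ℝ) ^ (1 - e * b) = p * (p : ℝ) ^ (-(e * b)) := by
      rw [sub_eq_add_neg, rpow_add hP0, rpow_one]
    rw [h3, hM, mul_assoc]
    apply mul_le_mul_of_nonneg_left _ (by positivity)
    calc (vJ k s (cls X p b η) : ℝ) ≤ vJ k s (Ico 0 (Y : ℤ)) := by exact_mod_cast haff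
      _ ≤ A * (Y : ℝ) ^ e := h1
      _ ≤ A * (p * ((X : ℝ) ^ e * (p : ℝ) ^ (-(e * b)))) := by gcongr
      _ = _ := by ring
  have hK := kb_claim hk hM0 hp hkp hpk hΔ ih (by omega) N hN2 0 1 (by norm_num) (by rw [mul_one])
  have hmom := v_moment (k := k) (Q := Q) (X := X) (s := s) (Ico 0 (X : ℤ)) subset_rfl hQs
  suffices hfin : ∑ α : Fin k → ZMod Q, ‖vF Q (Ico 0 (X : ℤ)) α‖ ^ (2 * s) ≤ M by
    rw [hmom, hM] at hfin
    exact le_of_mul_le_mul_left hfin (by positivity)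
  have hcls0 : cls X p 0 0 = Ico 0 (X : ℤ) := by
    unfold cls; apply filter_true_of_mem; intro z _; simp
  rw [← hcls0]
  set g : Fin p → (Fin k → ZMod Q) → ℝ := fun r α => ‖vF Q (cls X p 1 ((r : ℕ) : ℤ)) α‖ with hg
  set S := (univ : Finset (Fin k → Fin p)).filter (fun t => Function.Injective t) with hS
  have es : 2 * s = k * (2 * (k + 1)) := by rw [hs]; ring
  have hbn : ∀ α, ‖vF Q (cls X p 0 0) α‖ ^ (2 * s) ≤
      (2 * k : ℝ) ^ (2 * s) * ∑ r, g r α ^ (2 * s) +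
      (2 * p : ℝ) ^ (2 * s) * ∑ r ∈ S, ∏ i, g (r i) α ^ (2 * (k + 1)) := by
    intro α
    have := broad_narrow (k := k) (p := p) (n := 2 * (k + 1)) (by omega) hp.one_lt.le (by omega) (fun r => g r α)
      (fun r => norm_nonneg _) ‖vF Q (cls X p 0 0) α‖ (norm_nonneg _) (by
        rw [cls_split X p 0 hp.pos 0 α]
        refine (norm_sum_le _ _).trans (le_of_eq ?_)
        simp [hg])
    rw [es]; exact this
  refine (sum_le_sum fun α _ => hbn α).trans ?_
  rw [sum_add_distrib, ← mul_sum, ← mul_sum, sum_comm]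
  rw [sum_comm (t := S)]
  have c1 : ∑ r : Fin p, ∑ α, g r α ^ (2 * s) ≤ p * (M * (p : ℝ) ^ (1 - e * ((1 : ℕ) : ℝ))) := by
    refine (sum_le_card_nsmul _ _ _ fun r _ => ih 1 le_rfl hH1 _).trans ?_
    simp
  have c2 : ∑ r ∈ S, ∑ α, ∏ i, g (r i) α ^ (2 * (k + 1)) ≤ (p : ℝ) ^ k * (M * (p : ℝ) ^ vE k Δ N (0 : ℕ) (1 : ℕ)) := by
    refine (sum_le_card_nsmul _ _ (M * (p : ℝ) ^ vE k Δ N (0 : ℕ) (1 : ℕ)) fun r hr => ?_).trans ?_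
    · have hinj : pInj (k := k) p (fun i => ((r i : ℕ) : ℤ)) := by
        intro i l hil hdv
        simp only at hdv
        have hr' := (mem_filter.1 hr).2
        apply hil
        apply hr'
        have := Int.eq_zero_of_abs_lt_dvd hdv (by
          have := (r i).2; have := (r l).2
          rw [abs_lt]; constructor <;> omega)
        apply Fin.ext; omega
      have hKi : ∀ i : Fin k, ∑ α, (∏ l, g (r l) α ^ 2) * g (r i) α ^ (k * (2 * k)) ≤ M * (p : ℝ) ^ vE k Δ N (0 : ℕ) (1 : ℕ) := by
        intro i
        have := hK 0 ((r i : ℕ) : ℤ) _ hinj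
        unfold Kint at this
        simpa [hg] using this
      have hkpos : (0 : ℝ) < k := by linarith
      calc ∑ α, ∏ i, g (r i) α ^ (2 * (k + 1))
          ≤ ∑ α, (1 / k : ℝ) * ∑ i, (∏ l, g (r l) α ^ 2) * g (r i) α ^ (k * (2 * k)) := by
            apply sum_le_sum
            intro α _
            have e1 : ∏ i, g (r i) α ^ (2 * (k + 1)) = (∏ i, g (r i) α ^ 2) * ∏ i, g (r i) α ^ (2 * k) := by
              rw [← prod_mul_distrib]
              apply prod_congr rfl; intro i _; rw [← pow_add]; congr 1; ring
            rw [e1, ← mul_sum, mul_left_comm]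
            apply mul_le_mul_of_nonneg_left _ (prod_nonneg fun i _ => by positivity)
            refine (amgm_prod (by omega) _ (fun i => by positivity)).trans (le_of_eq ?_)
            simp only [← pow_mul]
            congr 1; apply sum_congr rfl; intro i _; congr 1; ring
        _ = (1 / k : ℝ) * ∑ i, ∑ α, (∏ l, g (r l) α ^ 2) * g (r i) α ^ (k * (2 * k)) := by
            rw [← mul_sum, sum_comm]
        _ ≤ (1 / k : ℝ) * ∑ i : Fin k, M * (p : ℝ) ^ vE k Δ N (0 : ℕ) (1 : ℕ) :=
            mul_le_mul_of_nonneg_left (sum_le_sum fun i _ => hKi i) (by positivity)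
        _ = _ := by simp; field_simp
    · rw [nsmul_eq_mul]
      apply mul_le_mul_of_nonneg_right _ (by positivity)
      have := card_le_univ S
      rw [Fintype.card_fun, Fintype.card_fin, Fintype.card_fin] at this
      exact_mod_cast this
  have hp1' : (2 * k : ℝ) ^ (2 * s) ≤ p := by exact_mod_cast hp1
  have h2s : (2 : ℝ) ^ (2 * s) ≤ p := by
    refine le_trans (pow_le_pow_left₀ (by norm_num) ?_ _) hp1'
    linarith
  have hg0 : ∀ r α, 0 ≤ g r α := fun r α => norm_nonneg _
  have half : M * (p : ℝ) ^ (-1 : ℝ) ≤ M / 2 := by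
    rw [rpow_neg_one, div_eq_mul_inv]
    gcongr
  have d1 : (2 * k : ℝ) ^ (2 * s) * ∑ r : Fin p, ∑ α, g r α ^ (2 * s) ≤ M / 2 := by
    calc _ ≤ (p : ℝ) * (p * (M * (p : ℝ) ^ (1 - e * ((1 : ℕ) : ℝ)))) := mul_le_mul hp1' c1 (sum_nonneg fun r _ => sum_nonneg fun α _ => pow_nonneg (hg0 _ _) _) (by positivity)
      _ = M * (p : ℝ) ^ (2 + (1 - e)) := by
        rw [rpow_add hP0, show (2 : ℝ) = ((2 : ℕ) : ℝ) by norm_num, rpow_natCast]; push_cast; rw [mul_one]; ring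
      _ ≤ M * (p : ℝ) ^ (-1 : ℝ) := by gcongr; linarith; linarith
      _ ≤ _ := half
  have d2 : (2 * p : ℝ) ^ (2 * s) * ∑ r ∈ S, ∑ α, ∏ i, g (r i) α ^ (2 * (k + 1)) ≤ M / 2 := by
    calc _ ≤ ((p : ℝ) * (p : ℝ) ^ (2 * s)) * ((p : ℝ) ^ k * (M * (p : ℝ) ^ vE k Δ N (0 : ℕ) (1 : ℕ))) := by
            apply mul_le_mul _ c2 (sum_nonneg fun r _ => sum_nonneg fun α _ => (prod_nonneg fun i _ => pow_nonneg (hg0 _ _) _)) (by positivity)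
            rw [mul_pow]; exact mul_le_mul_of_nonneg_right h2s (by positivity)
      _ = M * (p : ℝ) ^ (((1 + 2 * s + k : ℕ) : ℝ) + vE k Δ N (0 : ℕ) (1 : ℕ)) := by
        rw [rpow_add hP0, rpow_natCast]; ring
      _ ≤ M * (p : ℝ) ^ (-1 : ℝ) := by
        gcongr
        · linarith
        · unfold vE; rw [hs]; push_cast; nlinarith
      _ ≤ _ := half
  linarith

lemma eC_add (s t : ℝ) : eC (s + t) = eC s * eC t := by
  unfold eC; rw [← Complex.exp_add]; push_cast; ring_nf

lemma eC_norm (t : ℝ) : ‖eC t‖ = 1 := by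
  unfold eC
  rw [show (2 * Real.pi * Complex.I * t : ℂ) = ((2 * Real.pi * t : ℝ) : ℂ) * Complex.I by push_cast; ring]
  exact Complex.norm_exp_ofReal_mul_I _

lemma eC_int (n : ℤ) : eC n = 1 := by
  unfold eC
  rw [show (2 * Real.pi * Complex.I * ((n : ℝ) : ℂ) : ℂ) = n * (2 * Real.pi * Complex.I) by push_cast; ring]
  exact Complex.exp_int_mul_two_pi_mul_I n

lemma eC_nat (n : ℕ) : eC n = 1 := by exact_mod_cast eC_int n

lemma eC_zero : eC 0 = 1 := by simpa using eC_int 0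

lemma eC_neg (t : ℝ) : eC (-t) = (starRingEnd ℂ) (eC t) := by
  unfold eC; rw [← Complex.exp_conj]; simp only [map_mul, Complex.conj_ofReal, Complex.conj_I, map_ofNat]; push_cast; ring_nf

lemma eC_conj_mul (s t : ℝ) : eC s * (starRingEnd ℂ) (eC t) = eC (s - t) := by
  rw [← eC_neg, ← eC_add, sub_eq_add_neg]

lemma eC_half (t : ℝ) : eC t = (cos (2 * π * t) : ℂ) + (sin (2 * π * t) : ℂ) * Complex.I := by
  unfold eC
  rw [show (2 * Real.pi * Complex.I * t : ℂ) = ((2 * Real.pi * t : ℝ) : ℂ) * Complex.I by push_cast; ring]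
  rw [Complex.exp_mul_I, Complex.ofReal_cos, Complex.ofReal_sin]

lemma norm_eC_sub_one (t : ℝ) : ‖eC t - 1‖ ≤ 2 * π * |t| := by
  unfold eC
  rw [show (2 * Real.pi * Complex.I * t : ℂ) = Complex.I * ((2 * Real.pi * t : ℝ) : ℂ) by push_cast; ring]
  refine (norm_exp_I_mul_ofReal_sub_one_le).trans (le_of_eq ?_)
  rw [norm_eq_abs, abs_mul, abs_of_pos (by positivity)]

/-- cotangent -/
def ctn (t : ℝ) : ℝ := cos (π * t) / sin (π * t)

lemma sin_lo {δ t : ℝ} (h0 : 0 < δ) (h1 : δ ≤ t) (h2 : t ≤ 1 - δ) : 2 * δ ≤ sin (π * t) := by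
  have hpi := pi_pos
  rcases le_total t (1 / 2) with h | h
  · have := mul_le_sin (x := π * t) (mul_nonneg hpi.le (by linarith)) (by nlinarith)
    have e : 2 / π * (π * t) = 2 * t := by field_simp
    rw [e] at this; linarith
  · have := mul_le_sin (x := π * (1 - t)) (mul_nonneg hpi.le (by linarith)) (by nlinarith)
    have e : 2 / π * (π * (1 - t)) = 2 * (1 - t) := by field_simp
    rw [e, show π * (1 - t) = π - π * t by ring, sin_pi_sub] at this; linarith

lemma one_sub_eC (t : ℝ) (h : sin (π * t) ≠ 0) :
    (1 - eC t) * ((1 / 2 : ℂ) + Complex.I / 2 * (ctn t : ℂ)) = 1 := by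
  rw [eC_half, show 2 * π * t = 2 * (π * t) by ring, cos_two_mul, sin_two_mul]
  unfold ctn
  set s := sin (π * t)
  set c := cos (π * t)
  have h1 : s ^ 2 + c ^ 2 = 1 := sin_sq_add_cos_sq _
  have hs : (s : ℂ) ≠ 0 := by exact_mod_cast h
  have h1' : (s : ℂ) ^ 2 + (c : ℂ) ^ 2 = 1 := by exact_mod_cast h1
  push_cast
  field_simp
  linear_combination (- 2 * c * Complex.I) * h1' + (-2 * (c:ℂ) ^ 2 * s) * Complex.I_sq

lemma ctn_diff {s t δ : ℝ} (h0 : 0 < δ) (h1 : δ ≤ s) (hst : s ≤ t) (h2 : t ≤ 1 - δ) : ctn t ≤ ctn s := by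
  have hs := sin_lo h0 h1 (hst.trans h2)
  have ht := sin_lo h0 (h1.trans hst) h2
  unfold ctn
  rw [div_le_div_iff₀ (by linarith) (by linarith)]
  have : 0 ≤ sin (π * t - π * s) := sin_nonneg_of_nonneg_of_le_pi
    (by nlinarith [pi_pos]) (by nlinarith [pi_pos])
  rw [sin_sub] at this
  linarith

lemma ctn_abs {t δ : ℝ} (h0 : 0 < δ) (h1 : δ ≤ t) (h2 : t ≤ 1 - δ) : |ctn t| ≤ 1 / (2 * δ) := by
  have ht := sin_lo h0 h1 h2
  unfold ctn
  rw [abs_div, abs_of_pos (a := sin _) (by linarith)]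
  exact div_le_div₀ zero_le_one (abs_cos_le_one _) (by linarith) ht

lemma kuz_aux (f : ℕ → ℝ) (N : ℕ) (δ : ℝ) (h0 : 0 < δ)
    (h1 : ∀ n ≤ N, δ ≤ f (n + 1) - f n) (h2 : ∀ n ≤ N, f (n + 1) - f n ≤ 1 - δ)
    (hm : ∀ n, n + 1 ≤ N → f (n + 1) - f n ≤ f (n + 2) - f (n + 1)) :
    ‖∑ n ∈ range (N + 1), eC (f n) + eC (f (N + 1)) * ((1 / 2 : ℂ) + Complex.I / 2 * (ctn (f (N + 1) - f N) : ℂ))‖ ≤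
      ‖((1 / 2 : ℂ) + Complex.I / 2 * (ctn (f 1 - f 0) : ℂ))‖ + (ctn (f 1 - f 0) - ctn (f (N + 1) - f N)) / 2 := by
  have key : ∀ n ≤ N, eC (f n) = (eC (f n) - eC (f (n + 1))) * ((1 / 2 : ℂ) + Complex.I / 2 * (ctn (f (n + 1) - f n) : ℂ)) := by
    intro n hn
    have hs := sin_lo h0 (h1 n hn) (h2 n hn)
    have := one_sub_eC (f (n + 1) - f n) (by linarith)
    have e : eC (f (n + 1)) = eC (f n) * eC (f (n + 1) - f n) := by rw [← eC_add]; congr 1; ring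
    rw [e]
    linear_combination (-eC (f n)) * this
  induction N with
  | zero =>
    simp only [range_one, sum_singleton, zero_add]
    rw [sub_self, zero_div, add_zero]
    have k0 := key 0 le_rfl
    rw [zero_add] at k0
    have : eC (f 0) + eC (f 1) * ((1 / 2 : ℂ) + Complex.I / 2 * (ctn (f 1 - f 0) : ℂ)) =
      eC (f 0) * ((1 / 2 : ℂ) + Complex.I / 2 * (ctn (f 1 - f 0) : ℂ)) := by linear_combination k0
    rw [this, norm_mul, eC_norm, one_mul]
  | succ N ih =>
    have ih := ih (fun n hn => h1 n (by omega)) (fun n hn => h2 n (by omega)) (fun n hn => hm n (by omega))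
      (fun n hn => key n (by omega))
    rw [sum_range_succ]
    have kN := key (N + 1) le_rfl
    set c1 := ctn (f (N + 1) - f N)
    set c2 := ctn (f (N + 1 + 1) - f (N + 1))
    have hc : c2 ≤ c1 := ctn_diff h0 (h1 N (by omega)) (hm N (by omega)) (h2 (N + 1) le_rfl)
    have e : (∑ n ∈ range (N + 1), eC (f n) + eC (f (N + 1)) + eC (f (N + 1 + 1)) * ((1 / 2 : ℂ) + Complex.I / 2 * (c2 : ℂ))) =
      (∑ n ∈ range (N + 1), eC (f n) + eC (f (N + 1)) * ((1 / 2 : ℂ) + Complex.I / 2 * (c1 : ℂ))) +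
        eC (f (N + 1)) * (Complex.I / 2 * ((c2 - c1 : ℝ) : ℂ)) := by
      push_cast
      linear_combination kN
    rw [e]
    refine (norm_add_le _ _).trans ?_
    have : ‖eC (f (N + 1)) * (Complex.I / 2 * ((c2 - c1 : ℝ) : ℂ))‖ = (c1 - c2) / 2 := by
      rw [norm_mul, eC_norm, norm_mul, norm_div, Complex.norm_I, Complex.norm_real, norm_eq_abs, abs_of_nonpos (by linarith)]
      simp; ring
    rw [this]; linarith

lemma kuz0 (f : ℕ → ℝ) (N : ℕ) (δ : ℝ) (h0 : 0 < δ)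
    (h1 : ∀ n < N, δ ≤ f (n + 1) - f n) (h2 : ∀ n < N, f (n + 1) - f n ≤ 1 - δ)
    (hm : ∀ n, n + 1 < N → f (n + 1) - f n ≤ f (n + 2) - f (n + 1)) :
    ‖∑ n ∈ range N, eC (f n)‖ ≤ 2 / δ := by
  rcases N with _ | N
  · simp; positivity
  have hd : δ ≤ 1 / 2 := by have := h1 0 (by omega); have := h2 0 (by omega); linarith
  have hk := kuz_aux f N δ h0 (fun n hn => h1 n (by omega)) (fun n hn => h2 n (by omega)) (fun n hn => hm n (by omega))
  have hnc : ∀ t : ℝ, |ctn t| ≤ 1 / (2 * δ) → ‖((1 / 2 : ℂ) + Complex.I / 2 * (ctn t : ℂ))‖ ≤ 1 / 2 + 1 / (4 * δ) := by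
    intro t ht
    refine (norm_add_le _ _).trans ?_
    rw [norm_mul, norm_div Complex.I, Complex.norm_I, Complex.norm_real, norm_eq_abs]
    have : 1 / (4 * δ) = 1 / 2 * (1 / (2 * δ)) := by field_simp; norm_num
    rw [this]
    have : ‖(1 / 2 : ℂ)‖ = 1 / 2 := by simp
    rw [this]
    simp only [Complex.norm_ofNat]
    gcongr
  have a0 := ctn_abs h0 (h1 0 (by omega)) (h2 0 (by omega))
  have aN := ctn_abs h0 (h1 N (by omega)) (h2 N (by omega))
  have b0 := hnc _ a0
  have bN := hnc _ aN
  rw [zero_add] at a0 b0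
  have := norm_sub_le (∑ n ∈ range (N + 1), eC (f n) + eC (f (N + 1)) * ((1 / 2 : ℂ) + Complex.I / 2 * (ctn (f (N + 1) - f N) : ℂ)))
    (eC (f (N + 1)) * ((1 / 2 : ℂ) + Complex.I / 2 * (ctn (f (N + 1) - f N) : ℂ)))
  rw [add_sub_cancel_right, norm_mul (eC _), eC_norm, one_mul] at this
  have e1 : 2 / δ = 2 * (1 / δ) := by ring
  have e2 : 1 / (2 * δ) = 1 / 2 * (1 / δ) := by field_simp
  have e4 : 1 / (4 * δ) = 1 / 4 * (1 / δ) := by field_simp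
  have e3 : 2 ≤ 1 / δ := by rw [le_div_iff₀ h0]; linarith
  have := abs_le.1 a0
  have := abs_le.1 aN
  rw [e1]; rw [e2] at *; rw [e4] at b0 bN
  linarith

lemma kuz (f : ℕ → ℝ) (N : ℕ) (δ : ℝ) (k : ℤ) (h0 : 0 < δ)
    (h1 : ∀ n < N, k + δ ≤ f (n + 1) - f n) (h2 : ∀ n < N, f (n + 1) - f n ≤ k + 1 - δ)
    (hm : ∀ n, n + 1 < N → f (n + 1) - f n ≤ f (n + 2) - f (n + 1)) :
    ‖∑ n ∈ range N, eC (f n)‖ ≤ 2 / δ := by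
  have := kuz0 (fun n => f n - k * n) N δ h0 (fun n hn => by have := h1 n hn; push_cast; linarith)
    (fun n hn => by have := h2 n hn; push_cast; linarith) (fun n hn => by have := hm n hn; push_cast; linarith)
  refine le_trans (le_of_eq ?_) this
  congr 1
  apply sum_congr rfl
  intro n _
  have : eC (f n) = eC (f n - k * n) * eC ((k * n : ℤ) : ℝ) := by rw [← eC_add]; congr 1; push_cast; ring
  rw [this, eC_int, mul_one]

lemma thr (G : ℕ → ℝ) (N : ℕ) (hm : ∀ n, n + 1 < N → G n ≤ G (n + 1)) (u : ℝ) :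
    ∃ a ≤ N, (∀ n < a, G n < u) ∧ ∀ n, a ≤ n → n < N → u ≤ G n := by
  induction N with
  | zero => exact ⟨0, le_rfl, by simp, by simp⟩
  | succ N ih =>
    obtain ⟨a, ha, h1, h2⟩ := ih (fun n hn => hm n (by omega))
    by_cases hN : a = N
    · subst hN
      by_cases h : G a < u
      · refine ⟨a + 1, le_rfl, fun n hn => ?_, fun n hn hn' => by omega⟩
        rcases Nat.lt_succ_iff_lt_or_eq.1 hn with h' | h'
        · exact h1 n h'
        · rw [h']; exact h
      · refine ⟨a, by omega, h1, fun n hn hn' => ?_⟩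
        rw [show n = a by omega]; linarith
    · refine ⟨a, by omega, h1, fun n hn hn' => ?_⟩
      rcases Nat.lt_succ_iff_lt_or_eq.1 hn' with h' | h'
      · exact h2 n hn h'
      · have e := h2 (N - 1) (by omega) (by omega)
        have := hm (N - 1) (by omega)
        rw [Nat.sub_add_cancel (by omega)] at this
        rw [h']; linarith

lemma len_le (G : ℕ → ℝ) (N : ℕ) (l : ℝ) (hl : 0 < l) (hm : ∀ n, n + 1 < N → G n + l ≤ G (n + 1)) (a b : ℕ)
    (hbN : b ≤ N) (u v : ℝ) (hu : ∀ n, a ≤ n → n < b → u ≤ G n) (hv : ∀ n, a ≤ n → n < b → G n ≤ v) (huv : u ≤ v) :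
    ((b - a : ℕ) : ℝ) ≤ (v - u) / l + 1 := by
  have h0 : 0 ≤ (v - u) / l := div_nonneg (by linarith) hl.le
  by_cases hab : a < b
  · have key : ∀ j, a + j < b → G a + j * l ≤ G (a + j) := by
      intro j
      induction j with
      | zero => intro _; simp
      | succ j ih =>
        intro hj
        have h1 := ih (by omega)
        have h2 := hm (a + j) (by omega)
        rw [← add_assoc]; push_cast; linarith
    have h1 := key (b - a - 1) (by omega)
    have h2 := hu a le_rfl hab
    have h3 := hv (a + (b - a - 1)) (by omega) (by omega)
    have e : ((b - a : ℕ) : ℝ) = ((b - a - 1 : ℕ) : ℝ) + 1 := by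
      exact_mod_cast (by omega : b - a = (b - a - 1) + 1)
    have : ((b - a - 1 : ℕ) : ℝ) ≤ (v - u) / l := by rw [le_div_iff₀ hl]; linarith
    linarith
  · rw [Nat.sub_eq_zero_of_le (by omega)]; push_cast; linarith

lemma norm_sum_eC_le (f : ℕ → ℝ) (s : Finset ℕ) : ‖∑ n ∈ s, eC (f n)‖ ≤ s.card := by
  refine (norm_sum_le _ _).trans ?_
  simp [eC_norm]

lemma sd_block (f : ℕ → ℝ) (N : ℕ) (l : ℝ) (hl : 0 < l) (hl4 : l ≤ 1 / 4) (k : ℤ)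
    (hm : ∀ n, n + 1 < N → (f (n + 1) - f n) + l ≤ f (n + 2) - f (n + 1))
    (h1 : ∀ n < N, k ≤ f (n + 1) - f n) (h2 : ∀ n < N, f (n + 1) - f n < k + 1) :
    ‖∑ n ∈ range N, eC (f n)‖ ≤ 4 / sqrt l + 2 := by
  set G : ℕ → ℝ := fun n => f (n + 1) - f n with hG
  set δ := sqrt l with hδ
  have hδ0 : 0 < δ := sqrt_pos.2 hl
  have hδ2 : δ * δ = l := mul_self_sqrt hl.le
  have hδh : δ ≤ 1 / 2 := by nlinarith
  have hm' : ∀ n, n + 1 < N → G n ≤ G (n + 1) := fun n hn => by have := hm n hn; simp only [hG]; linarith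
  obtain ⟨a, haN, ha1, ha2⟩ := thr G N hm' (k + δ)
  obtain ⟨b, hbN, hb1, hb2⟩ := thr G N hm' (k + 1 - δ)
  have hab : a ≤ b := by
    by_contra h
    push Not at h
    have := ha1 b h
    have := hb2 b le_rfl (by omega)
    linarith
  have hdl : δ / l = 1 / δ := by rw [← hδ2]; field_simp
  have la := len_le G N l hl hm 0 a haN k (k + δ) (fun n _ hn => h1 n (by omega)) (fun n _ hn => (ha1 n hn).le) (by linarith)
  have lb := len_le G N l hl hm b N le_rfl (k + 1 - δ) (k + 1) (fun n hn hn' => hb2 n hn hn') (fun n _ hn => (h2 n hn).le) (by linarith)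
  rw [add_sub_cancel_left, hdl] at la
  rw [sub_sub_cancel, hdl] at lb
  have hmid := kuz (fun n => f (a + n)) (b - a) δ k hδ0 (fun n hn => ha2 (a + n) (by omega) (by omega))
    (fun n hn => (hb1 (a + n) (by omega)).le) (fun n hn => hm' (a + n) (by omega))
  have e : ∑ n ∈ range N, eC (f n) = ∑ n ∈ range a, eC (f n) + ∑ n ∈ range (b - a), eC (f (a + n)) +
      ∑ n ∈ Ico b N, eC (f n) := by
    rw [range_eq_Ico, range_eq_Ico, ← sum_Ico_consecutive _ (Nat.zero_le a) haN,
      ← sum_Ico_consecutive _ hab hbN, sum_Ico_eq_sum_range _ a b, ← range_eq_Ico, add_assoc,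
      range_eq_Ico]
  rw [e]
  have n1 := norm_sum_eC_le f (range a)
  have n3 := norm_sum_eC_le f (Ico b N)
  rw [card_range] at n1
  rw [Nat.card_Ico] at n3
  rw [Nat.sub_zero] at la
  have e4 : 4 / δ = 4 * (1 / δ) := by ring
  have e2 : 2 / δ = 2 * (1 / δ) := by ring
  rw [e4]; rw [e2] at hmid
  refine (norm_add₃_le).trans ?_
  linarith

lemma sd_pos (f : ℕ → ℝ) (l : ℝ) (hl : 0 < l) (hl4 : l ≤ 1 / 4) (N : ℕ)
    (hm : ∀ n, n + 1 < N + 1 → (f (n + 1) - f n) + l ≤ f (n + 2) - f (n + 1)) :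
    ‖∑ n ∈ range (N + 1), eC (f n)‖ ≤ (⌊f (N + 1) - f N⌋ - ⌊f 1 - f 0⌋ + 1 : ℤ) * (4 / sqrt l + 2) := by
  have hB : 0 ≤ 4 / sqrt l + 2 := by positivity
  induction N using Nat.strong_induction_on generalizing f with
  | _ N ih =>
  set G : ℕ → ℝ := fun n => f (n + 1) - f n with hG
  have hm' : ∀ n, n + 1 < N + 1 → G n ≤ G (n + 1) := fun n hn => by have := hm n hn; simp only [hG]; linarith
  have hmono : ∀ n, n ≤ N → G 0 ≤ G n := by
    intro n
    induction n with
    | zero => intro _; exact le_rfl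
    | succ n ihn => intro hn; exact (ihn (by omega)).trans (hm' n (by omega))
  set k := ⌊f 1 - f 0⌋ with hk
  obtain ⟨a, haN, ha1, ha2⟩ := thr G (N + 1) hm' (k + 1)
  have ha0 : a ≠ 0 := by
    rintro rfl
    have := ha2 0 le_rfl (by omega)
    have h := Int.lt_floor_add_one (f 1 - f 0)
    simp only [hG, zero_add] at this
    linarith
  have hblk := sd_block f a l hl hl4 k (fun n hn => hm n (by omega)) (fun n hn => by
      have := hmono n (by omega)
      have h := Int.floor_le (f 1 - f 0)
      simp only [hG, zero_add] at this
      linarith) (fun n hn => ha1 n hn)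
  by_cases haN' : a = N + 1
  · rw [haN'] at hblk
    refine hblk.trans ?_
    refine le_mul_of_one_le_left hB ?_
    have : k ≤ ⌊f (N + 1) - f N⌋ := Int.floor_le_floor (by
      have := hmono N le_rfl
      simpa only [hG, zero_add] using this)
    exact_mod_cast (by omega : 1 ≤ ⌊f (N + 1) - f N⌋ - k + 1)
  · have := ih (N - a) (by omega) (fun n => f (a + n)) (fun n hn => hm (a + n) (by omega))
    have e : ∑ n ∈ range (N + 1), eC (f n) = ∑ n ∈ range a, eC (f n) + ∑ n ∈ range (N - a + 1), eC (f (a + n)) := by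
      rw [range_eq_Ico, ← sum_Ico_consecutive _ (Nat.zero_le a) haN, sum_Ico_eq_sum_range _ a (N + 1),
       ← range_eq_Ico, show N + 1 - a = N - a + 1 by omega]
    rw [e]
    refine (norm_add_le _ _).trans ?_
    rw [show a + (N - a + 1) = N + 1 by omega, show a + (N - a) = N by omega, add_zero] at this
    have hfl : k + 1 ≤ ⌊f (a + 1) - f a⌋ := Int.le_floor.2 (by
      have := ha2 a le_rfl (by omega)
      push_cast; exact this)
    have h2 : ((⌊f (N + 1) - f N⌋ - ⌊f (a + 1) - f a⌋ + 1 : ℤ) : ℝ) ≤ ((⌊f (N + 1) - f N⌋ - k : ℤ) : ℝ) := by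
      exact_mod_cast (by omega)
    have h3 := mul_le_mul_of_nonneg_right h2 hB
    have e3 : ((⌊f (N + 1) - f N⌋ - k + 1 : ℤ) : ℝ) = ((⌊f (N + 1) - f N⌋ - k : ℤ) : ℝ) + 1 := by push_cast; ring
    rw [e3, add_mul, one_mul]
    linarith

/-- discrete second derivative test -/
lemma sd_test (f : ℕ → ℝ) (l L : ℝ) (hl : 0 < l) (N : ℕ)
    (h1 : ∀ n, n + 2 ≤ N → l ≤ f (n + 2) - 2 * f (n + 1) + f n)
    (h2 : ∀ n, n + 2 ≤ N → f (n + 2) - 2 * f (n + 1) + f n ≤ L) (hlL : l ≤ L) :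
    ‖∑ n ∈ range N, eC (f n)‖ ≤ (L * N + 2) * (4 / sqrt l + 4) := by
  have hs : 0 < sqrt l := sqrt_pos.2 hl
  have hL : 0 < L := by linarith
  by_cases hl4 : l ≤ 1 / 4
  · rcases N with _ | N
    · simp; positivity
    refine (sd_pos f l hl hl4 N (fun n hn => by have := h1 n (by omega); linarith)).trans ?_
    have key : ∀ n, n ≤ N → f (n + 1) - f n ≤ f 1 - f 0 + L * n := by
      intro n
      induction n with
      | zero => intro _; simp
      | succ n ih => intro hn; have := ih (by omega); have := h2 n (by omega); push_cast; linarith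
    have k := key N le_rfl
    have a1 := Int.floor_le (f (N + 1) - f N)
    have a2 := Int.lt_floor_add_one (f 1 - f 0)
    apply mul_le_mul
    · push_cast; linarith
    · linarith
    · positivity
    · positivity
  · push Not at hl4
    refine (norm_sum_eC_le _ _).trans ?_
    rw [card_range]
    have : (N : ℝ) ≤ (L * N) * 4 := by
      have : (0:ℝ) ≤ N := by positivity
      nlinarith
    have h4 : 0 ≤ 4 / sqrt l := by positivity
    have : 0 ≤ (L * N) := by positivity
    nlinarith

lemma sd_conj (f : ℕ → ℝ) (s : Finset ℕ) : ‖∑ n ∈ s, eC (-f n)‖ = ‖∑ n ∈ s, eC (f n)‖ := by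
  simp only [eC_neg]
  rw [← map_sum, Complex.norm_conj]

lemma weyl_id (z : ℕ → ℂ) (hz : ∀ n, ‖z n‖ = 1) (N : ℕ) :
    (‖∑ n ∈ range N, z n‖ ^ 2 : ℝ) = N + 2 * (∑ u ∈ range N, ∑ n ∈ range (N - (u + 1)),
      z (n + (u + 1)) * (starRingEnd ℂ) (z n)).re := by
  induction N with
  | zero => simp
  | succ N ih =>
    have e1 : (∑ u ∈ range (N + 1), ∑ n ∈ range (N + 1 - (u + 1)), z (n + (u + 1)) * (starRingEnd ℂ) (z n)) =
      (∑ u ∈ range N, ∑ n ∈ range (N - (u + 1)), z (n + (u + 1)) * (starRingEnd ℂ) (z n)) +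
        z N * (starRingEnd ℂ) (∑ n ∈ range N, z n) := by
      rw [sum_range_succ]
      simp only [Nat.sub_self, range_zero, sum_empty, add_zero]
      rw [map_sum, mul_sum, ← sum_range_reflect (fun n => z N * (starRingEnd ℂ) (z n)), ← sum_add_distrib]
      apply sum_congr rfl
      intro u hu
      have hu := mem_range.1 hu
      rw [show N + 1 - (u + 1) = N - (u + 1) + 1 by omega, sum_range_succ, show N - (u + 1) + (u + 1) = N by omega,
        show N - 1 - u = N - (u + 1) by omega]
    rw [e1, sum_range_succ, Complex.add_re]
    have := Complex.normSq_add (z N) (∑ n ∈ range N, z n)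
    rw [Complex.normSq_eq_norm_sq, Complex.normSq_eq_norm_sq, Complex.normSq_eq_norm_sq, hz, ih] at this
    rw [add_comm (∑ n ∈ range N, z n), this]
    push_cast; ring

lemma weyl_diff (f : ℕ → ℝ) (N : ℕ) :
    ‖∑ n ∈ range N, eC (f n)‖ ^ 2 ≤ N + 2 * ∑ u ∈ range N, ‖∑ n ∈ range (N - (u + 1)), eC (f (n + (u + 1)) - f n)‖ := by
  rw [weyl_id (fun n => eC (f n)) (fun n => eC_norm _)]
  simp only [eC_conj_mul]
  have := (Complex.re_le_norm (∑ u ∈ range N, ∑ n ∈ range (N - (u + 1)), eC (f (n + (u + 1)) - f n))).trans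
    (norm_sum_le _ _)
  linarith

lemma tel_bd (a : ℕ → ℝ) (l L : ℝ) (N : ℕ) (ha : ∀ n, n + 1 ≤ N → l ≤ a (n + 1) - a n ∧ a (n + 1) - a n ≤ L) (u n : ℕ) (h : n + u ≤ N) :
    u * l ≤ a (n + u) - a n ∧ a (n + u) - a n ≤ u * L := by
  induction u with
  | zero => simp
  | succ u ih =>
    have h1 := ih (by omega)
    have h2 := ha (n + u) (by omega)
    rw [← add_assoc]
    push_cast
    constructor <;> linarith

lemma sum_inv_sqrt (N : ℕ) : ∑ u ∈ range N, 1 / sqrt ((u + 1 : ℕ) : ℝ) ≤ 2 * sqrt N := by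
  induction N with
  | zero => simp
  | succ N ih =>
    rw [sum_range_succ]
    have h1 : 0 ≤ sqrt N := sqrt_nonneg _
    have h2 : 0 < sqrt ((N + 1 : ℕ) : ℝ) := sqrt_pos.2 (by positivity)
    have e1 : sqrt N * sqrt N = N := mul_self_sqrt (by positivity)
    have e2 : sqrt ((N + 1 : ℕ) : ℝ) * sqrt ((N + 1 : ℕ) : ℝ) = N + 1 := by
      rw [mul_self_sqrt (by positivity)]; push_cast; ring
    have : 1 / sqrt ((N + 1 : ℕ) : ℝ) ≤ 2 * sqrt ((N + 1 : ℕ) : ℝ) - 2 * sqrt N := by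
      rw [div_le_iff₀ h2]
      nlinarith [sq_nonneg (sqrt ((N + 1 : ℕ) : ℝ) - sqrt N)]
    linarith

/-- discrete third derivative test -/
lemma td_test (f : ℕ → ℝ) (l R : ℝ) (hl : 0 < l) (hR : 1 ≤ R) (N : ℕ)
    (h : ∀ n, n + 3 ≤ N → l ≤ f (n + 3) - 3 * f (n + 2) + 3 * f (n + 1) - f n ∧
      f (n + 3) - 3 * f (n + 2) + 3 * f (n + 1) - f n ≤ R * l) :
    ‖∑ n ∈ range N, eC (f n)‖ ^ 2 ≤ N + 16 * R * N ^ 2 * sqrt (N * l) + 64 * sqrt (N / l) := by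
  have hN0 : (0 : ℝ) ≤ N := by positivity
  by_cases hNl : 1 < N * l
  · have h1 : ‖∑ n ∈ range N, eC (f n)‖ ≤ N := by simpa using norm_sum_eC_le f (range N)
    have h2 : 1 ≤ sqrt (N * l) := one_le_sqrt.2 hNl.le
    have h3 : ‖∑ n ∈ range N, eC (f n)‖ ^ 2 ≤ (N : ℝ) ^ 2 := pow_le_pow_left₀ (norm_nonneg _) h1 2
    have h5 : (N : ℝ) ^ 2 * 1 ≤ (R * N ^ 2) * sqrt (N * l) := mul_le_mul (by nlinarith) h2 zero_le_one (by positivity)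
    have : 0 ≤ sqrt (N / l) := sqrt_nonneg _
    nlinarith
  push Not at hNl
  have hu : ∀ u ∈ range N, ‖∑ n ∈ range (N - (u + 1)), eC (f (n + (u + 1)) - f n)‖ ≤
      8 * R * N * sqrt (N * l) + 16 / sqrt l * (1 / sqrt ((u + 1 : ℕ) : ℝ)) := by
    intro u hu
    have hu := mem_range.1 hu
    have hu0 : (0 : ℝ) < ((u + 1 : ℕ) : ℝ) := by positivity
    have key : ∀ n, n + 2 ≤ N - (u + 1) → _ := fun n hn => tel_bd (fun n => f (n + 2) - 2 * f (n + 1) + f n) l (R * l) (N - 2)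
      (fun m hm => by have := h m (by omega); constructor <;> linarith [this.1, this.2]) (u + 1) n (by omega)
    have := sd_test (fun n => f (n + (u + 1)) - f n) (((u + 1 : ℕ) : ℝ) * l) (((u + 1 : ℕ) : ℝ) * (R * l)) (by positivity) (N - (u + 1))
      (fun n hn => by
        have := (key n hn).1
        simp only [show n + 2 + (u + 1) = n + (u + 1) + 2 by ring, show n + 1 + (u + 1) = n + (u + 1) + 1 by ring]
        linarith)
      (fun n hn => by
        have := (key n hn).2
        simp only [show n + 2 + (u + 1) = n + (u + 1) + 2 by ring, show n + 1 + (u + 1) = n + (u + 1) + 1 by ring]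
        linarith) (by nlinarith [mul_pos hu0 hl])
    refine this.trans ?_
    set v : ℝ := ((u + 1 : ℕ) : ℝ) with hv
    have hvN : v ≤ N := by rw [hv]; exact_mod_cast hu
    set w := sqrt (v * l) with hw
    have hw0 : 0 < w := sqrt_pos.2 (by positivity)
    have hww : w * w = v * l := mul_self_sqrt (by positivity)
    have hwN : w ≤ sqrt (N * l) := sqrt_le_sqrt (by gcongr)
    have hw1 : w ≤ 1 := hwN.trans (sqrt_le_one.2 hNl)
    have hNu : ((N - (u + 1) : ℕ) : ℝ) ≤ N := by exact_mod_cast Nat.sub_le _ _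
    have e1 : 16 / sqrt l * (1 / sqrt v) = 16 / w := by
      rw [hw, sqrt_mul hu0.le]; field_simp
    rw [e1]
    calc (v * (R * l) * ((N - (u + 1) : ℕ) : ℝ) + 2) * (4 / w + 4)
        ≤ (v * (R * l) * N + 2) * (8 / w) := by
          apply mul_le_mul _ _ (by positivity) (by positivity)
          · gcongr
          · rw [div_add' _ _ _ hw0.ne']; gcongr; linarith
      _ = 8 * R * N * w + 16 / w := by
          rw [show v * (R * l) * N = R * N * (w * w) by rw [hww]; ring]; field_simp; ring
      _ ≤ _ := by gcongr
  refine (weyl_diff f N).trans ?_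
  have hs := sum_le_sum hu
  rw [sum_add_distrib, sum_const, card_range, nsmul_eq_mul, ← mul_sum] at hs
  have h2 : 16 / sqrt l * ∑ u ∈ range N, 1 / sqrt ((u + 1 : ℕ) : ℝ) ≤ 32 * sqrt (N / l) := by
    refine (mul_le_mul_of_nonneg_left (sum_inv_sqrt N) (by positivity)).trans (le_of_eq ?_)
    rw [sqrt_div hN0]; ring
  nlinarith

/-- discrete fourth derivative test -/
lemma fd_test (f : ℕ → ℝ) (l R : ℝ) (hl : 0 < l) (hR : 1 ≤ R) (N : ℕ)
    (h : ∀ n, n + 4 ≤ N → l ≤ f (n + 4) - 4 * f (n + 3) + 6 * f (n + 2) - 4 * f (n + 1) + f n ∧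
      f (n + 4) - 4 * f (n + 3) + 6 * f (n + 2) - 4 * f (n + 1) + f n ≤ R * l) :
    ‖∑ n ∈ range N, eC (f n)‖ ^ 2 ≤ N + 2 * N * sqrt N + 8 * R * N ^ 2 * sqrt (sqrt (N * (N * l)))
      + 32 * N / sqrt (sqrt l) := by
  have hN0 : (0 : ℝ) ≤ N := by positivity
  have hu : ∀ u ∈ range N, ‖∑ n ∈ range (N - (u + 1)), eC (f (n + (u + 1)) - f n)‖ ≤
      sqrt N + 4 * R * N * sqrt (sqrt (N * (N * l))) + 8 * sqrt (sqrt (N / l) * (1 / sqrt ((u + 1 : ℕ) : ℝ))) := by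
    intro u hu
    have hu := mem_range.1 hu
    have hu0 : (0 : ℝ) < ((u + 1 : ℕ) : ℝ) := by positivity
    have key : ∀ n, n + 3 ≤ N - (u + 1) → _ := fun n hn => tel_bd (fun n => f (n + 3) - 3 * f (n + 2) + 3 * f (n + 1) - f n) l (R * l) (N - 3)
      (fun m hm => by have := h m (by omega); constructor <;> linarith [this.1, this.2]) (u + 1) n (by omega)
    have := td_test (fun n => f (n + (u + 1)) - f n) (((u + 1 : ℕ) : ℝ) * l) R (by positivity) hR (N - (u + 1))
      (fun n hn => by
        have := key n hn
        simp only [show n + 3 + (u + 1) = n + (u + 1) + 3 by ring, show n + 2 + (u + 1) = n + (u + 1) + 2 by ring, show n + 1 + (u + 1) = n + (u + 1) + 1 by ring]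
        constructor <;> linarith [this.1, this.2])
    set v : ℝ := ((u + 1 : ℕ) : ℝ) with hv
    have hvN : v ≤ N := by rw [hv]; exact_mod_cast hu
    have hNu : ((N - (u + 1) : ℕ) : ℝ) ≤ N := by exact_mod_cast Nat.sub_le _ _
    have e1 : sqrt (N / l) * (1 / sqrt v) = sqrt (N / (v * l)) := by
      rw [sqrt_div hN0, sqrt_div hN0, sqrt_mul hu0.le]; field_simp
    rw [e1]
    refine abs_le_of_sq_le_sq' (le_trans this ?_) (by positivity) |>.2
    set A := sqrt (N * (N * l)) with hA
    set B := sqrt (N / (v * l)) with hB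
    have a1 : sqrt N ^ 2 = N := sq_sqrt hN0
    have a2 : sqrt A ^ 2 = A := sq_sqrt (sqrt_nonneg _)
    have a3 : sqrt B ^ 2 = B := sq_sqrt (sqrt_nonneg _)
    have b1 : sqrt (((N - (u + 1) : ℕ) : ℝ) * (v * l)) ≤ A := sqrt_le_sqrt (by gcongr)
    have b2 : sqrt (((N - (u + 1) : ℕ) : ℝ) / (v * l)) ≤ B := sqrt_le_sqrt (by gcongr)
    have hA0 : 0 ≤ A := sqrt_nonneg _
    calc _ ≤ (N : ℝ) + 16 * (R * R) * N ^ 2 * A + 64 * B := by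
            gcongr
            nlinarith
      _ = sqrt N ^ 2 + (4 * R * N * sqrt A) ^ 2 + (8 * sqrt B) ^ 2 := by rw [mul_pow _ (sqrt A), mul_pow _ (sqrt B), a1, a2, a3]; ring
      _ ≤ _ := by
        have p1 : 0 ≤ sqrt N := sqrt_nonneg _
        have p2 : 0 ≤ 4 * R * N * sqrt A := by positivity
        have p3 : 0 ≤ 8 * sqrt B := by positivity
        nlinarith [mul_nonneg p1 p2, mul_nonneg p1 p3, mul_nonneg p2 p3]
  refine (weyl_diff f N).trans ?_
  have hs := sum_le_sum hu
  rw [sum_add_distrib, sum_const, card_range, nsmul_eq_mul, ← mul_sum] at hs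
  have h2 : ∑ u ∈ range N, sqrt (sqrt (N / l) * (1 / sqrt ((u + 1 : ℕ) : ℝ))) ≤ 2 * N / sqrt (sqrt l) := by
    refine abs_le_of_sq_le_sq' (le_trans (sq_sum_le_card_mul_sum_sq) ?_) (by positivity) |>.2
    rw [card_range]
    have : ∀ u : ℕ, sqrt (sqrt (N / l) * (1 / sqrt ((u + 1 : ℕ) : ℝ))) ^ 2 = sqrt (N / l) * (1 / sqrt ((u + 1 : ℕ) : ℝ)) :=
      fun u => sq_sqrt (by positivity)
    simp only [this]
    rw [← mul_sum]
    calc _ ≤ (N : ℝ) * (sqrt (N / l) * (2 * sqrt N)) := by gcongr; exact sum_inv_sqrt N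
      _ = 2 * N ^ 2 / sqrt l := by
        rw [sqrt_div hN0]
        have a1 : sqrt N ^ 2 = N := sq_sqrt hN0
        field_simp; rw [a1]; ring
      _ ≤ _ := by
        rw [div_pow, sq_sqrt (sqrt_nonneg _)]
        gcongr
        nlinarith [sq_nonneg (N : ℝ)]
  have e : 32 * N / sqrt (sqrt l) = 16 * (2 * N / sqrt (sqrt l)) := by ring
  rw [e]
  nlinarith

/-- iterated forward differences -/
def dlt : ℕ → (ℝ → ℝ) → ℝ → ℝ
  | 0, F, t => F t
  | k + 1, F, t => dlt k F (t + 1) - dlt k F t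

lemma dlt_deriv (k : ℕ) (F F' : ℝ → ℝ) (a : ℝ) (h : ∀ t, a ≤ t → HasDerivAt F (F' t) t) :
    ∀ t, a ≤ t → HasDerivAt (dlt k F) (dlt k F' t) t := by
  induction k with
  | zero => exact h
  | succ k ih =>
    intro t ht
    have h1 := (ih (t + 1) (by linarith)).comp_add_const t 1
    exact h1.sub (ih t ht)

lemma dlt_mvt (k : ℕ) (F : ℕ → ℝ → ℝ) (a : ℝ) (h : ∀ j t, a ≤ t → HasDerivAt (F j) (F (j + 1) t) t) :
    ∀ b, a ≤ b → ∃ ξ, b ≤ ξ ∧ ξ ≤ b + k ∧ dlt k (F 0) b = F k ξ := by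
  induction k generalizing F with
  | zero => intro b _; exact ⟨b, le_rfl, by simp, rfl⟩
  | succ k ih =>
    intro b hb
    have hd := dlt_deriv k (F 0) (F 1) a (h 0)
    obtain ⟨c, hc, hce⟩ := exists_hasDerivAt_eq_slope (dlt k (F 0)) (dlt k (F 1)) (show b < b + 1 by linarith)
      (fun t ht => (hd t (hb.trans ht.1)).continuousAt.continuousWithinAt) (fun t ht => hd t (hb.trans ht.1.le))
    obtain ⟨ξ, h1, h2, h3⟩ := ih (fun j => F (j + 1)) (fun j t ht => h (j + 1) t ht) c (hb.trans hc.1.le)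
    refine ⟨ξ, hc.1.le.trans h1, ?_, ?_⟩
    · have := hc.2; push_cast; linarith
    · have e : dlt (k + 1) (F 0) b = dlt k (F 1) c := by
        rw [hce]; simp [dlt]
      rw [e]; exact h3

/-- falling factorial -/
def ffac (γ : ℝ) (j : ℕ) : ℝ := ∏ i ∈ range j, (γ - i)

lemma rpow_family (γ : ℝ) (j : ℕ) (t : ℝ) (ht : 0 < t) :
    HasDerivAt (fun t : ℝ => ffac γ j * t ^ (γ - j)) (ffac γ (j + 1) * t ^ (γ - (j + 1 : ℕ))) t := by
  have := (hasDerivAt_rpow_const (x := t) (p := γ - j) (Or.inl ht.ne')).const_mul (ffac γ j)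
  have e : ffac γ (j + 1) * t ^ (γ - (j + 1 : ℕ)) = ffac γ j * ((γ - j) * t ^ (γ - j - 1)) := by
    unfold ffac
    rw [prod_range_succ, mul_assoc]
    congr 3; push_cast; ring
  rw [e]; exact this

lemma dlt_rpow (γ : ℝ) (k : ℕ) (b : ℝ) (hb : 0 < b) :
    ∃ ξ, b ≤ ξ ∧ ξ ≤ b + k ∧ dlt k (fun t => t ^ γ) b = ffac γ k * ξ ^ (γ - k) := by
  have := dlt_mvt k (fun j t => ffac γ j * t ^ (γ - j)) b (fun j t ht => rpow_family γ j t (hb.trans_le ht)) b le_rfl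
  simpa [ffac] using this

/-- the block exponential sum phase -/
def phs (d : ℕ) (γ α β : ℝ) (h ι : ℕ) (m : ℕ) : ℝ := α * (m : ℝ) ^ d + β * m + h * ((m : ℝ) + ι) ^ γ

/-- block bound -/
def BB (d : ℕ) (γ κ : ℝ) : Prop := ∃ C : ℝ, 0 < C ∧ ∀ x X N h ι : ℕ, ∀ α β : ℝ, 1 ≤ X → X ≤ x → N ≤ X → 1 ≤ h →
  (h : ℝ) ≤ (x : ℝ) ^ (2 * κ) → ι ≤ 1 → ‖∑ n ∈ range N, eC (phs d γ α β h ι (X + n))‖ ≤ C * (x : ℝ) ^ (1 - κ)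

lemma dlt_range {γ : ℝ} {k X N ι n : ℕ} (hγ1 : γ < 1) (hk : 1 ≤ k) (hX : 1 ≤ X) (hN : N ≤ X) (hι : ι ≤ 1) (hn : n + k ≤ N) {σ : ℝ}
    (hf : 0 < σ * ffac γ k) :
    (σ * ffac γ k) * (3 * (X : ℝ)) ^ (γ - k) ≤ σ * dlt k (fun t => t ^ γ) (((X + n : ℕ) : ℝ) + ι) ∧
    σ * dlt k (fun t => t ^ γ) (((X + n : ℕ) : ℝ) + ι) ≤ (3 ^ (k - γ)) * ((σ * ffac γ k) * (3 * (X : ℝ)) ^ (γ - k)) := by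
  have hX' : (1 : ℝ) ≤ X := by exact_mod_cast hX
  have hk' : (1 : ℝ) ≤ k := by exact_mod_cast hk
  obtain ⟨ξ, h1, h2, h3⟩ := dlt_rpow γ k (((X + n : ℕ) : ℝ) + ι) (by positivity)
  rw [h3, ← mul_assoc]
  have hb : ((X + n : ℕ) : ℝ) + ι + k ≤ 3 * X := by exact_mod_cast (by omega : X + n + ι + k ≤ 3 * X)
  have hlo : (X : ℝ) ≤ ξ := by
    refine le_trans ?_ h1
    exact_mod_cast (by omega : X ≤ X + n + ι)
  constructor
  · gcongr 1
    exact rpow_le_rpow_of_nonpos (by linarith) (by linarith) (by linarith)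
  · have e : (3 : ℝ) ^ (k - γ) * ((σ * ffac γ k) * (3 * (X : ℝ)) ^ (γ - k)) = (σ * ffac γ k) * (X : ℝ) ^ (γ - k) := by
      rw [mul_rpow (by norm_num) (by positivity), mul_left_comm, ← mul_assoc (3 ^ _), ← rpow_add (by norm_num)]
      simp
    rw [e]
    gcongr 1
    exact rpow_le_rpow_of_nonpos (by linarith) hlo (by linarith)

lemma bb_two {γ κ : ℝ} (h0 : 0 < γ) (hγ1 : γ < 1) (hκ0 : 0 < κ) (hκ : κ ≤ 1 / 6) (hκ2 : κ ≤ γ / 4) : BB 2 γ κ := by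
  have hff : 0 < ffac γ 3 := by
    simp only [ffac, prod_range_succ, prod_range_zero]; push_cast
    have : 0 < (1 - γ) * (2 - γ) := mul_pos (by linarith) (by linarith)
    nlinarith
  set c := ffac γ 3 * 3 ^ (γ - 3) with hc
  have hc0 : 0 < c := by positivity
  set R : ℝ := 3 ^ (3 - γ) with hR
  have hR1 : 1 ≤ R := one_le_rpow (by norm_num) (by linarith)
  have hC0 : 0 < 1 + 16 * R * sqrt c + 64 / sqrt c := by positivity
  refine ⟨sqrt (1 + 16 * R * sqrt c + 64 / sqrt c), by positivity, ?_⟩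
  intro x X N h ι α β hX hXx hN hh hhx hι
  have hX' : (1 : ℝ) ≤ X := by exact_mod_cast hX
  have hh' : (1 : ℝ) ≤ h := by exact_mod_cast hh
  have hx' : (1 : ℝ) ≤ x := by exact_mod_cast hX.trans hXx
  have hXx' : (X : ℝ) ≤ x := by exact_mod_cast hXx
  have hN' : (N : ℝ) ≤ X := by exact_mod_cast hN
  set l : ℝ := h * (c * (X : ℝ) ^ (γ - 3)) with hl
  have hl0 : 0 < l := by positivity
  have hd : ∀ n, n + 3 ≤ N → _ := fun n hn => dlt_range (γ := γ) (k := 3) (n := n) hγ1 (by norm_num) hX hN hι hn (σ := 1) (by simpa using hff)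
  have ec : ffac γ 3 * (3 * (X : ℝ)) ^ (γ - 3) = c * (X : ℝ) ^ (γ - 3) := by
    rw [mul_rpow (by norm_num) (by positivity), hc]; ring
  have ht := td_test (fun n => phs 2 γ α β h ι (X + n)) l R hl0 hR1 N (fun n hn => by
    have := hd n hn
    simp only [one_mul, Nat.cast_ofNat] at this
    rw [ec, ← hR] at this
    have e : phs 2 γ α β h ι (X + (n + 3)) - 3 * phs 2 γ α β h ι (X + (n + 2)) + 3 * phs 2 γ α β h ι (X + (n + 1)) - phs 2 γ α β h ι (X + n)
       = h * dlt 3 (fun t => t ^ γ) (((X + n : ℕ) : ℝ) + ι) := by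
      simp only [phs, dlt]; push_cast
      simp only [show (X : ℝ) + (n + 3) + ι = X + n + ι + 1 + 1 + 1 by ring, show (X : ℝ) + (n + 2) + ι = X + n + ι + 1 + 1 by ring,
        show (X : ℝ) + (n + 1) + ι = X + n + ι + 1 by ring]
      ring
    rw [e, hl]
    constructor
    · exact mul_le_mul_of_nonneg_left this.1 (by positivity)
    · rw [mul_left_comm]; exact mul_le_mul_of_nonneg_left this.2 (by positivity))
  have hx0 : (0 : ℝ) < x := by linarith
  refine abs_le_of_sq_le_sq' (le_trans ht ?_) (by positivity) |>.2
  rw [mul_pow, sq_sqrt hC0.le, ← rpow_natCast (_ ^ _), ← rpow_mul hx0.le]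
  have hexp : (1 - κ) * ((2 : ℕ) : ℝ) = 2 - 2 * κ := by push_cast; ring
  rw [hexp]
  have t1 : (N : ℝ) ≤ (x : ℝ) ^ (2 - 2 * κ) := by
    calc (N : ℝ) ≤ x := hN'.trans hXx'
      _ = (x : ℝ) ^ (1 : ℝ) := (rpow_one _).symm
      _ ≤ _ := rpow_le_rpow_of_exponent_le hx' (by linarith)
  have t2 : (N : ℝ) ^ 2 * sqrt (N * l) ≤ sqrt c * (x : ℝ) ^ (2 - 2 * κ) := by
    have s1 : sqrt (N * l) ≤ sqrt c * ((x : ℝ) ^ κ * (X : ℝ) ^ (-1 / 2 : ℝ)) := by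
      rw [sqrt_le_left (by positivity), mul_pow, sq_sqrt hc0.le, mul_pow, ← rpow_natCast, ← rpow_natCast,
        ← rpow_mul hx0.le, ← rpow_mul (by positivity)]
      have e1 : κ * ((2 : ℕ) : ℝ) = 2 * κ := by push_cast; ring
      have e2 : (-1 / 2 : ℝ) * ((2 : ℕ) : ℝ) = 1 + (-2) := by push_cast; ring
      rw [e1, e2, rpow_add (by positivity), rpow_one, hl]
      calc (N : ℝ) * (h * (c * (X : ℝ) ^ (γ - 3))) ≤ X * ((x : ℝ) ^ (2 * κ) * (c * (X : ℝ) ^ (-2 : ℝ))) := by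
            gcongr
            · linarith
        _ = _ := by ring
    calc (N : ℝ) ^ 2 * sqrt (N * l) ≤ (X : ℝ) ^ 2 * (sqrt c * ((x : ℝ) ^ κ * (X : ℝ) ^ (-1 / 2 : ℝ))) := by gcongr
      _ = sqrt c * ((x : ℝ) ^ κ * (X : ℝ) ^ (3 / 2 : ℝ)) := by
        rw [show (3 / 2 : ℝ) = ((2 : ℕ) : ℝ) + (-1 / 2) by push_cast; norm_num, rpow_add (by positivity), rpow_natCast]; ring
      _ ≤ sqrt c * ((x : ℝ) ^ κ * (x : ℝ) ^ (3 / 2 : ℝ)) := by gcongr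
      _ = sqrt c * (x : ℝ) ^ (κ + 3 / 2) := by rw [rpow_add hx0]
      _ ≤ _ := by gcongr; linarith
  have t3 : sqrt (N / l) ≤ 1 / sqrt c * (x : ℝ) ^ (2 - 2 * κ) := by
    have e1 : (N : ℝ) / l ≤ (1 / c) * (X : ℝ) ^ (4 - γ) := by
      rw [div_le_iff₀ hl0, hl]
      have : (1 / c) * (X : ℝ) ^ (4 - γ) * (h * (c * (X : ℝ) ^ (γ - 3))) = h * ((X : ℝ) ^ (4 - γ) * (X : ℝ) ^ (γ - 3)) := by field_simp
      rw [this, ← rpow_add (by positivity), show 4 - γ + (γ - 3) = 1 by ring, rpow_one]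
      nlinarith
    calc _ ≤ sqrt ((1 / c) * (X : ℝ) ^ (4 - γ)) := sqrt_le_sqrt e1
      _ = 1 / sqrt c * (X : ℝ) ^ ((4 - γ) / 2) := by
        rw [sqrt_mul (by positivity), sqrt_div zero_le_one, sqrt_one, sqrt_eq_rpow (_ ^ _), ← rpow_mul (by positivity)]
        congr 2; ring
      _ ≤ 1 / sqrt c * (x : ℝ) ^ ((4 - γ) / 2) := by gcongr; linarith
      _ ≤ _ := by gcongr; linarith
  calc _ = (N : ℝ) + 16 * R * (N ^ 2 * sqrt (N * l)) + 64 * sqrt (N / l) := by ring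
    _ ≤ (x : ℝ) ^ (2 - 2 * κ) + 16 * R * (sqrt c * (x : ℝ) ^ (2 - 2 * κ)) + 64 * (1 / sqrt c * (x : ℝ) ^ (2 - 2 * κ)) := by gcongr
    _ = _ := by ring

lemma sqsq (a : ℝ) (ha : 0 ≤ a) : sqrt (sqrt a) = a ^ (1 / 4 : ℝ) := by
  rw [sqrt_eq_rpow, sqrt_eq_rpow, ← rpow_mul ha]; norm_num

lemma bb_three {γ κ : ℝ} (h0 : 0 < γ) (hγ1 : γ < 1) (hκ0 : 0 < κ) (hκ : κ ≤ 1 / 10) (hκ2 : κ ≤ γ / 8) : BB 3 γ κ := by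
  have hff : 0 < -1 * ffac γ 4 := by
    simp only [ffac, prod_range_succ, prod_range_zero]; push_cast
    have : 0 < γ * ((1 - γ) * ((2 - γ) * (3 - γ))) := mul_pos h0 (mul_pos (by linarith) (mul_pos (by linarith) (by linarith)))
    linarith
  set c := (-1 * ffac γ 4) * 3 ^ (γ - 4) with hc
  have hc0 : 0 < c := by positivity
  clear_value c
  set R : ℝ := 3 ^ (4 - γ) with hR
  have hR1 : 1 ≤ R := one_le_rpow (by norm_num) (by linarith)
  set c4 := c ^ (1 / 4 : ℝ) with hc4
  have hc40 : 0 < c4 := by positivity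
  have hC0 : 0 < 1 + 2 + 8 * R * c4 + 32 / c4 := by positivity
  refine ⟨sqrt (1 + 2 + 8 * R * c4 + 32 / c4), by positivity, ?_⟩
  intro x X N h ι α β hX hXx hN hh hhx hι
  have hX' : (1 : ℝ) ≤ X := by exact_mod_cast hX
  have hh' : (1 : ℝ) ≤ h := by exact_mod_cast hh
  have hx' : (1 : ℝ) ≤ x := by exact_mod_cast hX.trans hXx
  have hXx' : (X : ℝ) ≤ x := by exact_mod_cast hXx
  have hN' : (N : ℝ) ≤ X := by exact_mod_cast hN
  set l : ℝ := h * (c * (X : ℝ) ^ (γ - 4)) with hl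
  have hl0 : 0 < l := by positivity
  have hd : ∀ n, n + 4 ≤ N → _ := fun n hn => dlt_range (γ := γ) (k := 4) (n := n) hγ1 (by norm_num) hX hN hι hn (σ := -1) hff
  have ec : -1 * ffac γ 4 * (3 * (X : ℝ)) ^ (γ - 4) = c * (X : ℝ) ^ (γ - 4) := by
    rw [mul_rpow (by norm_num) (by positivity), hc]; ring
  have ht := fd_test (fun n => -phs 3 γ α β h ι (X + n)) l R hl0 hR1 N (fun n hn => by
    have := hd n hn
    simp only [Nat.cast_ofNat] at this
    rw [ec, ← hR] at this
    have e : -phs 3 γ α β h ι (X + (n + 4)) - 4 * -phs 3 γ α β h ι (X + (n + 3)) + 6 * -phs 3 γ α β h ι (X + (n + 2)) - 4 * -phs 3 γ α β h ι (X + (n + 1)) + -phs 3 γ α β h ι (X + n)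
       = h * (-1 * dlt 4 (fun t => t ^ γ) (((X + n : ℕ) : ℝ) + ι)) := by
      simp only [phs, dlt]; push_cast
      simp only [show (X : ℝ) + (n + 4) + ι = X + n + ι + 1 + 1 + 1 + 1 by ring, show (X : ℝ) + (n + 3) + ι = X + n + ι + 1 + 1 + 1 by ring, show (X : ℝ) + (n + 2) + ι = X + n + ι + 1 + 1 by ring,
        show (X : ℝ) + (n + 1) + ι = X + n + ι + 1 by ring]
      ring
    rw [e, hl]
    constructor
    · exact mul_le_mul_of_nonneg_left this.1 (by positivity)
    · rw [mul_left_comm R]; exact mul_le_mul_of_nonneg_left this.2 (by positivity))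
  rw [sd_conj, sqsq _ (by positivity), sqsq _ hl0.le] at ht
  have hx0 : (0 : ℝ) < x := by linarith
  refine abs_le_of_sq_le_sq' (le_trans ht ?_) (by positivity) |>.2
  rw [mul_pow, sq_sqrt hC0.le, ← rpow_natCast (_ ^ _), ← rpow_mul hx0.le]
  have hexp : (1 - κ) * ((2 : ℕ) : ℝ) = 2 - 2 * κ := by push_cast; ring
  rw [hexp]
  have hNx : (N : ℝ) ≤ x := hN'.trans hXx'
  have t1 : (N : ℝ) ≤ (x : ℝ) ^ (2 - 2 * κ) := by
    calc (N : ℝ) ≤ x := hNx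
      _ = (x : ℝ) ^ (1 : ℝ) := (rpow_one _).symm
      _ ≤ _ := rpow_le_rpow_of_exponent_le hx' (by linarith)
  have t0 : (N : ℝ) * sqrt N ≤ (x : ℝ) ^ (2 - 2 * κ) := by
    calc (N : ℝ) * sqrt N ≤ x * sqrt x := by gcongr
      _ = (x : ℝ) ^ (1 + 1 / 2 : ℝ) := by rw [rpow_add hx0, rpow_one, sqrt_eq_rpow]
      _ ≤ _ := rpow_le_rpow_of_exponent_le hx' (by linarith)
  have t2 : (N : ℝ) ^ 2 * (N * (N * l)) ^ (1 / 4 : ℝ) ≤ c4 * (x : ℝ) ^ (2 - 2 * κ) := by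
    have s1 : (N * (N * l)) ≤ c * ((x : ℝ) ^ (2 * κ) * (X : ℝ) ^ (-1 : ℝ)) := by
      have e2 : (-1 : ℝ) = ((2 : ℕ) : ℝ) + (-3) := by push_cast; ring
      rw [e2, rpow_add (by positivity), rpow_natCast, hl]
      calc (N : ℝ) * (N * (h * (c * (X : ℝ) ^ (γ - 4)))) ≤ X * (X * ((x : ℝ) ^ (2 * κ) * (c * (X : ℝ) ^ (-3 : ℝ)))) := by
            gcongr
            · linarith
        _ = _ := by ring
    calc (N : ℝ) ^ 2 * (N * (N * l)) ^ (1 / 4 : ℝ) ≤ (X : ℝ) ^ 2 * (c * ((x : ℝ) ^ (2 * κ) * (X : ℝ) ^ (-1 : ℝ))) ^ (1 / 4 : ℝ) := by gcongr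
      _ = c4 * ((x : ℝ) ^ (κ / 2) * (X : ℝ) ^ (7 / 4 : ℝ)) := by
        rw [mul_rpow hc0.le (by positivity), mul_rpow (by positivity) (by positivity), ← rpow_mul hx0.le, ← rpow_mul (by positivity),
          show (7 / 4 : ℝ) = ((2 : ℕ) : ℝ) + (-1 * (1 / 4)) by push_cast; norm_num, rpow_add (by positivity), rpow_natCast,
          show 2 * κ * (1 / 4) = κ / 2 by ring]; ring
      _ ≤ c4 * ((x : ℝ) ^ (κ / 2) * (x : ℝ) ^ (7 / 4 : ℝ)) := by gcongr
      _ = c4 * (x : ℝ) ^ (κ / 2 + 7 / 4) := by rw [rpow_add hx0]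
      _ ≤ _ := by gcongr; linarith
  have t3 : N / l ^ (1 / 4 : ℝ) ≤ 1 / c4 * (x : ℝ) ^ (2 - 2 * κ) := by
    have e1 : c * (X : ℝ) ^ (γ - 4) ≤ l := by
      rw [hl]; exact le_mul_of_one_le_left (by positivity) hh'
    calc N / l ^ (1 / 4 : ℝ) ≤ X / (c * (X : ℝ) ^ (γ - 4)) ^ (1 / 4 : ℝ) := by gcongr
      _ = 1 / c4 * (X : ℝ) ^ (2 - γ / 4) := by
        rw [mul_rpow hc0.le (by positivity), ← rpow_mul (by positivity), show 2 - γ / 4 = 1 - (γ - 4) * (1 / 4) by ring,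
          rpow_sub (by positivity), rpow_one]
        field_simp; rfl
      _ ≤ 1 / c4 * (x : ℝ) ^ (2 - γ / 4) := by gcongr; linarith
      _ ≤ _ := by gcongr; linarith
  calc _ = (N : ℝ) + 2 * (N * sqrt N) + 8 * R * (N ^ 2 * (N * (N * l)) ^ (1 / 4 : ℝ)) + 32 * (N / l ^ (1 / 4 : ℝ)) := by ring
    _ ≤ (x : ℝ) ^ (2 - 2 * κ) + 2 * (x : ℝ) ^ (2 - 2 * κ) + 8 * R * (c4 * (x : ℝ) ^ (2 - 2 * κ)) + 32 * (1 / c4 * (x : ℝ) ^ (2 - 2 * κ)) := by gcongr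
    _ = _ := by ring

lemma dual_ls {μ ν : Type*} (M : Finset μ) (Ω : Finset ν) (E : μ → ν → ℂ) (c : ν → ℝ) (B : ℝ)
    (hB0 : 0 ≤ B) (hB : ∀ m ∈ M, ∑ m' ∈ M, ‖∑ n ∈ Ω, E m n * (starRingEnd ℂ) (E m' n)‖ ≤ B) :
    ∑ m ∈ M, ‖∑ n ∈ Ω, (c n : ℂ) * E m n‖ ^ 2 ≤ B * ∑ n ∈ Ω, c n ^ 2 := by
  set G : μ → ℂ := fun m => ∑ n ∈ Ω, (c n : ℂ) * E m n with hG
  set K : μ → μ → ℂ := fun m m' => ∑ n ∈ Ω, E m n * (starRingEnd ℂ) (E m' n) with hK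
  set V := ∑ m ∈ M, ‖G m‖ ^ 2 with hV
  have hsym : ∀ m m', ‖K m m'‖ = ‖K m' m‖ := by
    intro m m'
    rw [← RCLike.norm_conj (K m m')]
    congr 1
    simp only [hK, map_sum, map_mul, Complex.conj_conj]
    exact sum_congr rfl fun _ _ => mul_comm _ _
  set H : ν → ℂ := fun n => ∑ m ∈ M, (starRingEnd ℂ) (G m) * E m n with hH
  have e1 : (V : ℂ) = ∑ n ∈ Ω, (c n : ℂ) * H n := by
    simp only [hH, mul_sum]
    rw [sum_comm, hV]
    push_cast
    refine sum_congr rfl fun m _ => ?_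
    rw [← Complex.conj_mul' (G m)]
    conv_lhs => rw [show G m = ∑ n ∈ Ω, (c n : ℂ) * E m n from rfl, mul_sum]
    exact sum_congr rfl fun _ _ => by ring
  have e2 : ∑ n ∈ Ω, ‖H n‖ ^ 2 ≤ B * V := by
    have : ((∑ n ∈ Ω, ‖H n‖ ^ 2 : ℝ) : ℂ) = ∑ m ∈ M, ∑ m' ∈ M, (starRingEnd ℂ) (G m) * G m' * K m m' := by
      push_cast
      simp only [← Complex.mul_conj', hH, map_sum, map_mul, Complex.conj_conj, sum_mul_sum]
      rw [sum_comm]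
      refine sum_congr rfl fun m _ => ?_
      rw [sum_comm]
      refine sum_congr rfl fun m' _ => ?_
      rw [hK, mul_sum]
      exact sum_congr rfl fun _ _ => by ring
    have h2 : ∑ n ∈ Ω, ‖H n‖ ^ 2 ≤ ∑ m ∈ M, ∑ m' ∈ M, ‖G m‖ * ‖G m'‖ * ‖K m m'‖ := by
      have h3 : ‖((∑ n ∈ Ω, ‖H n‖ ^ 2 : ℝ) : ℂ)‖ = ∑ n ∈ Ω, ‖H n‖ ^ 2 := by
        rw [Complex.norm_real, norm_of_nonneg (by positivity)]
      rw [← h3, this]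
      refine (norm_sum_le _ _).trans (sum_le_sum fun m _ => (norm_sum_le _ _).trans (sum_le_sum fun m' _ => ?_))
      simp
    refine h2.trans ?_
    have h4 : ∑ m ∈ M, ∑ m' ∈ M, ‖G m‖ * ‖G m'‖ * ‖K m m'‖ ≤
        ∑ m ∈ M, ∑ m' ∈ M, (‖G m‖ ^ 2 * ‖K m m'‖ / 2 + ‖G m'‖ ^ 2 * ‖K m m'‖ / 2) := by
      refine sum_le_sum fun m _ => sum_le_sum fun m' _ => ?_
      nlinarith [mul_nonneg (sq_nonneg (‖G m‖ - ‖G m'‖)) (norm_nonneg (K m m'))]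
    refine h4.trans ?_
    simp only [sum_add_distrib]
    have h5 : ∑ m ∈ M, ∑ m' ∈ M, ‖G m'‖ ^ 2 * ‖K m m'‖ / 2 = ∑ m ∈ M, ∑ m' ∈ M, ‖G m‖ ^ 2 * ‖K m m'‖ / 2 := by
      rw [sum_comm]
      simp only [hsym]
    have h6 : ∑ m ∈ M, ∑ m' ∈ M, ‖G m‖ ^ 2 * ‖K m m'‖ / 2 ≤ B * V / 2 := by
      rw [hV, mul_sum, sum_div]
      refine sum_le_sum fun m hm => ?_
      rw [← sum_div, ← mul_sum]
      nlinarith [mul_le_mul_of_nonneg_left (hB m hm) (sq_nonneg ‖G m‖)]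
    rw [h5]; linarith
  have hV0 : 0 ≤ V := by positivity
  have e3 : V ^ 2 ≤ (∑ n ∈ Ω, c n ^ 2) * (B * V) := by
    have h1 : V ≤ ∑ n ∈ Ω, |c n| * ‖H n‖ := by
      have : V = ‖(V : ℂ)‖ := by rw [Complex.norm_real, norm_of_nonneg hV0]
      rw [this, e1]
      refine (norm_sum_le _ _).trans (sum_le_sum fun n _ => ?_)
      simp
    calc V ^ 2 ≤ (∑ n ∈ Ω, |c n| * ‖H n‖) ^ 2 := by gcongr
      _ ≤ (∑ n ∈ Ω, |c n| ^ 2) * ∑ n ∈ Ω, ‖H n‖ ^ 2 := sum_mul_sq_le_sq_mul_sq _ _ _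
      _ ≤ _ := by simp only [sq_abs]; gcongr
  rcases hV0.eq_or_lt with h | h
  · rw [← h]; positivity
  · nlinarith

lemma vino_ls (k s : ℕ) (U : ℕ) (M : Finset ℕ) (a : ℕ → Fin k → ℝ) (j0 : Fin k) (B : ℝ) (hB0 : 0 ≤ B)
    (hB : ∀ m ∈ M, ∑ m' ∈ M, ‖∑ l ∈ range (s * U ^ (j0.1 + 1) + 1), eC ((a m j0 - a m' j0) * l)‖ ≤ B) :
    ∑ m ∈ M, ‖∑ u ∈ range U, eC (∑ j, a m j * (u : ℝ) ^ (j.1 + 1))‖ ^ (2 * s) ≤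
      (∏ j ∈ univ.erase j0, (s * (U : ℝ) ^ (j.1 + 1) + 1)) * B * vJ k s (Ico 0 (U : ℤ)) := by
  set Ω : Finset (Fin k → ℤ) := Fintype.piFinset fun j => Ico 0 ((s * U ^ (j.1 + 1) + 1 : ℕ) : ℤ) with hΩ
  set E : ℕ → (Fin k → ℤ) → ℂ := fun m n => ∏ j, eC (a m j * n j) with hE
  set Xs : Finset (Fin s → ℤ) := Fintype.piFinset fun _ => Ico 0 (U : ℤ) with hXs
  set p : (Fin s → ℤ) → Fin k → ℤ := fun x j => ∑ i, x i ^ (j.1 + 1) with hp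
  set c : (Fin k → ℤ) → ℕ := fun n => (Xs.filter fun x => p x = n).card with hc
  have hico : ∀ (N : ℕ) (f : ℤ → ℂ), ∑ l ∈ Ico 0 (N : ℤ), f l = ∑ l ∈ range N, f l := by
    intro N f
    rw [← Nat.Ico_zero_eq_range]
    have := sum_image (f := f) (s := Ico 0 N) (g := fun n : ℕ => (n : ℤ)) (by intro a _ b _ h; simpa using h)
    rw [← this]
    congr 1
    ext z
    simp only [mem_image, mem_Ico]
    constructor
    · intro h; exact ⟨z.toNat, by omega, by omega⟩
    · rintro ⟨n, h, rfl⟩; omega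
  have hpm : ∀ x ∈ Xs, p x ∈ Ω := by
    intro x hx
    simp only [hXs, Fintype.mem_piFinset, mem_Ico] at hx
    simp only [hΩ, Fintype.mem_piFinset, mem_Ico, hp]
    intro j
    have h1 : ∑ i, x i ^ (j.1 + 1) ≤ ∑ i : Fin s, (U : ℤ) ^ (j.1 + 1) :=
      sum_le_sum fun i _ => pow_le_pow_left₀ (hx i).1 (hx i).2.le _
    refine ⟨sum_nonneg fun i _ => pow_nonneg (hx i).1 _, ?_⟩
    simp at h1
    push_cast
    linarith
  have hK : ∀ m m', ∑ n ∈ Ω, E m n * (starRingEnd ℂ) (E m' n) =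
      ∏ j, ∑ l ∈ range (s * U ^ (j.1 + 1) + 1), eC ((a m j - a m' j) * l) := by
    intro m m'
    have : ∀ j : Fin k, ∑ l ∈ range (s * U ^ (j.1 + 1) + 1), eC ((a m j - a m' j) * l) =
        ∑ l ∈ Ico 0 ((s * U ^ (j.1 + 1) + 1 : ℕ) : ℤ), eC ((a m j - a m' j) * l) := by
      intro j; rw [hico]; simp
    simp only [this]
    rw [prod_univ_sum]
    refine sum_congr rfl fun n _ => ?_
    simp only [hE, map_prod, ← prod_mul_distrib, eC_conj_mul, sub_mul]
  have hKb : ∀ m ∈ M, ∑ m' ∈ M, ‖∑ n ∈ Ω, E m n * (starRingEnd ℂ) (E m' n)‖ ≤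
      (∏ j ∈ univ.erase j0, (s * (U : ℝ) ^ (j.1 + 1) + 1)) * B := by
    intro m hm
    refine le_trans ?_ (mul_le_mul_of_nonneg_left (hB m hm) (by positivity))
    rw [mul_sum]
    refine sum_le_sum fun m' _ => ?_
    rw [hK, norm_prod, ← prod_erase_mul _ _ (mem_univ j0)]
    gcongr with j hj
    refine (norm_sum_eC_le _ _).trans ?_
    simp
  have h := dual_ls M Ω E (fun n => c n) _ (by positivity) hKb
  have hS : ∀ m, ∑ n ∈ Ω, (((c n : ℕ) : ℝ) : ℂ) * E m n = (∑ u ∈ range U, eC (∑ j, a m j * (u : ℝ) ^ (j.1 + 1))) ^ s := by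
    intro m
    have h1 : (∑ u ∈ range U, eC (∑ j, a m j * (u : ℝ) ^ (j.1 + 1))) =
      ∑ u ∈ Ico 0 (U : ℤ), eC (∑ j, a m j * (u : ℝ) ^ (j.1 + 1)) := by rw [hico]; simp
    rw [h1]
    have h2 : (∑ u ∈ Ico 0 (U : ℤ), eC (∑ j, a m j * (u : ℝ) ^ (j.1 + 1))) ^ s =
        ∏ _i : Fin s, ∑ u ∈ Ico 0 (U : ℤ), eC (∑ j, a m j * (u : ℝ) ^ (j.1 + 1)) := by simp
    have hee : ∀ {ι : Type} (t : Finset ι) (f : ι → ℝ), ∏ i ∈ t, eC (f i) = eC (∑ i ∈ t, f i) := by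
      intro ι t f
      induction t using Finset.induction_on with
      | empty => simp [eC_zero]
      | insert i t hi ih => rw [prod_insert hi, sum_insert hi, eC_add, ih]
    rw [h2, prod_univ_sum, ← sum_fiberwise_of_maps_to hpm]
    refine sum_congr rfl fun n _ => ?_
    rw [sum_congr rfl (g := fun _ => E m n)]
    · simp [hc]
    · intro x hx
      have := (mem_filter.1 hx).2
      simp only [hE, hee, ← this, hp]
      rw [sum_comm]
      congr 1
      refine sum_congr rfl fun j _ => ?_
      push_cast
      rw [mul_sum]
  have hJ : ∑ n ∈ Ω, ((c n : ℕ) : ℝ) ^ 2 = vJ k s (Ico 0 (U : ℤ)) := by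
    have h1 : ∀ xy ∈ vPairs (ι := Fin s) k (fun _ => Ico 0 (U : ℤ)) (fun _ => Ico 0 (U : ℤ)), p xy.1 ∈ Ω := by
      intro xy hxy
      simp only [vPairs, mem_filter, mem_product] at hxy
      exact hpm _ (by simpa [hXs] using hxy.1.1)
    rw [vJ, card_eq_sum_card_fiberwise h1]
    push_cast
    refine sum_congr rfl fun n _ => ?_
    rw [sq, ← Nat.cast_mul, hc]
    rw [← card_product]
    congr 2
    ext ⟨x, y⟩
    simp only [vPairs, mem_filter, mem_product, hXs, hp, Fintype.mem_piFinset]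
    constructor
    · rintro ⟨⟨h1, h2⟩, h3, h4⟩
      refine ⟨⟨⟨h1, h3⟩, fun j hj => ?_⟩, h2⟩
      have h5 := congrFun h2 ⟨j, hj⟩
      have h6 := congrFun h4 ⟨j, hj⟩
      simp only at h5 h6
      rw [h5, h6]
    · rintro ⟨⟨⟨h1, h3⟩, h4⟩, h2⟩
      refine ⟨⟨h1, h2⟩, h3, ?_⟩
      rw [← h2]
      funext j
      exact (h4 j j.2).symm
  rw [hJ] at h
  refine le_trans (le_of_eq ?_) h
  refine sum_congr rfl fun m _ => ?_
  rw [hS, norm_pow, ← pow_mul, mul_comm]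

lemma lin_bound (t : ℝ) (n : ℤ) (δ : ℝ) (h0 : 0 < δ) (h1 : n + δ ≤ t) (h2 : t ≤ n + 1 - δ) (L : ℕ) :
    ‖∑ l ∈ range L, eC (t * l)‖ ≤ 2 / δ := by
  refine kuz (fun l => t * l) L δ n h0 (fun l _ => ?_) (fun l _ => ?_) (fun l _ => ?_) <;> push_cast <;> linarith

def wu (q L : ℕ) (ρ : ℝ) (b : ℕ) : ℝ := (if (b : ℝ) < 2 * q * ρ + 1 then (L : ℝ) else 0) + 8 * q / (b + 1)

lemma wu_nonneg (q L : ℕ) (ρ : ℝ) (b : ℕ) : 0 ≤ wu q L ρ b := by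
  unfold wu; split_ifs <;> positivity

lemma wu_pt (q : ℕ) (hq : 1 ≤ q) (r : ℤ) (t ρ : ℝ) (hρ : 0 ≤ ρ) (ht : |t - r / q| ≤ ρ) (L : ℕ) :
    ‖∑ l ∈ range L, eC (t * l)‖ ≤ wu q L ρ (r % q).toNat + wu q L ρ (q - 1 - (r % q).toNat) := by
  have hq' : (0 : ℝ) < q := by exact_mod_cast hq
  obtain ⟨b, hb⟩ : ∃ b : ℕ, r % q = b := ⟨(r % q).toNat, by have := Int.emod_nonneg r (by omega : (q : ℤ) ≠ 0); omega⟩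
  have hbq : b < q := by have := Int.emod_lt_of_pos r (by omega : (0 : ℤ) < q); omega
  have hr : (r : ℝ) / q = (r / q : ℤ) + (b : ℝ) / q := by
    have h := Int.mul_ediv_add_emod r q
    rw [hb] at h
    have h' : (q : ℝ) * (r / q : ℤ) + b = r := by exact_mod_cast h
    rw [← h']; field_simp
  have hc : (((q - 1 - b : ℕ)) : ℝ) = q - 1 - b := by
    rw [Nat.cast_sub (by omega), Nat.cast_sub hq]; simp
  have htriv := norm_sum_eC_le (fun l => t * l) (range L)
  rw [card_range] at htriv
  rw [hb, Int.toNat_natCast]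
  rw [hr] at ht
  rw [abs_le] at ht
  by_cases h1 : (b : ℝ) < 2 * q * ρ + 1
  · have : (L : ℝ) ≤ wu q L ρ b := by
      unfold wu; rw [if_pos h1]; linarith [show (0 : ℝ) ≤ 8 * q / (b + 1) by positivity]
    linarith [wu_nonneg q L ρ (q - 1 - b)]
  by_cases h2 : (((q - 1 - b : ℕ)) : ℝ) < 2 * q * ρ + 1
  · have : (L : ℝ) ≤ wu q L ρ (q - 1 - b) := by
      unfold wu; rw [if_pos h2]
      linarith [show (0 : ℝ) ≤ 8 * q / ((q - 1 - b : ℕ) + 1) by positivity]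
    linarith [wu_nonneg q L ρ b]
  rw [not_lt] at h1 h2
  rw [hc] at h2
  have hb1 : (1 : ℝ) ≤ b := by nlinarith [mul_nonneg hq'.le hρ]
  have hb2 : (1 : ℝ) ≤ q - b := by nlinarith [mul_nonneg hq'.le hρ]
  have key : ∀ δ : ℝ, 0 < δ → δ ≤ b / (2 * q) → δ ≤ (q - b) / (2 * q) → ‖∑ l ∈ range L, eC (t * l)‖ ≤ 2 / δ := by
    intro δ h0 h3 h4
    have e1 : ρ ≤ b / (2 * q) := by rw [le_div_iff₀ (by positivity)]; nlinarith
    have e2 : ρ ≤ (q - b) / (2 * q) := by rw [le_div_iff₀ (by positivity)]; nlinarith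
    have e3 : (b : ℝ) / q = b / (2 * q) + b / (2 * q) := by field_simp; ring
    have e4 : (b : ℝ) / q = 1 - (q - b) / (2 * q) - (q - b) / (2 * q) := by field_simp; ring
    refine lin_bound t (r / q) δ h0 ?_ ?_ L
    · linarith
    · linarith
  have w1 : 4 * q / b ≤ wu q L ρ b := by
    unfold wu; rw [if_neg (by linarith), zero_add, div_le_div_iff₀ (by linarith) (by linarith)]; nlinarith
  have w2 : 4 * q / (q - b) ≤ wu q L ρ (q - 1 - b) := by
    unfold wu; rw [hc, if_neg (by linarith), zero_add, div_le_div_iff₀ (by linarith) (by linarith)]; nlinarith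
  rcases le_total (b : ℝ) (q - b) with h | h
  · have := key (b / (2 * q)) (by positivity) le_rfl (by gcongr)
    have e : 2 / ((b : ℝ) / (2 * q)) = 4 * q / b := by field_simp; ring
    linarith [wu_nonneg q L ρ (q - 1 - b)]
  · have := key ((q - b) / (2 * q)) (by positivity) (by gcongr) le_rfl
    have e : 2 / (((q : ℝ) - b) / (2 * q)) = 4 * q / (q - b) := by field_simp; ring
    linarith [wu_nonneg q L ρ b]

lemma wu_sum (q L : ℕ) (ρ : ℝ) (hρ : 0 ≤ ρ) :
    ∑ b ∈ range q, wu q L ρ b ≤ L * (2 * q * ρ + 2) + 8 * q * (1 + log q) := by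
  unfold wu
  rw [sum_add_distrib]
  gcongr
  · rw [← sum_filter, sum_const, nsmul_eq_mul, mul_comm]
    gcongr
    have : filter (fun b : ℕ => (b : ℝ) < 2 * q * ρ + 1) (range q) ⊆ range ⌈2 * q * ρ + 1⌉₊ := by
      intro b hb
      rw [mem_range, Nat.lt_ceil]
      exact (mem_filter.1 hb).2
    have h := card_le_card this
    rw [card_range] at h
    have h2 := Nat.ceil_lt_add_one (show 0 ≤ 2 * q * ρ + 1 by positivity)
    have h3 : ((filter (fun b : ℕ => (b : ℝ) < 2 * q * ρ + 1) (range q)).card : ℝ) ≤ ⌈2 * q * ρ + 1⌉₊ := by exact_mod_cast h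
    linarith
  · have := harmonic_le_one_add_log q
    simp only [harmonic, Rat.cast_sum] at this
    simp only [div_eq_mul_inv, ← mul_sum]
    gcongr
    refine le_trans (le_of_eq (sum_congr rfl fun i _ => ?_)) this
    push_cast; rfl

lemma block_sum (q : ℕ) (hq : 1 ≤ q) (a k0 : ℤ) (hco : IsCoprime (q : ℤ) a) (F : ℕ → ℝ) (hF : ∀ b, 0 ≤ F b) :
    ∑ i ∈ range q, F ((a * (k0 + i)) % q).toNat ≤ ∑ b ∈ range q, F b := by
  have hq0 : (q : ℤ) ≠ 0 := by omega
  have hinj : Set.InjOn (fun i : ℕ => ((a * (k0 + i)) % (q : ℤ)).toNat) (range q : Set ℕ) := by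
    intro i hi j hj h
    simp only [coe_range, Set.mem_Iio] at hi hj h
    have h1 := Int.emod_nonneg (a * (k0 + i)) hq0
    have h2 := Int.emod_nonneg (a * (k0 + j)) hq0
    have h3 : (a * (k0 + i)) % (q : ℤ) = (a * (k0 + j)) % (q : ℤ) := by omega
    have h4 : (q : ℤ) ∣ a * (k0 + i) - a * (k0 + j) := Int.ModEq.dvd (Int.ModEq.symm h3)
    have h5 : (q : ℤ) ∣ a * (i - j) := by convert h4 using 1; ring
    have h6 := hco.dvd_of_dvd_mul_left h5
    have h7 := Int.eq_zero_of_abs_lt_dvd h6 (by rw [abs_lt]; omega)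
    omega
  rw [← sum_image (f := F) hinj]
  refine sum_le_sum_of_subset_of_nonneg ?_ (fun b _ _ => hF b)
  intro b hb
  obtain ⟨i, _, rfl⟩ := mem_image.1 hb
  have h1 := Int.emod_nonneg (a * (k0 + i)) hq0
  have h2 := Int.emod_lt_of_pos (a * (k0 + i)) (by omega : (0 : ℤ) < q)
  rw [mem_range]; omega

lemma blocks_sum (q : ℕ) (hq : 1 ≤ q) (a k0 : ℤ) (hco : IsCoprime (q : ℤ) a) (F : ℕ → ℝ) (hF : ∀ b, 0 ≤ F b) (J : ℕ) :
    ∑ i ∈ range (q * J), F ((a * (k0 + i)) % q).toNat ≤ J * ∑ b ∈ range q, F b := by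
  induction J with
  | zero => simp
  | succ J ih =>
    rw [Nat.mul_succ, sum_range_add]
    have := block_sum q hq a (k0 + (q * J : ℕ)) hco F hF
    push_cast at this ⊢
    simp only [add_assoc] at this ⊢
    linarith

lemma spacing (q : ℕ) (hq : 1 ≤ q) (a : ℤ) (hco : IsCoprime (q : ℤ) a) (d X N : ℕ) (hd : 1 ≤ d) (hN : N ≤ X) (θ : ℕ → ℝ) (ρ : ℝ)
    (hρ : 0 ≤ ρ) (L : ℕ)
    (hθ : ∀ n < N, ∀ n' < N, |θ n - θ n' - (a * (d * ((n : ℤ) - n')) : ℤ) / q| ≤ ρ) :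
    ∀ n ∈ range N, ∑ n' ∈ range N, ‖∑ l ∈ range L, eC ((θ n - θ n') * l)‖ ≤
      (2 * d * X / q + 1) * (2 * (L * (2 * q * ρ + 2) + 8 * q * (1 + log q))) := by
  intro n hn
  rw [mem_range] at hn
  set F : ℕ → ℝ := fun b => wu q L ρ b + wu q L ρ (q - 1 - b) with hFd
  have hF : ∀ b, 0 ≤ F b := fun b => add_nonneg (wu_nonneg _ _ _ _) (wu_nonneg _ _ _ _)
  set J := 2 * d * X / q + 1 with hJ
  set G : ℕ → ℝ := fun i => F ((a * (-(d * X : ℕ) + i)) % q).toNat with hG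
  set idx : ℕ → ℕ := fun n' => d * (n + X - n') with hidx
  have h1 : ∑ n' ∈ range N, ‖∑ l ∈ range L, eC ((θ n - θ n') * l)‖ ≤ ∑ n' ∈ range N, G (idx n') := by
    refine sum_le_sum fun n' hn' => ?_
    rw [mem_range] at hn'
    refine (wu_pt q hq _ _ ρ hρ (hθ n hn n' hn') L).trans (le_of_eq ?_)
    have : (-((d * X : ℕ) : ℤ) + (idx n' : ℕ)) = d * ((n : ℤ) - n') := by
      simp only [hidx]; push_cast; rw [Nat.cast_sub (by omega)]; push_cast; ring
    simp only [hG, this, hFd]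
  have hinj : Set.InjOn idx (range N : Set ℕ) := by
    intro i hi j hj h
    simp only [coe_range, Set.mem_Iio, hidx] at hi hj h
    have := Nat.eq_of_mul_eq_mul_left (by omega) h
    omega
  have h2 : ∑ n' ∈ range N, G (idx n') ≤ ∑ i ∈ range (q * J), G i := by
    rw [← sum_image (f := G) hinj]
    refine sum_le_sum_of_subset_of_nonneg ?_ (fun b _ _ => hF _)
    intro b hb
    obtain ⟨i, _, rfl⟩ := mem_image.1 hb
    rw [mem_range]
    have h3 : 2 * d * X < q * J := by rw [hJ]; exact Nat.lt_mul_div_succ _ (by omega)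
    have h4 : d * (n + X - i) ≤ d * (2 * X) := Nat.mul_le_mul_left _ (by omega)
    simp only [hidx]
    linarith
  have h3 := blocks_sum q hq a (-(d * X : ℕ)) hco F hF J
  have h4 : ∑ b ∈ range q, F b ≤ 2 * (L * (2 * q * ρ + 2) + 8 * q * (1 + log q)) := by
    simp only [hFd, sum_add_distrib]
    rw [sum_range_reflect (fun b => wu q L ρ b) q]
    linarith [wu_sum q L ρ hρ]
  have h5 : (J : ℝ) ≤ 2 * d * X / q + 1 := by
    rw [hJ]; push_cast
    have := @Nat.cast_div_le ℝ _ _ _ (2 * d * X) q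
    push_cast at this
    linarith
  have h6 : 0 ≤ ∑ b ∈ range q, F b := sum_nonneg fun b _ => hF b
  calc _ ≤ _ := h1.trans (h2.trans h3)
    _ ≤ _ := by gcongr

lemma taylor_fam (n : ℕ) : ∀ (F : ℕ → ℝ → ℝ) (a M : ℝ) (_ : ∀ j t, a ≤ t → HasDerivAt (F j) (F (j + 1) t) t)
    (_ : ∀ t, a ≤ t → |F n t| ≤ M) (u : ℝ) (_ : 0 ≤ u),
    |F 0 (a + u) - ∑ j ∈ range n, F j a * u ^ j / (j.factorial : ℝ)| ≤ M * u ^ n := by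
  induction n with
  | zero => intro F a M h hM u hu; simpa using hM (a + u) (by linarith)
  | succ n ih =>
    intro F a M h hM u hu
    have hM0 : 0 ≤ M := (abs_nonneg _).trans (hM a le_rfl)
    rcases hu.eq_or_lt with rfl | hu'
    · rw [sum_range_succ']; simp
    set G : ℝ → ℝ := fun v => F 0 (a + v) - ∑ j ∈ range (n + 1), F j a * v ^ j / (j.factorial : ℝ) with hG
    set G' : ℝ → ℝ := fun v => F 1 (a + v) - ∑ j ∈ range n, F (j + 1) a * v ^ j / (j.factorial : ℝ) with hG'
    have hd : ∀ v, 0 ≤ v → HasDerivAt G (G' v) v := by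
      intro v hv
      have h1 := (h 0 (a + v) (by linarith)).comp_const_add a v
      refine h1.sub ?_
      have h2 : HasDerivAt (fun v : ℝ => ∑ j ∈ range (n + 1), F j a * v ^ j / (j.factorial : ℝ))
          (∑ j ∈ range (n + 1), F j a * (j * v ^ (j - 1)) / (j.factorial : ℝ)) v := by
        exact HasDerivAt.fun_sum (x := v) (u := range (n + 1)) (A := fun j v => F j a * v ^ j / (j.factorial : ℝ))
          (A' := fun j => F j a * (j * v ^ (j - 1)) / (j.factorial : ℝ))
          (fun j _ => ((hasDerivAt_pow j v).const_mul (F j a)).div_const _)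
      refine h2.congr_deriv ?_
      rw [sum_range_succ']
      simp only [Nat.cast_zero, zero_mul, mul_zero, zero_div, add_zero]
      refine sum_congr rfl fun j _ => ?_
      rw [Nat.factorial_succ]
      push_cast
      have : ((j : ℝ) + 1) ≠ 0 := by positivity
      have : (j.factorial : ℝ) ≠ 0 := by positivity
      field_simp
    obtain ⟨v, hv, hve⟩ := exists_hasDerivAt_eq_slope G G' hu' (fun t ht => (hd t ht.1).continuousAt.continuousWithinAt)
      (fun t ht => hd t ht.1.le)
    have h0 : G 0 = 0 := by simp only [hG]; rw [sum_range_succ']; simp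
    rw [h0, sub_zero, sub_zero, eq_div_iff hu'.ne'] at hve
    have h1 := ih (fun j => F (j + 1)) a M (fun j t ht => h (j + 1) t ht) hM v hv.1.le
    change |G u| ≤ _
    rw [← hve, abs_mul, abs_of_pos hu', pow_succ, ← mul_assoc]
    gcongr
    refine h1.trans ?_
    have := hv.1.le
    have := hv.2.le
    gcongr

lemma shift_avg (f : ℕ → ℂ) (hf : ∀ n, ‖f n‖ ≤ 1) (N U : ℕ) :
    U * ‖∑ n ∈ range N, f n‖ ≤ ∑ n ∈ range N, ‖∑ u ∈ range U, f (n + u)‖ + 2 * (U : ℝ) ^ 2 := by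
  have hb : ∀ (g : ℕ → ℂ) (hg : ∀ n, ‖g n‖ ≤ 1) (u : ℕ), ‖∑ n ∈ range u, g n‖ ≤ u := by
    intro g hg u
    refine (norm_sum_le _ _).trans ((sum_le_sum fun n _ => hg n).trans ?_)
    simp
  have h2 : ∀ u < U, ‖∑ n ∈ range N, f n - ∑ n ∈ range N, f (n + u)‖ ≤ 2 * U := by
    intro u hu
    have e1 := sum_range_add f N u
    have e2 := sum_range_add f u N
    rw [add_comm u N] at e2
    have e3 : ∑ n ∈ range N, f n - ∑ n ∈ range N, f (n + u) =
        ∑ n ∈ range u, f n - ∑ n ∈ range u, f (N + n) := by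
      have e4 : ∑ n ∈ range N, f (n + u) = ∑ n ∈ range N, f (u + n) :=
        sum_congr rfl fun n _ => by rw [add_comm]
      rw [e4]
      linear_combination e2 - e1
    rw [e3]
    refine (norm_sub_le _ _).trans ?_
    have := hb f hf u
    have := hb (fun n => f (N + n)) (fun n => hf _) u
    have : (u : ℝ) ≤ U := by exact_mod_cast hu.le
    linarith
  have h3 : (U : ℂ) * ∑ n ∈ range N, f n = ∑ n ∈ range N, ∑ u ∈ range U, f (n + u) +
      ∑ u ∈ range U, (∑ n ∈ range N, f n - ∑ n ∈ range N, f (n + u)) := by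
    rw [sum_comm, ← sum_add_distrib]
    simp
  have h4 : (U : ℝ) * ‖∑ n ∈ range N, f n‖ = ‖(U : ℂ) * ∑ n ∈ range N, f n‖ := by simp
  rw [h4, h3]
  refine (norm_add_le _ _).trans (add_le_add (norm_sum_le _ _) ?_)
  refine (norm_sum_le _ _).trans ((sum_le_sum fun u hu => h2 u (mem_range.1 hu)).trans (le_of_eq ?_))
  simp; ring

def tco (e : ℕ) (γ α β : ℝ) (h ι : ℕ) (m : ℕ) (j : ℕ) : ℝ :=
  α * ((e + 2).choose (j + 1)) * (m : ℝ) ^ (e + 2 - (j + 1)) + (if j = 0 then β else 0) +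
    h * (ffac γ (j + 1) * ((m : ℝ) + ι) ^ (γ - (j + 1 : ℕ)) / ((j + 1).factorial : ℝ))

lemma phs_taylor (e : ℕ) (γ : ℝ) (h1 : γ < 1) (α β : ℝ) (h ι m : ℕ) (hm : 1 ≤ m) (u : ℕ) :
    |phs (e + 2) γ α β h ι (m + u) - (phs (e + 2) γ α β h ι m + ∑ j : Fin (e + 2), tco e γ α β h ι m j * (u : ℝ) ^ (j.1 + 1))| ≤
      h * (|ffac γ (e + 3)| * (m : ℝ) ^ (γ - (e + 3 : ℕ)) * (u : ℝ) ^ (e + 3)) := by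
  have hm0 : (0 : ℝ) < m := by exact_mod_cast hm
  have hmi : (0 : ℝ) < (m : ℝ) + ι := by positivity
  have ht := taylor_fam (e + 3) (fun j t => ffac γ j * t ^ (γ - j)) ((m : ℝ) + ι) (|ffac γ (e + 3)| * (m : ℝ) ^ (γ - (e + 3 : ℕ)))
    (fun j t ht => rpow_family γ j t (hmi.trans_le ht)) (fun t ht => by
      have ht0 := hmi.trans_le ht
      rw [abs_mul, abs_of_nonneg (rpow_nonneg ht0.le _)]
      gcongr ?_ * ?_
      refine rpow_le_rpow_of_nonpos hm0 ?_ ?_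
      · have : (0 : ℝ) ≤ ι := by positivity
        linarith
      · push_cast; linarith [show (0 : ℝ) ≤ e by positivity]) u (by positivity)
  rw [sum_range_succ'] at ht
  have hbin : ((m : ℝ) + u) ^ (e + 2) = (m : ℝ) ^ (e + 2) + ∑ j ∈ range (e + 2), (u : ℝ) ^ (j + 1) * (m : ℝ) ^ (e + 2 - (j + 1)) * ((e + 2).choose (j + 1)) := by
    rw [add_comm (m : ℝ), add_pow, sum_range_succ']; simp [add_comm]
  have hs : ∑ j : Fin (e + 2), tco e γ α β h ι m j * (u : ℝ) ^ (j.1 + 1) =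
      α * (((m : ℝ) + u) ^ (e + 2) - (m : ℝ) ^ (e + 2)) + β * u +
      h * ∑ j ∈ range (e + 2), ffac γ (j + 1) * ((m : ℝ) + ι) ^ (γ - (j + 1 : ℕ)) * (u : ℝ) ^ (j + 1) / ((j + 1).factorial : ℝ) := by
    rw [hbin, add_sub_cancel_left]
    rw [Fin.sum_univ_eq_sum_range (fun j => tco e γ α β h ι m j * (u : ℝ) ^ (j + 1)) (e + 2)]
    unfold tco
    simp only [add_mul, sum_add_distrib, mul_sum]
    congr 1
    · congr 1
      · exact sum_congr rfl fun j _ => by ring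
      · simp [ite_mul]
    · exact sum_congr rfl fun j _ => by ring
  rw [hs]
  have hh : (0 : ℝ) ≤ h := by positivity
  refine le_trans (le_of_eq ?_) (mul_le_mul_of_nonneg_left ht hh)
  rw [← abs_of_nonneg hh, ← abs_mul, abs_of_nonneg hh]
  congr 1
  unfold phs
  push_cast
  rw [show (m : ℝ) + u + ι = m + ι + u by ring]
  simp [ffac]
  ring

lemma minor_B (x q P s d C1 Cl E ω κ : ℝ) (hx : 1 ≤ x) (hs : 0 ≤ s) (hd : 0 ≤ d) (hC1 : 0 ≤ C1) (hCl : 0 ≤ Cl) (hE : 2 ≤ E)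
    (hq1 : x ^ (0.43 : ℝ) ≤ q) (hq2 : q ≤ x ^ (E + 1 - 0.43 - 3 * κ)) (D : ℝ) (hP : x ^ ω ≤ D * P) (hP1 : 1 ≤ P) (hκ0 : 0 < κ) (hκ : κ ≤ 0.02)
    (hω : E - 3 * κ ≤ ω) (hℓ : 1 + log q ≤ Cl * x ^ (0.005 : ℝ)) (L : ℝ) (hL : L ≤ (s + 1) * P) :
    (2 * d * x / q + 1) * (2 * (L * (2 * q * (C1 * x ^ (3 * κ - E)) + 2) + 8 * q * (1 + log q))) ≤
      ((s + 1) * (8 * d * C1 + 8 * d + 4 * C1 + 4) + D * Cl * (32 * d + 16)) * (P * x ^ (0.575 : ℝ)) := by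
  have hx0 : 0 < x := by linarith
  have hq0 : 0 < q := (by positivity : (0:ℝ) < x ^ (0.43 : ℝ)).trans_le hq1
  set y := x ^ (0.575 : ℝ) with hy
  have hy0 : 0 < y := by positivity
  have t1 : x / q ≤ y := by
    rw [div_le_iff₀ hq0]
    calc x = x ^ (0.57 : ℝ) * x ^ (0.43 : ℝ) := by rw [← rpow_add hx0]; norm_num
      _ ≤ y * q := by
        gcongr
        exact rpow_le_rpow_of_exponent_le hx (by norm_num)
  have t2 : q * x ^ (3 * κ - E) ≤ y := by
    calc q * x ^ (3 * κ - E) ≤ x ^ (E + 1 - 0.43 - 3 * κ) * x ^ (3 * κ - E) := by gcongr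
      _ = x ^ (0.57 : ℝ) := by rw [← rpow_add hx0]; congr 1; ring_nf
      _ ≤ y := rpow_le_rpow_of_exponent_le hx (by norm_num)
  have t3 : x * x ^ (3 * κ - E) ≤ y := by
    calc x * x ^ (3 * κ - E) = x ^ (1 + (3 * κ - E)) := by rw [rpow_add hx0, rpow_one]
      _ ≤ y := rpow_le_rpow_of_exponent_le hx (by linarith)
  have t4 : 1 ≤ y := one_le_rpow hx (by norm_num)
  have t5 : x * (1 + log q) ≤ D * Cl * (P * y) := by
    calc x * (1 + log q) ≤ x * (Cl * x ^ (0.005 : ℝ)) := by gcongr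
      _ = Cl * x ^ (1.005 : ℝ) := by
        have : x ^ (1.005 : ℝ) = x * x ^ (0.005 : ℝ) := by
          rw [← rpow_one_add' hx0.le (by norm_num)]; norm_num
        rw [this]; ring
      _ ≤ Cl * (x ^ ω * y) := by
        gcongr
        rw [← rpow_add hx0]
        exact rpow_le_rpow_of_exponent_le hx (by linarith)
      _ ≤ Cl * ((D * P) * y) := by gcongr
      _ = _ := by ring
  have t6 : q * (1 + log q) ≤ D * Cl * (P * y) := by
    calc q * (1 + log q) ≤ q * (Cl * x ^ (0.005 : ℝ)) := by gcongr
      _ ≤ x ^ (E + 1 - 0.43 - 3 * κ) * (Cl * x ^ (0.005 : ℝ)) := by gcongr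
      _ = Cl * x ^ (E + 1 - 0.43 - 3 * κ + 0.005) := by rw [rpow_add hx0]; ring
      _ ≤ Cl * (x ^ ω * y) := by
        gcongr
        rw [← rpow_add hx0]
        exact rpow_le_rpow_of_exponent_le hx (by linarith)
      _ ≤ Cl * ((D * P) * y) := by gcongr
      _ = _ := by ring
  set z := x ^ (3 * κ - E) with hz
  have e : (2 * d * x / q + 1) * (2 * (L * (2 * q * (C1 * z) + 2) + 8 * q * (1 + log q))) =
    L * (8 * d * C1 * (x * z) + 8 * d * (x / q) + 4 * C1 * (q * z) + 4) + 32 * d * (x * (1 + log q)) + 16 * (q * (1 + log q)) := by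
    field_simp; ring
  rw [e]
  calc _ ≤ ((s + 1) * P) * (8 * d * C1 * y + 8 * d * y + 4 * C1 * y + 4 * y) + 32 * d * (D * Cl * (P * y)) + 16 * (D * Cl * (P * y)) := by
        gcongr; linarith
    _ = _ := by ring

lemma tco_diff (e : ℕ) (he : 2 ≤ e) (γ κ : ℝ) (hγ1 : γ < 1) (X n n' h ι q : ℕ) (a : ℤ) (α β : ℝ) (hX : 1 ≤ X)
    (hn : n ≤ X) (hn' : n' ≤ X) (hh : (h : ℝ) ≤ (X : ℝ) ^ (3 * κ)) (hq : (X : ℝ) ^ (0.43 : ℝ) ≤ q)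
    (hα : |α - a / q| ≤ 1 / ((X : ℝ) ^ ((e : ℝ) + 1 - 0.43 - 3 * κ) * q)) :
    |tco e γ α β h ι (X + n) e - tco e γ α β h ι (X + n') e - (a * ((e + 2 : ℕ) * ((n : ℤ) - n')) : ℤ) / q| ≤
      (2 * |ffac γ (e + 1)| + (e + 2)) * (X : ℝ) ^ (3 * κ - e) := by
  have hx : (1 : ℝ) ≤ X := by exact_mod_cast hX
  set x : ℝ := (X : ℝ) with hxd
  have hx0 : 0 < x := by linarith
  have hq0 : (0 : ℝ) < q := (by positivity : (0 : ℝ) < x ^ (0.43 : ℝ)).trans_le hq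
  set φ := ffac γ (e + 1)
  have hp : ∀ n : ℕ, |(h : ℝ) * (φ * (((X + n : ℕ) : ℝ) + ι) ^ (γ - (e + 1 : ℕ)) / ((e + 1).factorial : ℝ))| ≤ |φ| * x ^ (3 * κ - e) := by
    intro n
    have h0 : x ≤ ((X + n : ℕ) : ℝ) + ι := by push_cast; linarith [show (0 : ℝ) ≤ n by positivity, show (0 : ℝ) ≤ ι by positivity]
    have h1 : (((X + n : ℕ) : ℝ) + ι) ^ (γ - (e + 1 : ℕ)) ≤ x ^ (-(e : ℝ)) := by
      refine (rpow_le_rpow_of_nonpos hx0 h0 ?_).trans (rpow_le_rpow_of_exponent_le hx ?_)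
      all_goals push_cast; linarith [show (0 : ℝ) ≤ e by positivity]
    have hf : (1 : ℝ) ≤ ((e + 1).factorial : ℝ) := by exact_mod_cast Nat.succ_le_of_lt (Nat.factorial_pos _)
    rw [abs_mul, abs_div, abs_mul, Nat.abs_cast, Nat.abs_cast, abs_of_nonneg (rpow_nonneg (by linarith) _)]
    calc (h : ℝ) * (|φ| * (((X + n : ℕ) : ℝ) + ι) ^ (γ - (e + 1 : ℕ)) / ((e + 1).factorial : ℝ))
        ≤ x ^ (3 * κ) * (|φ| * x ^ (-(e : ℝ)) / 1) := by gcongr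
      _ = _ := by rw [sub_eq_add_neg, rpow_add hx0]; ring
  have hch : (((e + 2).choose (e + 1) : ℕ) : ℝ) = e + 2 := by
    rw [Nat.choose_succ_self_right]; push_cast; ring
  have hlin : |(α - a / q) * ((e + 2) * ((n : ℝ) - n'))| ≤ (e + 2) * x ^ (3 * κ - e) := by
    have h1 : |(n : ℝ) - n'| ≤ x := by
      rw [abs_le, hxd]; constructor
      · have : (n' : ℝ) ≤ X := by exact_mod_cast hn'
        linarith [show (0 : ℝ) ≤ n by positivity]
      · have : (n : ℝ) ≤ X := by exact_mod_cast hn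
        linarith [show (0 : ℝ) ≤ n' by positivity]
    rw [abs_mul, abs_mul, abs_of_nonneg (show (0 : ℝ) ≤ e + 2 by positivity)]
    calc _ ≤ 1 / (x ^ ((e : ℝ) + 1 - 0.43 - 3 * κ) * x ^ (0.43 : ℝ)) * ((e + 2) * x) := by
          refine mul_le_mul (hα.trans ?_) (by gcongr) (by positivity) (by positivity)
          gcongr
      _ = (e + 2) * (x / (x ^ ((e : ℝ) + 1 - 0.43 - 3 * κ) * x ^ (0.43 : ℝ))) := by ring
      _ = _ := by
        rw [← rpow_add hx0]
        nth_rw 1 [← rpow_one x]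
        rw [← rpow_sub hx0]
        congr 2; ring
  have e1 : tco e γ α β h ι (X + n) e - tco e γ α β h ι (X + n') e - (a * ((e + 2 : ℕ) * ((n : ℤ) - n')) : ℤ) / q =
      (α - a / q) * ((e + 2) * ((n : ℝ) - n')) +
      ((h : ℝ) * (φ * (((X + n : ℕ) : ℝ) + ι) ^ (γ - (e + 1 : ℕ)) / ((e + 1).factorial : ℝ)) -
      (h : ℝ) * (φ * (((X + n' : ℕ) : ℝ) + ι) ^ (γ - (e + 1 : ℕ)) / ((e + 1).factorial : ℝ))) := by
    unfold tco
    rw [if_neg (by omega), hch, show e + 2 - (e + 1) = 1 by omega]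
    push_cast
    ring
  rw [e1]
  refine (abs_add_le _ _).trans ?_
  have := abs_sub ((h : ℝ) * (φ * (((X + n : ℕ) : ℝ) + ι) ^ (γ - (e + 1 : ℕ)) / ((e + 1).factorial : ℝ))) ((h : ℝ) * (φ * (((X + n' : ℕ) : ℝ) + ι) ^ (γ - (e + 1 : ℕ)) / ((e + 1).factorial : ℝ)))
  have := hp n
  have := hp n'
  linarith

lemma vprod_bd (e U s : ℕ) (hU1 : (1 : ℝ) ≤ U) (j0 : Fin (e + 2)) (hj0 : j0.1 = e) :
    (∏ j ∈ univ.erase j0, (s * (U : ℝ) ^ (j.1 + 1) + 1)) * (U : ℝ) ^ (e + 1) ≤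
      ((s : ℝ) + 1) ^ (e + 2) * (U : ℝ) ^ ((((e + 2) * (e + 2 + 1) : ℕ) : ℝ) / 2) := by
  have h1 : ∀ j : ℕ, (s * (U : ℝ) ^ (j + 1) + 1) ≤ (s + 1) * (U : ℝ) ^ (j + 1) := fun j => by
    have := one_le_pow₀ hU1 (n := j + 1)
    linarith
  calc _ ≤ (∏ j ∈ univ.erase j0, ((s + 1) * (U : ℝ) ^ (j.1 + 1))) * ((s + 1) * (U : ℝ) ^ (j0.1 + 1)) := by
        have : (1 : ℝ) ≤ s + 1 := by linarith [show (0 : ℝ) ≤ s by positivity]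
        rw [hj0]
        gcongr with j hj
        · exact h1 j
        · exact le_mul_of_one_le_left (by positivity) this
    _ = ∏ j : Fin (e + 2), ((s + 1) * (U : ℝ) ^ (j.1 + 1)) := prod_erase_mul _ _ (mem_univ j0)
    _ = ((s : ℝ) + 1) ^ (e + 2) * ∏ j ∈ range (e + 2), (U : ℝ) ^ (j + 1) := by
        rw [prod_mul_distrib, Fin.prod_univ_eq_prod_range (fun j => (U : ℝ) ^ (j + 1)) (e + 2)]
        simp
    _ = _ := by
        rw [prod_pow_eq_pow_sum, ← rpow_natCast (U : ℝ)]
        congr 2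
        have := sum_range_succ' (fun i => i) (e + 2)
        simp only [add_zero] at this
        rw [← this]
        have h2 := sum_range_id_mul_two (e + 2 + 1)
        rw [eq_div_iff (by norm_num)]
        have h3 : e + 2 + 1 - 1 = e + 2 := by omega
        rw [h3] at h2
        exact_mod_cast (h2.trans (mul_comm _ _))

set_option maxHeartbeats 1000000 in
lemma minor_V (e : ℕ) (he : 2 ≤ e) (γ κ : ℝ) (hγ1 : γ < 1) (hκ0 : 0 < κ) (hκ : 2 * ((e : ℝ) + 2) * (e + 3) * κ ≤ 0.42) :
    ∃ C : ℝ, 0 < C ∧ ∀ (X N h ι q U : ℕ) (a : ℤ) (α β : ℝ), 1 ≤ X → N ≤ X → (h : ℝ) ≤ (X : ℝ) ^ (3 * κ) →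
      IsCoprime (q : ℤ) a → (X : ℝ) ^ (0.43 : ℝ) ≤ q → (q : ℝ) ≤ (X : ℝ) ^ ((e : ℝ) + 1 - 0.43 - 3 * κ) →
      |α - a / q| ≤ 1 / ((X : ℝ) ^ ((e : ℝ) + 1 - 0.43 - 3 * κ) * q) →
      (U : ℝ) ≤ X → (X : ℝ) ^ (((e : ℝ) + 2 - 4 * κ) / (e + 3)) ≤ 2 * U →
      ∑ n ∈ range N, ‖∑ u ∈ range U, eC (∑ j : Fin (e + 2), tco e γ α β h ι (X + n) j * (u : ℝ) ^ (j.1 + 1))‖ ≤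
        C * (U * (X : ℝ) ^ (1 - κ)) := by
  obtain ⟨A, hA, hJ⟩ := vmvt (e + 2) (by omega) 0.005 (by norm_num) (by norm_num)
  set s : ℕ := (e + 2) * (e + 2 + 1) with hs
  set C1 : ℝ := 2 * |ffac γ (e + 1)| + (e + 2) with hC1
  have hC10 : 0 ≤ C1 := by positivity
  set Cl : ℝ := 1 + (e + 1) / 0.005 with hCl
  have hCl0 : 0 ≤ Cl := by positivity
  set CB : ℝ := (((s : ℝ) + 1) * (8 * ((e + 2 : ℕ) : ℝ) * C1 + 8 * ((e + 2 : ℕ) : ℝ) + 4 * C1 + 4) + 2 ^ (e + 1) * Cl * (32 * ((e + 2 : ℕ) : ℝ) + 16)) with hCB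
  have hCB0 : 0 ≤ CB := by positivity
  set C2 : ℝ := CB * (s + 1) ^ (e + 2) * A with hC2
  have hC20 : 0 ≤ C2 := by positivity
  refine ⟨C2 + 1, by positivity, ?_⟩
  clear_value s C1 Cl CB C2
  intro X N h ι q U a α β hX hN hh hco hq1 hq2 hα hU hU2
  have hx : (1 : ℝ) ≤ X := by exact_mod_cast hX
  set x : ℝ := (X : ℝ) with hxd
  have hx0 : 0 < x := by linarith
  have he' : (2 : ℝ) ≤ e := by exact_mod_cast he
  have hκ' : κ ≤ 0.02 := by
    have h20 : (20 : ℝ) ≤ (e + 2) * (e + 3) := by nlinarith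
    nlinarith
  have hq0 : (0 : ℝ) < q := (by positivity : (0 : ℝ) < x ^ (0.43 : ℝ)).trans_le hq1
  have hqn : 1 ≤ q := by exact_mod_cast hq0
  have hU0 : (0 : ℝ) < U := by
    have : 0 < x ^ (((e : ℝ) + 2 - 4 * κ) / (e + 3)) := by positivity
    linarith
  have hU1 : (1 : ℝ) ≤ U := by exact_mod_cast hU0
  set j0 : Fin (e + 2) := ⟨e, by omega⟩ with hj0
  have hsp := spacing q hqn a hco (e + 2) X N (by omega) hN (fun n => tco e γ α β h ι (X + n) e) (C1 * x ^ (3 * κ - e)) (by positivity)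
    (s * U ^ (e + 1) + 1) (fun n hn n' hn' => by rw [hC1]; exact tco_diff e he γ κ hγ1 X n n' h ι q a α β hX (by omega) (by omega) hh hq1 hα)
  have hlog : 1 + log q ≤ Cl * x ^ (0.005 : ℝ) := by
    have h1 : log q ≤ (e + 1) * log x := by
      rw [← log_rpow hx0]
      refine log_le_log hq0 (hq2.trans (rpow_le_rpow_of_exponent_le hx (by linarith)))
    have h2 := log_le_rpow_div hx0.le (show (0 : ℝ) < 0.005 by norm_num)
    have h3 : 1 ≤ x ^ (0.005 : ℝ) := one_le_rpow hx (by norm_num)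
    have h4 : ((e : ℝ) + 1) * log x ≤ (e + 1) * (x ^ (0.005 : ℝ) / 0.005) := by gcongr
    rw [hCl]
    have : (1 + ((e : ℝ) + 1) / 0.005) * x ^ (0.005 : ℝ) = x ^ (0.005 : ℝ) + (e + 1) * (x ^ (0.005 : ℝ) / 0.005) := by ring
    linarith
  have hmB := minor_B x q ((U : ℝ) ^ (e + 1)) s ((e + 2 : ℕ) : ℝ) C1 Cl e (((e : ℝ) + 2 - 4 * κ) / (e + 3) * (e + 1)) κ hx (by positivity) (by positivity) hC10 hCl0 he'
    hq1 hq2 (2 ^ (e + 1)) (by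
      rw [← mul_pow, rpow_mul hx0.le, ← Nat.cast_one (R := ℝ), ← Nat.cast_add, rpow_natCast]
      gcongr) (one_le_pow₀ hU1) hκ0 hκ' (by
      rw [div_mul_eq_mul_div, le_div_iff₀ (by positivity)]
      nlinarith) hlog ((s * U ^ (e + 1) + 1 : ℕ) : ℝ) (by
      have := one_le_pow₀ hU1 (n := e + 1)
      push_cast; linarith)
  rw [← hCB] at hmB
  have hV := vino_ls (e + 2) s U (range N) (fun n j => tco e γ α β h ι (X + n) j) j0
    (CB * ((U : ℝ) ^ (e + 1) * x ^ (0.575 : ℝ))) (by positivity) (fun n hn => (hsp n hn).trans hmB)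
  set g : ℕ → ℂ := fun n => ∑ u ∈ range U, eC (∑ j : Fin (e + 2), tco e γ α β h ι (X + n) j * (u : ℝ) ^ (j.1 + 1)) with hg
  have hprod := vprod_bd e U s hU1 j0 rfl
  rw [show (((e + 2) * (e + 2 + 1) : ℕ) : ℝ) = s by rw [hs]] at hprod
  have hV2 : ∑ n ∈ range N, ‖g n‖ ^ (2 * s) ≤ C2 * ((U : ℝ) ^ (2 * s) * x ^ (0.58 : ℝ)) := by
    refine hV.trans ?_
    have hUe : (U : ℝ) ^ (3 / 2 * ((e + 2 : ℕ) : ℝ) * (((e + 2 : ℕ) : ℝ) + 1) + 0.005) ≤ (U : ℝ) ^ (3 / 2 * (s : ℝ)) * x ^ (0.005 : ℝ) := by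
      rw [rpow_add hU0]
      have : (3 / 2 * (s : ℝ)) = 3 / 2 * ((e + 2 : ℕ) : ℝ) * (((e + 2 : ℕ) : ℝ) + 1) := by rw [hs]; push_cast; ring
      rw [this]
      gcongr
    calc _ = CB * x ^ (0.575 : ℝ) * ((∏ j ∈ univ.erase j0, (s * (U : ℝ) ^ (j.1 + 1) + 1)) * (U : ℝ) ^ (e + 1)) * vJ (e + 2) s (Ico 0 (U : ℤ)) := by ring
      _ ≤ CB * x ^ (0.575 : ℝ) * (((s : ℝ) + 1) ^ (e + 2) * (U : ℝ) ^ ((s : ℝ) / 2)) * (A * ((U : ℝ) ^ (3 / 2 * (s : ℝ)) * x ^ (0.005 : ℝ))) := by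
        have := hJ U
        gcongr
        exact this.trans (by gcongr)
      _ = C2 * (((U : ℝ) ^ ((s : ℝ) / 2) * (U : ℝ) ^ (3 / 2 * (s : ℝ))) * (x ^ (0.575 : ℝ) * x ^ (0.005 : ℝ))) := by rw [hC2]; ring
      _ = _ := by
        rw [← rpow_add hU0, ← rpow_add hx0, ← rpow_natCast (U : ℝ)]
        congr 3
        · push_cast; ring
        · norm_num
  have hs1 : 1 ≤ 2 * s := by rw [hs]; nlinarith
  obtain ⟨t, ht⟩ : ∃ t, 2 * s = t + 1 := ⟨2 * s - 1, by omega⟩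
  have hH := pow_sum_le_card_mul_sum_pow (s := range N) (f := fun n => ‖g n‖) (fun _ _ => norm_nonneg _) t
  rw [card_range, ← ht] at hH
  refine le_of_pow_le_pow_left₀ (n := 2 * s) (by omega) (by positivity) (hH.trans ?_)
  have hNx : (N : ℝ) ≤ x := by rw [hxd]; exact_mod_cast hN
  calc (N : ℝ) ^ t * ∑ n ∈ range N, ‖g n‖ ^ (2 * s) ≤ x ^ t * (C2 * ((U : ℝ) ^ (2 * s) * x ^ (0.58 : ℝ))) := by gcongr
    _ = C2 * (U : ℝ) ^ (2 * s) * x ^ ((t : ℝ) + 0.58) := by rw [rpow_add hx0, rpow_natCast]; ring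
    _ ≤ (C2 + 1) ^ (2 * s) * (U : ℝ) ^ (2 * s) * x ^ ((1 - κ) * (2 * s : ℕ)) := by
      gcongr
      · calc C2 ≤ C2 + 1 := by linarith
          _ ≤ _ := le_self_pow₀ (by linarith) (by omega)
      · have h1 : ((2 * s : ℕ) : ℝ) = t + 1 := by exact_mod_cast ht
        have h2 : ((2 * s : ℕ) : ℝ) * κ ≤ 0.42 := by
          refine le_trans (le_of_eq ?_) hκ
          rw [hs]; push_cast; ring
        rw [one_sub_mul]
        linarith
    _ = _ := by rw [rpow_mul hx0.le, rpow_natCast, ← mul_pow, ← mul_pow]; ring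

lemma minor (e : ℕ) (he : 2 ≤ e) (γ κ : ℝ) (hγ1 : γ < 1) (hκ0 : 0 < κ) (hκ : 2 * ((e : ℝ) + 2) * (e + 3) * κ ≤ 0.42) :
    ∃ C : ℝ, 0 < C ∧ ∀ (X N h ι q : ℕ) (a : ℤ) (α β : ℝ), 1 ≤ X → N ≤ X → (h : ℝ) ≤ (X : ℝ) ^ (3 * κ) →
      IsCoprime (q : ℤ) a → (X : ℝ) ^ (0.43 : ℝ) ≤ q → (q : ℝ) ≤ (X : ℝ) ^ ((e : ℝ) + 1 - 0.43 - 3 * κ) →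
      |α - a / q| ≤ 1 / ((X : ℝ) ^ ((e : ℝ) + 1 - 0.43 - 3 * κ) * q) →
      ‖∑ n ∈ range N, eC (phs (e + 2) γ α β h ι (X + n))‖ ≤ C * (X : ℝ) ^ (1 - κ) := by
  obtain ⟨C, hC, hV⟩ := minor_V e he γ κ hγ1 hκ0 hκ
  set φ := |ffac γ (e + 3)| with hφ
  have hφ0 : 0 ≤ φ := abs_nonneg _
  refine ⟨C + 2 * π * φ + 2, by positivity, ?_⟩
  intro X N h ι q a α β hX hN hh hco hq1 hq2 hα
  have hx : (1 : ℝ) ≤ X := by exact_mod_cast hX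
  set x : ℝ := (X : ℝ) with hxd
  have hx0 : 0 < x := by linarith
  have he' : (2 : ℝ) ≤ e := by exact_mod_cast he
  have hκe : κ * (e + 3) ≤ 0.42 := by nlinarith [mul_pos hκ0 (show (0:ℝ) < e + 3 by positivity)]
  set ω : ℝ := ((e : ℝ) + 2 - 4 * κ) / (e + 3) with hω
  have hω0 : 0 ≤ ω := by rw [hω]; apply div_nonneg <;> nlinarith
  have hω1 : ω ≤ 1 - κ := by rw [hω, div_le_iff₀ (by positivity)]; nlinarith
  have hxω : 1 ≤ x ^ ω := one_le_rpow hx hω0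
  set U := ⌊x ^ ω⌋₊ with hU
  have hU1 : (U : ℝ) ≤ x ^ ω := Nat.floor_le (by positivity)
  have hU2 : x ^ ω ≤ 2 * U := by
    have h1 := Nat.lt_floor_add_one (x ^ ω)
    have h2 : (1 : ℝ) ≤ U := by exact_mod_cast (Nat.one_le_floor_iff _).2 hxω
    rw [← hU] at h1
    linarith
  have hU0 : (0 : ℝ) < U := by linarith
  have hUx : (U : ℝ) ≤ x := hU1.trans (by
    conv_rhs => rw [← rpow_one x]
    exact rpow_le_rpow_of_exponent_le hx (by linarith))
  have hV' := hV X N h ι q U a α β hX hN hh hco hq1 hq2 hα hUx hU2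
  have hsh := shift_avg (fun n => eC (phs (e + 2) γ α β h ι (X + n))) (fun n => (eC_norm _).le) N U
  have hR : ∀ n, ∀ u < U, h * (φ * ((X + n : ℕ) : ℝ) ^ (γ - (e + 3 : ℕ)) * (u : ℝ) ^ (e + 3)) ≤ φ * x ^ (-κ) := by
    intro n u hu
    have h1 : ((X + n : ℕ) : ℝ) ^ (γ - (e + 3 : ℕ)) ≤ x ^ (-((e : ℝ) + 2)) := by
      refine (rpow_le_rpow_of_nonpos hx0 (by push_cast; linarith [show (0 : ℝ) ≤ n by positivity]) ?_).trans
        (rpow_le_rpow_of_exponent_le hx ?_)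
      all_goals push_cast; linarith
    have h2 : (u : ℝ) ^ (e + 3) ≤ x ^ ((e : ℝ) + 2 - 4 * κ) := by
      have : (e : ℝ) + 2 - 4 * κ = ω * (e + 3 : ℕ) := by rw [hω]; push_cast; field_simp
      rw [this, rpow_mul hx0.le, rpow_natCast]
      have : (u : ℝ) ≤ U := by exact_mod_cast hu.le
      gcongr
      linarith
    calc _ ≤ x ^ (3 * κ) * (φ * x ^ (-((e : ℝ) + 2)) * x ^ ((e : ℝ) + 2 - 4 * κ)) := by gcongr
      _ = φ * (x ^ (3 * κ) * x ^ (-((e : ℝ) + 2)) * x ^ ((e : ℝ) + 2 - 4 * κ)) := by ring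
      _ = _ := by
        rw [← rpow_add hx0, ← rpow_add hx0]; congr 2; ring
  set g : ℕ → ℂ := fun n => ∑ u ∈ range U, eC (∑ j : Fin (e + 2), tco e γ α β h ι (X + n) j * (u : ℝ) ^ (j.1 + 1)) with hg
  have hin : ∀ n, ‖∑ u ∈ range U, eC (phs (e + 2) γ α β h ι (X + (n + u)))‖ ≤ ‖g n‖ + U * (2 * π * (φ * x ^ (-κ))) := by
    intro n
    have h1 : ∑ u ∈ range U, eC (phs (e + 2) γ α β h ι (X + (n + u))) = eC (phs (e + 2) γ α β h ι (X + n)) * g n +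
        ∑ u ∈ range U, (eC (phs (e + 2) γ α β h ι (X + (n + u))) - eC (phs (e + 2) γ α β h ι (X + n) +
          ∑ j : Fin (e + 2), tco e γ α β h ι (X + n) j * (u : ℝ) ^ (j.1 + 1))) := by
      simp only [hg, sum_sub_distrib, mul_sum, ← eC_add]
      ring
    rw [h1]
    refine (norm_add_le _ _).trans (add_le_add (by rw [norm_mul, eC_norm, one_mul]) ?_)
    refine (norm_sum_le _ _).trans ((sum_le_sum (g := fun _ => 2 * π * (φ * x ^ (-κ))) fun u hu => ?_).trans (by simp))
    have h2 := phs_taylor e γ hγ1 α β h ι (X + n) (by omega) u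
    have h3 := h2.trans (hR n u (mem_range.1 hu))
    rw [add_assoc] at h3
    set A1 := phs (e + 2) γ α β h ι (X + (n + u))
    set A2 := phs (e + 2) γ α β h ι (X + n) + ∑ j : Fin (e + 2), tco e γ α β h ι (X + n) j * (u : ℝ) ^ (j.1 + 1)
    have h4 : eC A1 - eC A2 = eC A2 * (eC (A1 - A2) - 1) := by
      rw [mul_sub, ← eC_add, mul_one]; congr 2; ring
    rw [h4, norm_mul, eC_norm, one_mul]
    refine (norm_eC_sub_one _).trans ?_
    gcongr
  have hNx : (N : ℝ) ≤ x := by rw [hxd]; exact_mod_cast hN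
  have hsum : ∑ n ∈ range N, ‖∑ u ∈ range U, eC (phs (e + 2) γ α β h ι (X + (n + u)))‖ ≤
      C * (U * x ^ (1 - κ)) + U * (2 * π * φ * x ^ (1 - κ)) := by
    refine (sum_le_sum fun n _ => hin n).trans ?_
    rw [sum_add_distrib]
    refine add_le_add hV' ?_
    rw [sum_const, card_range, nsmul_eq_mul]
    calc (N : ℝ) * (U * (2 * π * (φ * x ^ (-κ)))) ≤ x * (U * (2 * π * (φ * x ^ (-κ)))) := by gcongr
      _ = _ := by rw [sub_eq_add_neg, rpow_add hx0, rpow_one]; ring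
  have hU3 : (U : ℝ) ≤ x ^ (1 - κ) := hU1.trans (rpow_le_rpow_of_exponent_le hx hω1)
  refine le_of_mul_le_mul_left (hsh.trans ?_) hU0
  have : 2 * (U : ℝ) ^ 2 ≤ 2 * (U * x ^ (1 - κ)) := by rw [sq]; gcongr
  nlinarith

lemma sd_mvt (f f' f'' : ℝ → ℝ) (b : ℝ) (h1 : ∀ t, b ≤ t → HasDerivAt f (f' t) t) (h2 : ∀ t, b ≤ t → HasDerivAt f' (f'' t) t) :
    ∃ ξ, b ≤ ξ ∧ ξ ≤ b + 2 ∧ f (b + 2) - 2 * f (b + 1) + f b = f'' ξ := by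
  have hd : ∀ t, b ≤ t → HasDerivAt (fun t => f (t + 1) - f t) (f' (t + 1) - f' t) t := fun t ht =>
    ((h1 (t + 1) (by linarith)).comp_add_const t 1).sub (h1 t ht)
  obtain ⟨c, hc, hce⟩ := exists_hasDerivAt_eq_slope (fun t => f (t + 1) - f t) (fun t => f' (t + 1) - f' t) (show b < b + 1 by linarith)
      (fun t ht => (hd t ht.1).continuousAt.continuousWithinAt) (fun t ht => hd t ht.1.le)
  obtain ⟨ξ, hξ, hξe⟩ := exists_hasDerivAt_eq_slope f' f'' (show c < c + 1 by linarith)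
      (fun t ht => (h2 t (hc.1.le.trans ht.1)).continuousAt.continuousWithinAt) (fun t ht => h2 t (hc.1.le.trans ht.1.le))
  refine ⟨ξ, by linarith [hc.1, hξ.1], by linarith [hc.2, hξ.2], ?_⟩
  rw [hξe]
  simp only [add_sub_cancel_left, div_one] at hce ⊢
  rw [hce, show b + 1 + 1 = b + 2 by ring]; ring

lemma res_split (g : ℕ → ℂ) (N q : ℕ) (hq : 1 ≤ q) (K : ℝ)
    (hK : ∀ r < q, ∀ M, (∀ i < M, r + q * i < N) → M ≤ N / q + 1 → ‖∑ i ∈ range M, g (r + q * i)‖ ≤ K) :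
    ‖∑ n ∈ range N, g n‖ ≤ q * K := by
  have h1 : ∀ n ∈ range N, n % q ∈ range q := fun n _ => mem_range.2 (Nat.mod_lt _ hq)
  rw [← sum_fiberwise_of_maps_to h1]
  refine (norm_sum_le _ _).trans ((sum_le_sum (g := fun _ => K) fun r hr => ?_).trans (by simp))
  rw [mem_range] at hr
  have hM : ∀ i, i < (N + q - 1 - r) / q ↔ r + q * i < N := by
    intro i
    rw [← Nat.succ_le_iff, Nat.le_div_iff_mul_le hq, Nat.succ_mul, mul_comm i q]
    omega
  have h2 : ∑ n ∈ range N with n % q = r, g n = ∑ i ∈ range ((N + q - 1 - r) / q), g (r + q * i) := by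
    symm
    refine sum_nbij' (fun i => r + q * i) (fun n => n / q) ?_ ?_ ?_ ?_ ?_
    · intro i hi
      rw [mem_range, hM] at hi
      simp [hi, Nat.mod_eq_of_lt hr]
    · intro n hn
      rw [mem_filter, mem_range] at hn
      rw [mem_range, hM, ← hn.2, Nat.mod_add_div]; exact hn.1
    · intro i _
      rw [Nat.add_mul_div_left _ _ hq, Nat.div_eq_of_lt hr, zero_add]
    · intro n hn
      rw [mem_filter] at hn
      rw [← hn.2, Nat.mod_add_div]
    · intro i _; rfl
  rw [h2]
  refine hK r hr _ (fun i hi => (hM i).1 hi) ?_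
  rw [← Nat.add_div_right _ hq]
  exact Nat.div_le_div_right (by omega)

def gdd (e : ℕ) (γ β' : ℝ) (h ι : ℕ) (t : ℝ) : ℝ :=
  β' * ((e + 2) * (e + 1)) * t ^ e + h * (γ * (γ - 1)) * (t + ι) ^ (γ - 2)

lemma major_int (e q Y N h ι : ℕ) (a : ℤ) (β' β γ σ l L : ℝ) (hq : 1 ≤ q) (hY : 1 ≤ Y) (hσ : σ = 1 ∨ σ = -1) (hl : 0 < l) (hlL : l ≤ L)
    (hlo : ∀ t : ℝ, Y ≤ t → t + 1 ≤ Y + N → l ≤ σ * gdd e γ β' h ι t) (hhi : ∀ t : ℝ, Y ≤ t → t + 1 ≤ Y + N → σ * gdd e γ β' h ι t ≤ L) :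
    ‖∑ n ∈ range N, eC (phs (e + 2) γ (a / q + β') β h ι (Y + n))‖ ≤
      q * ((q ^ 2 * L * (N / q + 1) + 2) * (4 / sqrt (q ^ 2 * l) + 4) + 1) := by
  have hq0 : (0 : ℝ) < q := by exact_mod_cast hq
  refine res_split _ N q hq _ fun r hr M hM hM1 => ?_
  set F : ℝ → ℝ := fun t => σ * (β' * t ^ (e + 2) + β * t + h * (t + ι) ^ γ) with hF
  set F' : ℝ → ℝ := fun t => σ * (β' * ((e + 2) * t ^ (e + 1)) + β + h * (γ * (t + ι) ^ (γ - 1))) with hF'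
  have hd1 : ∀ t : ℝ, 0 < t → HasDerivAt F (F' t) t := by
    intro t ht
    have h0 : 0 < t + ι := by positivity
    have h1 := ((hasDerivAt_rpow_const (x := t + ι) (p := γ) (Or.inl h0.ne')).comp_add_const t (ι : ℝ)).const_mul (h : ℝ)
    have h2 := (hasDerivAt_pow (e + 2) t).const_mul β'
    have h3 := (hasDerivAt_id t).const_mul β
    refine (((h2.add h3).add h1).const_mul σ).congr_deriv ?_
    simp only [hF']; push_cast; simp
  have hd2 : ∀ t : ℝ, 0 < t → HasDerivAt F' (σ * gdd e γ β' h ι t) t := by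
    intro t ht
    have h0 : 0 < t + ι := by positivity
    have h1 := (((hasDerivAt_rpow_const (x := t + ι) (p := γ - 1) (Or.inl h0.ne')).comp_add_const t (ι : ℝ)).const_mul γ).const_mul (h : ℝ)
    have h2 := ((hasDerivAt_pow (e + 1) t).const_mul ((e : ℝ) + 2)).const_mul β'
    refine (((h2.add_const β).add h1).const_mul σ).congr_deriv ?_
    simp only [gdd]; push_cast; rw [show γ - 1 - 1 = γ - 2 by ring]; ring
  set f : ℕ → ℝ := fun i => F ((Y : ℝ) + r + q * i) with hf
  have hmid : ∀ n, n + 2 ≤ M - 1 → ∃ t : ℝ, Y ≤ t ∧ t + 1 ≤ Y + N ∧ f (n + 2) - 2 * f (n + 1) + f n = q ^ 2 * (σ * gdd e γ β' h ι t) := by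
    intro n hn
    have hpos : ∀ t : ℝ, (n : ℝ) ≤ t → (Y : ℝ) ≤ (Y : ℝ) + r + q * t := fun t ht => by
      have : 0 ≤ (q : ℝ) * t := mul_nonneg hq0.le (le_trans (by positivity) ht)
      linarith [show (0 : ℝ) ≤ r by positivity]
    have hY0 : (0 : ℝ) < Y := by exact_mod_cast hY
    have hlin : ∀ t : ℝ, HasDerivAt (fun t : ℝ => (Y : ℝ) + r + q * t) q t := fun t => by
      simpa using ((hasDerivAt_id t).const_mul (q : ℝ)).const_add ((Y : ℝ) + r)
    obtain ⟨ξ, h1, h2, h3⟩ := sd_mvt (fun t => F ((Y : ℝ) + r + q * t)) (fun t => F' ((Y : ℝ) + r + q * t) * q)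
      (fun t => σ * gdd e γ β' h ι ((Y : ℝ) + r + q * t) * q * q) n
      (fun t ht => HasDerivAt.comp (h₂ := F) t (hd1 _ (hY0.trans_le (hpos t ht))) (hlin t))
      (fun t ht => (HasDerivAt.comp (h₂ := F') t (hd2 _ (hY0.trans_le (hpos t ht))) (hlin t)).mul_const (q : ℝ))
    refine ⟨_, hpos ξ h1, ?_, ?_⟩
    · have h4 := hM (n + 2) (by omega)
      have h5 : (r : ℝ) + q * (n + 2) + 1 ≤ N := by exact_mod_cast h4
      have : (q : ℝ) * ξ ≤ q * (n + 2) := by gcongr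
      linarith
    · simp only [hf]; push_cast; rw [h3]; ring
  have hsd := sd_test f (q ^ 2 * l) (q ^ 2 * L) (by positivity) (M - 1) (fun n hn => by
      obtain ⟨t, h1, h2, h3⟩ := hmid n hn
      rw [h3]; have := hlo t h1 h2; gcongr) (fun n hn => by
      obtain ⟨t, h1, h2, h3⟩ := hmid n hn
      rw [h3]; have := hhi t h1 h2; gcongr) (by gcongr)
  have hMq : (((M - 1 : ℕ)) : ℝ) ≤ N / q + 1 := by
    have h1 : (((M - 1 : ℕ)) : ℝ) ≤ ((N / q : ℕ) : ℝ) := by exact_mod_cast Nat.sub_le_iff_le_add.2 hM1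
    have h2 := @Nat.cast_div_le ℝ _ _ _ N q
    linarith
  have hL : 0 < L := hl.trans_le hlL
  have hterm : ∀ i : ℕ, eC (phs (e + 2) γ (a / q + β') β h ι (Y + (r + q * i))) = eC (a * (Y + r : ℝ) ^ (e + 2) / q) * eC (σ * f i) := by
    intro i
    have hpw : ∃ z : ℤ, ((Y : ℝ) + r + q * i) ^ (e + 2) = (Y + r : ℝ) ^ (e + 2) + q * z := by
      obtain ⟨z, hz⟩ := sub_dvd_pow_sub_pow ((Y : ℤ) + r + q * i) (Y + r) (e + 2)
      refine ⟨i * z, ?_⟩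
      have hz' : (((Y : ℤ) + r + q * i) ^ (e + 2) : ℤ) = (Y + r) ^ (e + 2) + q * (i * z) := by linear_combination hz
      exact_mod_cast hz'
    obtain ⟨z, hz⟩ := hpw
    have hσ2 : σ * f i = β' * ((Y : ℝ) + r + q * i) ^ (e + 2) + β * ((Y : ℝ) + r + q * i) + h * ((Y : ℝ) + r + q * i + ι) ^ γ := by
      simp only [hf, hF]; rcases hσ with rfl | rfl <;> ring
    rw [← eC_add, hσ2]
    have : phs (e + 2) γ (a / q + β') β h ι (Y + (r + q * i)) = a * (Y + r : ℝ) ^ (e + 2) / q +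
        (β' * ((Y : ℝ) + r + q * i) ^ (e + 2) + β * ((Y : ℝ) + r + q * i) + h * ((Y : ℝ) + r + q * i + ι) ^ γ) + ((a * z : ℤ) : ℝ) := by
      unfold phs
      push_cast
      rw [← add_assoc, add_mul, hz]
      field_simp
      ring
    rw [this, eC_add _ ((a * z : ℤ) : ℝ), eC_int, mul_one]
  simp only [hterm]
  rw [← mul_sum, norm_mul, eC_norm, one_mul]
  have hcj : ‖∑ i ∈ range M, eC (σ * f i)‖ = ‖∑ i ∈ range M, eC (f i)‖ := by
    rcases hσ with h | h
    · simp [h]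
    · rw [h, ← sd_conj]; simp
  rw [hcj]
  have hsp : ‖∑ i ∈ range M, eC (f i)‖ ≤ ‖∑ i ∈ range (M - 1), eC (f i)‖ + 1 := by
    rcases Nat.eq_zero_or_pos M with rfl | hM0
    · simp
    · obtain ⟨m, rfl⟩ : ∃ m, M = m + 1 := ⟨M - 1, by omega⟩
      rw [sum_range_succ, Nat.add_sub_cancel]
      exact (norm_add_le _ _).trans (by rw [eC_norm])
  refine hsp.trans ?_
  gcongr
  refine hsd.trans ?_
  gcongr

lemma major_piece (e : ℕ) (γ κ : ℝ) (hγ0 : 0 < γ) (hγ1 : γ < 1) (hγ : 1 - γ ≤ 0.01) (hκ0 : 0 < κ) (hκ : κ ≤ 0.0105) : ∃ C > 0,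
    ∀ (X Y N h ι q : ℕ) (a : ℤ) (β' β σ : ℝ), 1 ≤ X → X ≤ Y → Y + N ≤ 2 * X → (h : ℝ) ≤ (X : ℝ) ^ (3 * κ) → ι ≤ 1 →
    1 ≤ q → (q : ℝ) ≤ (X : ℝ) ^ (0.43 : ℝ) → |β'| ≤ 1 / ((X : ℝ) ^ ((e : ℝ) + 1 - 0.43 - 3 * κ) * q) → (σ = 1 ∨ σ = -1) →
    (∀ t : ℝ, Y ≤ t → t + 1 ≤ Y + N → γ * (1 - γ) / 9 * (X : ℝ) ^ (γ - 2 - κ) ≤ σ * gdd e γ β' h ι t) →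
    ‖∑ n ∈ range N, eC (phs (e + 2) γ (a / q + β') β h ι (Y + n))‖ ≤ C * (X : ℝ) ^ (1 - κ) := by
  set K : ℝ := ((e : ℝ) + 2) * (e + 1) * 2 ^ e with hK
  have hK0 : 0 < K := by positivity
  have hc0 : 0 < γ * (1 - γ) / 9 := by have : 0 < 1 - γ := by linarith
                                       positivity
  set c1 := γ * (1 - γ) / 9 with hc1
  refine ⟨(2 * K + 4) * (4 / sqrt c1 + 4) + 1, by positivity, ?_⟩
  intro X Y N h ι q a β' β σ hX hXY hYN hh hι hq hqX hβ hσ hlo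
  set x : ℝ := (X : ℝ) with hxd
  have hx1 : 1 ≤ x := by rw [hxd]; exact_mod_cast hX
  have hx0 : 0 < x := by linarith
  have hq0 : (0 : ℝ) < q := by exact_mod_cast hq
  have hYx : x ≤ Y := by rw [hxd]; exact_mod_cast hXY
  have hYN' : (Y : ℝ) + N ≤ 2 * x := by rw [hxd]; exact_mod_cast hYN
  have hι' : (ι : ℝ) ≤ 1 := by exact_mod_cast hι
  have hqx : (q : ℝ) ≤ x := hqX.trans (by simpa using rpow_le_rpow_of_exponent_le hx1 (show (0.43 : ℝ) ≤ 1 by norm_num))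
  set L : ℝ := (K + 1) * x ^ (3 * κ - 0.57) / q with hL
  have hbase : x ^ (3 * κ - 1) ≤ x ^ (3 * κ - 0.57) / q := by
    rw [le_div_iff₀ hq0]
    calc x ^ (3 * κ - 1) * q ≤ x ^ (3 * κ - 1) * x ^ (0.43 : ℝ) := by gcongr
      _ = _ := by rw [← rpow_add hx0]; congr 1; ring
  have hlL : c1 * x ^ (γ - 2 - κ) ≤ L := by
    have h1 : c1 ≤ 1 := by rw [hc1]; linarith [mul_le_one₀ hγ1.le (sub_nonneg.2 hγ1.le) (by linarith)]
    have h2 : x ^ (γ - 2 - κ) ≤ x ^ (3 * κ - 1) := rpow_le_rpow_of_exponent_le hx1 (by linarith)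
    calc c1 * x ^ (γ - 2 - κ) ≤ 1 * (x ^ (3 * κ - 0.57) / q) := by gcongr; exact h2.trans hbase
      _ ≤ (K + 1) * (x ^ (3 * κ - 0.57) / q) := by gcongr; linarith
      _ = L := by rw [hL]; ring
  have hhi : ∀ t : ℝ, Y ≤ t → t + 1 ≤ Y + N → σ * gdd e γ β' h ι t ≤ L := by
    intro t h1 h2
    have ht0 : 0 < t := by linarith
    have hti : 0 < t + ι := by positivity
    have hσ1 : |σ| = 1 := by rcases hσ with h | h <;> simp [h]
    have hb1 : |β' * ((e + 2) * (e + 1)) * t ^ e| ≤ K * x ^ (3 * κ - 0.57) / q := by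
      rw [abs_mul, abs_mul, abs_of_nonneg (by positivity : (0 : ℝ) ≤ (e + 2) * (e + 1)), abs_of_nonneg (by positivity : 0 ≤ t ^ e)]
      calc |β'| * ((e + 2) * (e + 1)) * t ^ e ≤ 1 / (x ^ ((e : ℝ) + 1 - 0.43 - 3 * κ) * q) * ((e + 2) * (e + 1)) * (2 * x) ^ e := by
            gcongr; linarith
        _ = K * (x ^ (e : ℝ) / x ^ ((e : ℝ) + 1 - 0.43 - 3 * κ)) / q := by rw [mul_pow, hK, rpow_natCast]; field_simp
        _ = _ := by rw [← rpow_sub hx0]; congr 3; ring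
    have hb2 : |h * (γ * (γ - 1)) * (t + ι) ^ (γ - 2)| ≤ x ^ (3 * κ - 0.57) / q := by
      rw [abs_mul, abs_mul, abs_of_nonneg (by positivity : (0 : ℝ) ≤ h), abs_of_nonneg (by positivity : 0 ≤ (t + (ι : ℝ)) ^ (γ - 2))]
      have h3 : |γ * (γ - 1)| ≤ 1 := by rw [abs_mul, abs_of_pos hγ0, abs_of_neg (by linarith)]; exact mul_le_one₀ hγ1.le (by linarith) (by linarith)
      have h4 : (t + (ι : ℝ)) ^ (γ - 2) ≤ x ^ (γ - 2) :=
        rpow_le_rpow_of_nonpos hx0 (by linarith [show (0 : ℝ) ≤ ι by positivity]) (by linarith)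
      calc h * |γ * (γ - 1)| * (t + (ι : ℝ)) ^ (γ - 2) ≤ x ^ (3 * κ) * 1 * x ^ (γ - 2) := by gcongr
        _ = x ^ (3 * κ + (γ - 2)) := by rw [mul_one, ← rpow_add hx0]
        _ ≤ x ^ (3 * κ - 1) := rpow_le_rpow_of_exponent_le hx1 (by linarith)
        _ ≤ _ := hbase
    calc σ * gdd e γ β' h ι t ≤ |σ * gdd e γ β' h ι t| := le_abs_self _
      _ ≤ _ := by
        rw [abs_mul, hσ1, one_mul, gdd]
        refine (abs_add_le _ _).trans ((add_le_add hb1 hb2).trans (le_of_eq ?_))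
        rw [hL]; ring
  have hl0 : 0 < c1 * x ^ (γ - 2 - κ) := by positivity
  refine (major_int e q Y N h ι a β' β γ σ (c1 * x ^ (γ - 2 - κ)) L hq (hX.trans hXY) hσ hl0 hlL hlo hhi).trans ?_
  have hNx : (N : ℝ) ≤ x := by linarith
  have hA : (q : ℝ) ^ 2 * L * (N / q + 1) + 2 ≤ (2 * K + 4) * x ^ (0.43 + 3 * κ) := by
    have h1 : (N : ℝ) / q + 1 ≤ 2 * x / q := by
      rw [le_div_iff₀ hq0, add_mul, div_mul_cancel₀ _ hq0.ne']; linarith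
    have h2 : (1 : ℝ) ≤ x ^ (0.43 + 3 * κ) := one_le_rpow hx1 (by positivity)
    calc (q : ℝ) ^ 2 * L * (N / q + 1) + 2 ≤ (q : ℝ) ^ 2 * L * (2 * x / q) + 2 * 1 := by rw [mul_one]; gcongr
      _ = (2 * K + 2) * (x ^ (3 * κ - 0.57) * x ^ (1 : ℝ)) + 2 * 1 := by rw [hL, rpow_one]; field_simp
      _ = (2 * K + 2) * x ^ (0.43 + 3 * κ) + 2 * 1 := by rw [← rpow_add hx0]; congr 3; ring
      _ ≤ (2 * K + 2) * x ^ (0.43 + 3 * κ) + 2 * x ^ (0.43 + 3 * κ) := by gcongr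
      _ = _ := by ring
  have hsq : sqrt ((q : ℝ) ^ 2 * (c1 * x ^ (γ - 2 - κ))) = q * (sqrt c1 * x ^ ((γ - 2 - κ) / 2)) := by
    rw [sqrt_mul (by positivity), sqrt_sq hq0.le, sqrt_mul hc0.le, sqrt_eq_rpow (x ^ _), ← rpow_mul hx0.le]
    congr 3; ring
  have hsc : 0 < sqrt c1 := sqrt_pos.2 hc0
  rw [hsq]
  have hB : q * (4 / (q * (sqrt c1 * x ^ ((γ - 2 - κ) / 2))) + 4) ≤ (4 / sqrt c1 + 4) * x ^ (0.57 - 4 * κ) := by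
    have h1 : x ^ (-((γ - 2 - κ) / 2)) ≤ x ^ (0.57 - 4 * κ) := rpow_le_rpow_of_exponent_le hx1 (by linarith)
    have h2 : x ^ (0.43 : ℝ) ≤ x ^ (0.57 - 4 * κ) := rpow_le_rpow_of_exponent_le hx1 (by linarith)
    calc q * (4 / (q * (sqrt c1 * x ^ ((γ - 2 - κ) / 2))) + 4) = 4 / sqrt c1 * x ^ (-((γ - 2 - κ) / 2)) + 4 * q := by
          rw [rpow_neg hx0.le]; field_simp
      _ ≤ 4 / sqrt c1 * x ^ (0.57 - 4 * κ) + 4 * x ^ (0.57 - 4 * κ) := by gcongr; exact hqX.trans h2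
      _ = _ := by ring
  have hq1 : (q : ℝ) ≤ x ^ (1 - κ) := hqX.trans (rpow_le_rpow_of_exponent_le hx1 (by linarith))
  calc _ = (q ^ 2 * L * (N / q + 1) + 2) * (q * (4 / (q * (sqrt c1 * x ^ ((γ - 2 - κ) / 2))) + 4)) + q := by ring
    _ ≤ ((2 * K + 4) * x ^ (0.43 + 3 * κ)) * ((4 / sqrt c1 + 4) * x ^ (0.57 - 4 * κ)) + x ^ (1 - κ) := by gcongr
    _ = (2 * K + 4) * (4 / sqrt c1 + 4) * (x ^ (0.43 + 3 * κ) * x ^ (0.57 - 4 * κ)) + x ^ (1 - κ) := by ring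
    _ = (2 * K + 4) * (4 / sqrt c1 + 4) * x ^ (1 - κ) + x ^ (1 - κ) := by rw [← rpow_add hx0]; congr 3; ring
    _ = _ := by ring

lemma major (e : ℕ) (he : 1 ≤ e) (γ κ : ℝ) (hγ0 : 0 < γ) (hγ1 : γ < 1) (hγ : 1 - γ ≤ 0.01) (hκ0 : 0 < κ) (hκ : κ ≤ 0.0105) : ∃ C > 0,
    ∀ (X N h ι q : ℕ) (a : ℤ) (β' β : ℝ), 1 ≤ X → N ≤ X → 1 ≤ h → (h : ℝ) ≤ (X : ℝ) ^ (3 * κ) → ι ≤ 1 →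
    1 ≤ q → (q : ℝ) ≤ (X : ℝ) ^ (0.43 : ℝ) → |β'| ≤ 1 / ((X : ℝ) ^ ((e : ℝ) + 1 - 0.43 - 3 * κ) * q) →
    ‖∑ n ∈ range N, eC (phs (e + 2) γ (a / q + β') β h ι (X + n))‖ ≤ C * (X : ℝ) ^ (1 - κ) := by
  obtain ⟨C, hC0, hC⟩ := major_piece e γ κ hγ0 hγ1 hγ hκ0 hκ
  refine ⟨2 * C + 9, by positivity, ?_⟩
  intro X N h ι q a β' β hX hNX hh1 hh hι hq hqX hβ
  set x : ℝ := (X : ℝ) with hxd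
  have hx1 : 1 ≤ x := by rw [hxd]; exact_mod_cast hX
  have hx0 : 0 < x := by linarith
  have hNx : (N : ℝ) ≤ x := by rw [hxd]; exact_mod_cast hNX
  have hι' : (ι : ℝ) ≤ 1 := by exact_mod_cast hι
  have hh' : (1 : ℝ) ≤ h := by exact_mod_cast hh1
  have hP0 : 0 < x ^ (1 - κ) := by positivity
  have hP1 : 1 ≤ x ^ (1 - κ) := one_le_rpow hx1 (by linarith)
  set δ := x ^ (-κ) with hδ
  have hδ0 : 0 < δ := by positivity
  have hδx : x * δ = x ^ (1 - κ) := by rw [hδ, sub_eq_add_neg, rpow_add hx0, rpow_one]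
  rcases lt_or_ge (1 / 2) δ with h12 | h12
  · refine (norm_sum_eC_le _ _).trans ?_
    have : x ≤ 2 * x ^ (1 - κ) := by rw [← hδx]; linarith [mul_le_mul_of_nonneg_left h12.le hx0.le]
    rw [card_range]
    linarith [mul_pos hC0 hP0]
  set B := h * (γ * (1 - γ)) with hB
  have hg0 : 0 < γ * (1 - γ) := mul_pos hγ0 (by linarith)
  have hBg : γ * (1 - γ) ≤ B := by exact le_mul_of_one_le_left hg0.le hh'
  have hB0 : 0 < B := hg0.trans_le hBg
  have hlow : ∀ t : ℝ, x ≤ t → t + 1 ≤ x + N → ∀ v, B * δ ≤ v → γ * (1 - γ) / 9 * x ^ (γ - 2 - κ) ≤ (t + ι) ^ (γ - 2) * v := by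
    intro t h1 h2 v hv
    have ht : 0 < t + ι := by linarith [show (0 : ℝ) ≤ ι by positivity]
    have h3 : (3 * x) ^ (γ - 2) ≤ (t + (ι : ℝ)) ^ (γ - 2) := rpow_le_rpow_of_nonpos ht (by linarith) (by linarith)
    have h4 : (1 / 9 : ℝ) ≤ 3 ^ (γ - 2) := by
      calc (1 / 9 : ℝ) = 3 ^ (-2 : ℝ) := by rw [rpow_neg (by norm_num)]; norm_num
        _ ≤ _ := rpow_le_rpow_of_exponent_le (by norm_num) (by linarith)
    calc γ * (1 - γ) / 9 * x ^ (γ - 2 - κ) = (1 / 9 * x ^ (γ - 2)) * (γ * (1 - γ) * δ) := by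
          rw [hδ, sub_eq_add_neg (γ - 2), rpow_add hx0]; ring
      _ ≤ (3 ^ (γ - 2) * x ^ (γ - 2)) * (B * δ) := by gcongr
      _ = (3 * x) ^ (γ - 2) * (B * δ) := by rw [mul_rpow (by norm_num) hx0.le]
      _ ≤ (t + ι) ^ (γ - 2) * v := by gcongr
  set A := β' * ((e + 2) * (e + 1)) with hA
  set ψ : ℝ → ℝ := fun t => A * t ^ e * (t + ι) ^ (2 - γ) with hψ
  clear_value ψ A B δ
  have hgdd : ∀ t : ℝ, 0 < t → gdd e γ β' h ι t = (t + ι) ^ (γ - 2) * (ψ t - B) := by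
    intro t ht
    have h0 : 0 < t + (ι : ℝ) := by positivity
    have h1 : (t + (ι : ℝ)) ^ (γ - 2) * (t + (ι : ℝ)) ^ (2 - γ) = 1 := by
      rw [← rpow_add h0]; simp
    rw [gdd, hB, hψ, ← hA]
    simp only
    linear_combination (-A * t ^ e) * h1
  rcases le_or_gt β' 0 with hb | hb
  · have := hC X X N h ι q a β' β (-1) hX le_rfl (by omega) hh hι hq hqX hβ (Or.inr rfl) (fun t h1 h2 => by
      have ht : 0 < t := by linarith
      have hψ0 : ψ t ≤ 0 := by
        have : A ≤ 0 := hA ▸ mul_nonpos_of_nonpos_of_nonneg hb (by positivity)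
        simp only [hψ]; rw [mul_assoc]; exact mul_nonpos_of_nonpos_of_nonneg this (by positivity)
      rw [hgdd t ht, mul_left_comm]
      exact hlow t h1 h2 _ (by linarith [mul_le_mul_of_nonneg_left h12 hB0.le]))
    refine this.trans ?_
    gcongr; linarith
  have hA0 : 0 < A := by rw [hA]; positivity
  have hmono : ∀ s t : ℝ, 0 < s → s ≤ t → ψ s ≤ ψ t := by
    intro s t hs hst
    simp only [hψ]
    have : (s + (ι : ℝ)) ^ (2 - γ) ≤ (t + ι) ^ (2 - γ) := rpow_le_rpow (by positivity) (by linarith) (by linarith)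
    have ht := hs.trans_le hst
    gcongr
  have hratio : ∀ s t : ℝ, 0 < s → s ≤ t → ψ s * t ≤ ψ t * s := by
    intro s t hs hst
    have ht : 0 < t := hs.trans_le hst
    obtain ⟨f, rfl⟩ : ∃ f, e = f + 1 := ⟨e - 1, by omega⟩
    simp only [hψ]
    have h1 : (s + (ι : ℝ)) ^ (2 - γ) ≤ (t + ι) ^ (2 - γ) := rpow_le_rpow (by positivity) (by linarith) (by linarith)
    calc A * s ^ (f + 1) * (s + ι) ^ (2 - γ) * t = A * s ^ f * (s + ι) ^ (2 - γ) * (s * t) := by ring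
      _ ≤ A * t ^ f * (t + ι) ^ (2 - γ) * (s * t) := by gcongr
      _ = _ := by ring
  have hGm : ∀ n : ℕ, n + 1 < N → ψ (x + n) ≤ ψ (x + (n + 1 : ℕ)) := fun n _ => hmono _ _ (by positivity) (by push_cast; linarith)
  obtain ⟨a1, ha1N, ha1, ha1'⟩ := thr (fun n => ψ (x + n)) N hGm (B * (1 - δ))
  obtain ⟨a2, ha2N, ha2, ha2'⟩ := thr (fun n => ψ (x + n)) N hGm (B * (1 + δ))
  have h12' : a1 ≤ a2 := by
    by_contra hcon
    push Not at hcon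
    have h1 := ha1 a2 hcon
    have h2 := ha2' a2 le_rfl (by omega)
    linarith [mul_pos hB0 hδ0]
  obtain ⟨n2, rfl⟩ : ∃ n2, a2 = a1 + n2 := ⟨a2 - a1, by omega⟩
  obtain ⟨n3, rfl⟩ : ∃ n3, N = a1 + n2 + n3 := ⟨N - (a1 + n2), by omega⟩
  have hpc1 := hC X X a1 h ι q a β' β (-1) hX le_rfl (by omega) hh hι hq hqX hβ (Or.inr rfl) (fun t h1 h2 => by
      have ht : 0 < t := by linarith
      rw [hgdd t ht, mul_left_comm]
      refine hlow t h1 (h2.trans (by push_cast; linarith [show (0 : ℝ) ≤ n2 by positivity, show (0 : ℝ) ≤ n3 by positivity])) _ ?_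
      have ha : 1 ≤ a1 := by
        by_contra hcon
        have : a1 = 0 := by omega
        rw [this] at h2; push_cast at h2; linarith
      have h3 := ha1 (a1 - 1) (by omega)
      have h4 := hmono t (x + (a1 - 1 : ℕ)) ht (by push_cast [ha]; linarith)
      linarith)
  have hpc3 := hC X (X + (a1 + n2)) n3 h ι q a β' β 1 hX (by omega) (by omega) hh hι hq hqX hβ (Or.inl rfl) (fun t h1 h2 => by
      push_cast at h1 h2
      rw [← hxd] at h1 h2
      have h0 : (0 : ℝ) ≤ a1 + n2 := by positivity
      have ht : 0 < t := by linarith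
      rw [hgdd t ht, one_mul]
      refine hlow t (by linarith) (h2.trans (by push_cast; linarith)) _ ?_
      have ha : 1 ≤ n3 := by
        by_contra hcon
        have : n3 = 0 := by omega
        rw [this] at h2; push_cast at h2; linarith
      have h3 := ha2' (a1 + n2) le_rfl (by omega)
      have h4 := hmono (x + (a1 + n2 : ℕ)) t (by positivity) (by push_cast; linarith)
      linarith)
  have hn2 : (n2 : ℝ) ≤ 9 * x ^ (1 - κ) := by
    rcases Nat.eq_zero_or_pos n2 with rfl | h0
    · push_cast; positivity
    have h1 := ha1' a1 le_rfl (by omega)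
    have h2 := ha2 (a1 + n2 - 1) (by omega)
    have hle : (a1 : ℝ) ≤ (a1 + n2 - 1 : ℕ) := by exact_mod_cast (by omega : a1 ≤ a1 + n2 - 1)
    have hcast : ((a1 + n2 - 1 : ℕ) : ℝ) = a1 + n2 - 1 := by push_cast [show 1 ≤ a1 + n2 by omega]; ring
    have h3 := hratio (x + a1) (x + (a1 + n2 - 1 : ℕ)) (by positivity) (by linarith)
    rw [hcast] at h2 h3
    have hs : (a1 : ℝ) ≤ x := by
      have : ((a1 + n2 + n3 : ℕ) : ℝ) = a1 + n2 + n3 := by push_cast; ring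
      linarith [show (0 : ℝ) ≤ n2 by positivity, show (0 : ℝ) ≤ n3 by positivity]
    have hn1 : (1 : ℝ) ≤ n2 := by exact_mod_cast h0
    have h4 : B * (1 - δ) * (x + (a1 + n2 - 1)) ≤ B * (1 + δ) * (x + a1) :=
      calc B * (1 - δ) * (x + (a1 + n2 - 1)) ≤ ψ (x + a1) * (x + (a1 + n2 - 1)) := by
            gcongr
            have : (0 : ℝ) ≤ a1 := by positivity
            linarith
        _ ≤ _ := h3
        _ ≤ _ := by gcongr
    rw [mul_assoc, mul_assoc] at h4
    have h5 := le_of_mul_le_mul_left h4 hB0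
    have h6 : ((n2 : ℝ) - 1) * (1 - δ) ≤ 2 * δ * (2 * x) := by
      have : δ * (x + a1) ≤ δ * (2 * x) := by gcongr; linarith
      linarith [mul_pos hB0 hδ0]
    have h7 : ((n2 : ℝ) - 1) * (1 / 2) ≤ ((n2 : ℝ) - 1) * (1 - δ) := by
      apply mul_le_mul_of_nonneg_left <;> linarith
    linarith
  rw [sum_range_add, sum_range_add]
  have hmid : ‖∑ n ∈ range n2, eC (phs (e + 2) γ (a / q + β') β h ι (X + (a1 + n)))‖ ≤ 9 * x ^ (1 - κ) :=
    (norm_sum_eC_le _ _).trans (by rwa [card_range])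
  have h3e : ∑ n ∈ range n3, eC (phs (e + 2) γ (a / q + β') β h ι (X + (a1 + n2 + n))) =
      ∑ n ∈ range n3, eC (phs (e + 2) γ (a / q + β') β h ι (X + (a1 + n2) + n)) :=
    sum_congr rfl fun n _ => by rw [add_assoc X]
  rw [h3e]
  calc _ ≤ _ := norm_add₃_le
    _ ≤ C * x ^ (1 - κ) + 9 * x ^ (1 - κ) + C * x ^ (1 - κ) := by gcongr
    _ = _ := by ring

lemma bb_four (e : ℕ) (he : 2 ≤ e) (γ κ : ℝ) (hγ0 : 0 < γ) (hγ1 : γ < 1) (hγ : 1 - γ ≤ 0.01) (hκ0 : 0 < κ) (hκ1 : κ ≤ 0.0105)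
    (hκ : 2 * ((e : ℝ) + 2) * (e + 3) * κ ≤ 0.42) : BB (e + 2) γ κ := by
  obtain ⟨C1, hC1, h1⟩ := minor e he γ κ hγ1 hκ0 hκ
  obtain ⟨C2, hC2, h2⟩ := major e (by omega) γ κ hγ0 hγ1 hγ hκ0 hκ1
  refine ⟨C1 + C2 + 1, by positivity, ?_⟩
  intro x X N h ι α β hX hXx hNX hh1 hh hι
  have hX1 : (1 : ℝ) ≤ X := by exact_mod_cast hX
  have hX0 : (0 : ℝ) < X := by linarith
  have hXx' : (X : ℝ) ≤ x := by exact_mod_cast hXx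
  have hx0 : (0 : ℝ) < x := by linarith
  have hP0 : 0 < (x : ℝ) ^ (1 - κ) := by positivity
  rcases le_or_gt (X : ℝ) ((x : ℝ) ^ (1 - κ)) with hs | hs
  · refine (norm_sum_eC_le _ _).trans ?_
    rw [card_range]
    have : (N : ℝ) ≤ X := by exact_mod_cast hNX
    calc (N : ℝ) ≤ 1 * (x : ℝ) ^ (1 - κ) := by linarith
      _ ≤ _ := by gcongr; linarith
  have hh' : (h : ℝ) ≤ (X : ℝ) ^ (3 * κ) := by
    refine hh.trans ?_
    calc (x : ℝ) ^ (2 * κ) ≤ (x : ℝ) ^ ((1 - κ) * (3 * κ)) := rpow_le_rpow_of_exponent_le (hX1.trans hXx') (by nlinarith)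
      _ = ((x : ℝ) ^ (1 - κ)) ^ (3 * κ) := rpow_mul hx0.le _ _
      _ ≤ _ := rpow_le_rpow hP0.le hs.le (by positivity)
  have hfin : (X : ℝ) ^ (1 - κ) ≤ (x : ℝ) ^ (1 - κ) := rpow_le_rpow hX0.le hXx' (by linarith)
  set V : ℝ := (X : ℝ) ^ ((e : ℝ) + 1 - 0.43 - 3 * κ) with hV
  have he' : (2 : ℝ) ≤ e := by exact_mod_cast he
  have hV1 : 1 ≤ V := one_le_rpow hX1 (by linarith)
  obtain ⟨r, hr1, hr2⟩ := exists_rat_abs_sub_le_and_den_le α (n := ⌊V⌋₊) (Nat.floor_pos.2 hV1)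
  have hq0 : (0 : ℝ) < r.den := by exact_mod_cast r.pos
  have happ : |α - r.num / r.den| ≤ 1 / (V * r.den) := by
    rw [show (r.num : ℝ) / r.den = (r : ℝ) by exact_mod_cast r.num_div_den]
    refine hr1.trans ?_
    have := (Nat.lt_floor_add_one V).le
    gcongr
  rcases le_or_gt ((X : ℝ) ^ (0.43 : ℝ)) r.den with hq | hq
  · have hcop : IsCoprime ((r.den : ℕ) : ℤ) r.num := by
      rw [isCoprime_comm, Int.isCoprime_iff_gcd_eq_one]
      simpa [Int.gcd] using r.reduced
    have hqV : (r.den : ℝ) ≤ V := le_trans (by exact_mod_cast hr2) (Nat.floor_le (by linarith))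
    refine (h1 X N h ι r.den r.num α β hX hNX hh' hcop hq hqV happ).trans ?_
    calc C1 * (X : ℝ) ^ (1 - κ) ≤ (C1 + C2 + 1) * (x : ℝ) ^ (1 - κ) := by gcongr; linarith
      _ = _ := rfl
  · have := h2 X N h ι r.den r.num (α - r.num / r.den) β hX hNX hh1 hh' hι r.pos hq.le happ
    rw [add_sub_cancel] at this
    refine this.trans ?_
    calc C2 * (X : ℝ) ^ (1 - κ) ≤ (C1 + C2 + 1) * (x : ℝ) ^ (1 - κ) := by gcongr; linarith
      _ = _ := rfl

lemma log_abs (ε : ℝ) (hε : 0 < ε) : ∃ C > 0, ∀ x : ℕ, 1 ≤ x → ((Nat.log 2 x + 1 : ℕ) : ℝ) ≤ C * (x : ℝ) ^ ε := by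
  have hl : 0 < log 2 := log_pos (by norm_num)
  refine ⟨1 / ε / log 2 + 1, by positivity, fun x hx => ?_⟩
  have hx1 : (1 : ℝ) ≤ x := by exact_mod_cast hx
  have h1 : (Nat.log 2 x : ℝ) ≤ logb 2 x := by exact_mod_cast natLog_le_logb x 2
  have h2 := log_le_rpow_div (show (0 : ℝ) ≤ x by linarith) hε
  have h3 : (1 : ℝ) ≤ (x : ℝ) ^ ε := one_le_rpow hx1 hε.le
  have h4 : logb 2 x ≤ (x : ℝ) ^ ε / ε / log 2 := by
    unfold logb; gcongr
  push_cast
  calc (Nat.log 2 x : ℝ) + 1 ≤ (x : ℝ) ^ ε / ε / log 2 + (x : ℝ) ^ ε := by linarith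
    _ = _ := by ring

lemma dyad {d : ℕ} {γ κ : ℝ} (hB : BB d γ κ) (ε : ℝ) (hε : 0 < ε) : ∃ C > 0, ∀ x y h ι : ℕ, ∀ α β : ℝ, 1 ≤ x → y ≤ x → 1 ≤ h →
    (h : ℝ) ≤ (x : ℝ) ^ (2 * κ) → ι ≤ 1 → ‖∑ m ∈ Icc 1 y, eC (phs d γ α β h ι m)‖ ≤ C * (x : ℝ) ^ (1 - κ + ε) := by
  obtain ⟨C, hC0, hC⟩ := hB
  obtain ⟨C', hC0', hC'⟩ := log_abs ε hε
  refine ⟨C' * C, by positivity, fun x y h ι α β hx hy hh hhx hι => ?_⟩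
  have key : ∀ k y : ℕ, y < 2 ^ k → y ≤ x → ‖∑ m ∈ Icc 1 y, eC (phs d γ α β h ι m)‖ ≤ k * (C * (x : ℝ) ^ (1 - κ)) := by
    intro k
    induction k with
    | zero => intro y hy _; have : y = 0 := by simpa using hy
              subst this; simp
    | succ k ih =>
      intro y hy hyx
      rcases Nat.eq_zero_or_pos y with rfl | hy0
      · simp; positivity
      have h1 := ih (y / 2) (by rw [pow_succ] at hy; omega) (by omega)
      have h2 := hC x (y / 2 + 1) (y - y / 2) h ι α β (by omega) (by omega) (by omega) hh hhx hι
      have h3 : ∑ m ∈ Icc 1 y, eC (phs d γ α β h ι m) = ∑ m ∈ Icc 1 (y / 2), eC (phs d γ α β h ι m) +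
          ∑ n ∈ range (y - y / 2), eC (phs d γ α β h ι (y / 2 + 1 + n)) := by
        have e1 : ∀ z, Icc 1 z = Ico 1 (z + 1) := fun z => by ext; simp
        rw [e1, e1, ← sum_Ico_consecutive _ (show 1 ≤ y / 2 + 1 by omega) (show y / 2 + 1 ≤ y + 1 by omega),
          sum_Ico_eq_sum_range _ (y / 2 + 1), Nat.add_sub_add_right]
      rw [h3]
      refine (norm_add_le _ _).trans ((add_le_add h1 h2).trans (le_of_eq ?_))
      push_cast; ring
  have h1 := key (Nat.log 2 x + 1) y (hy.trans_lt (Nat.lt_pow_succ_log_self (by norm_num) x)) hy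
  have hx0 : (0 : ℝ) < x := by exact_mod_cast hx
  refine h1.trans ?_
  calc _ ≤ (C' * (x : ℝ) ^ ε) * (C * (x : ℝ) ^ (1 - κ)) := by gcongr; exact hC' x hx
    _ = C' * C * ((x : ℝ) ^ (1 - κ) * (x : ℝ) ^ ε) := by ring
    _ = _ := by rw [← rpow_add hx0]

def Q2 (t : ℝ) : ℝ := Int.fract t ^ 2 - Int.fract t

lemma Q2_ineq (t s : ℝ) : Q2 (t + s) - Q2 t ≤ s * (2 * Int.fract t - 1) + s ^ 2 := by
  have hmin : ∀ u : ℝ, ∀ n : ℤ, Q2 u ≤ (u - n) * (u - n - 1) := by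
    intro u n
    have h1 : u = ⌊u⌋ + Int.fract u := (Int.floor_add_fract u).symm
    have h2 := Int.fract_nonneg u
    have h3 := (Int.fract_lt_one u).le
    set v := Int.fract u with hv
    have e : (u - n) * (u - n - 1) - (v ^ 2 - v) = ((⌊u⌋ - n : ℤ) : ℝ) * (((⌊u⌋ - n : ℤ) : ℝ) - 1 + 2 * v) := by
      push_cast; rw [show (⌊u⌋ : ℝ) = u - v by linarith]; ring
    have : Q2 u = v ^ 2 - v := rfl
    rw [this]
    generalize ⌊u⌋ - n = j at e
    suffices 0 ≤ (j : ℝ) * ((j : ℝ) - 1 + 2 * v) by linarith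
    rcases le_or_gt j 0 with hj | hj
    · rcases eq_or_lt_of_le hj with hj | hj
      · simp [hj]
      · have : (j : ℝ) ≤ -1 := by exact_mod_cast (by omega : j ≤ -1)
        apply mul_nonneg_of_nonpos_of_nonpos <;> linarith
    · have : (1 : ℝ) ≤ j := by exact_mod_cast hj
      apply mul_nonneg <;> linarith
  have h := hmin (t + s) ⌊t⌋
  have h1 : t - ⌊t⌋ = Int.fract t := rfl
  have : (t + s - ⌊t⌋) * (t + s - ⌊t⌋ - 1) = (Int.fract t + s) * (Int.fract t + s - 1) := by rw [← h1]; ring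
  rw [this] at h
  unfold Q2 at h ⊢
  linarith

lemma Q2_hasSum (t : ℝ) : HasSum (fun n : ℕ => 1 / (n : ℝ) ^ 2 * cos (2 * π * n * t)) (π ^ 2 * (Q2 t + 1 / 6)) := by
  have h := hasSum_one_div_nat_pow_mul_cos (k := 1) one_ne_zero (x := Int.fract t) ⟨Int.fract_nonneg t, (Int.fract_lt_one t).le⟩
  convert h using 1
  · funext n
    congr 1
    · have : 2 * π * n * t = 2 * π * n * Int.fract t + ((n * ⌊t⌋ : ℤ) : ℝ) * (2 * π) := by
        have := Int.floor_add_fract t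
        push_cast
        linear_combination (-2 * π * n) * this
      rw [this, cos_add_int_mul_two_pi]
  · have hb : (Polynomial.map (algebraMap ℚ ℝ) (Polynomial.bernoulli (2 * 1))).eval (Int.fract t) = Q2 t + 1 / 6 := by
      simp [Polynomial.bernoulli, sum_range_succ, Q2, bernoulli_one, bernoulli_two, Polynomial.eval_add]
      ring
    rw [hb, show ((Nat.factorial (2 * 1) : ℕ) : ℝ) = 2 by norm_num [Nat.factorial]]; ring

lemma cos_diff (n : ℕ) (t s : ℝ) : ((cos (2 * π * n * (t + s)) - cos (2 * π * n * t) : ℝ) : ℂ) =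
    ((eC (n * s) - 1) * eC (n * t) + (eC (-(n * s)) - 1) * eC (-(n * t))) / 2 := by
  have hc : ∀ u : ℝ, ((cos (2 * π * u) : ℝ) : ℂ) = (eC u + eC (-u)) / 2 := by
    intro u
    rw [eC_half u, eC_half (-u), show 2 * π * -u = -(2 * π * u) by ring, cos_neg, sin_neg]
    push_cast; ring
  rw [Complex.ofReal_sub, mul_assoc (2 * π), mul_assoc (2 * π), hc, hc, mul_add, eC_add, neg_add, eC_add]
  ring

lemma q_bound {d : ℕ} {γ κ : ℝ} (hB : BB d γ κ) (hκ0 : 0 < κ) (hκ : κ ≤ 1 / 2) (ε : ℝ) (hε : 0 < ε) (hε1 : ε ≤ 1) :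
    ∃ C > 0, ∀ x y ι : ℕ, ∀ α β s : ℝ, 1 ≤ x → y ≤ x → ι ≤ 1 → |s| = (x : ℝ) ^ (-κ) →
    ‖∑ m ∈ Icc 1 y, eC (α * (m : ℝ) ^ d + β * m) * ((Q2 (-((m : ℝ) + ι) ^ γ + s) - Q2 (-((m : ℝ) + ι) ^ γ) : ℝ) : ℂ)‖ ≤
      C * (x : ℝ) ^ (1 - 2 * κ + ε) := by
  obtain ⟨C1, hC1, h1⟩ := dyad hB (ε / 2) (by positivity)
  have hsum : Summable (fun n : ℕ => 1 / (n : ℝ) ^ (1 + ε / 2)) := summable_one_div_nat_rpow.2 (by linarith)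
  set Z := ∑' n : ℕ, 1 / (n : ℝ) ^ (1 + ε / 2) with hZ
  have hZ0 : 0 ≤ Z := tsum_nonneg fun n => by positivity
  refine ⟨(2 * π * C1 + 2) * Z + 1, by positivity, ?_⟩
  intro x y ι α β s hx hy hι hs
  have hx1 : (1 : ℝ) ≤ x := by exact_mod_cast hx
  have hx0 : (0 : ℝ) < x := by linarith
  set w : ℕ → ℂ := fun m => eC (α * (m : ℝ) ^ d + β * m) with hw
  set t : ℕ → ℝ := fun m => -((m : ℝ) + ι) ^ γ with ht
  have hS : HasSum (fun n : ℕ => ∑ m ∈ Icc 1 y, w m * ((1 / (n : ℝ) ^ 2 * (cos (2 * π * n * (t m + s)) - cos (2 * π * n * t m)) : ℝ) : ℂ))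
      (∑ m ∈ Icc 1 y, w m * ((π ^ 2 * (Q2 (t m + s) - Q2 (t m)) : ℝ) : ℂ)) := by
    refine hasSum_sum fun m _ => HasSum.mul_left _ ?_
    rw [Complex.hasSum_ofReal]
    rw [show π ^ 2 * (Q2 (t m + s) - Q2 (t m)) = π ^ 2 * (Q2 (t m + s) + 1 / 6) - π ^ 2 * (Q2 (t m) + 1 / 6) by ring]
    simpa only [mul_sub] using (Q2_hasSum (t m + s)).sub (Q2_hasSum (t m))
  have hterm : ∀ n : ℕ, ‖∑ m ∈ Icc 1 y, w m * ((1 / (n : ℝ) ^ 2 * (cos (2 * π * n * (t m + s)) - cos (2 * π * n * t m)) : ℝ) : ℂ)‖ ≤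
      ((2 * π * C1 + 2) * (x : ℝ) ^ (1 - 2 * κ + ε)) * (1 / (n : ℝ) ^ (1 + ε / 2)) := by
    intro n
    rcases Nat.eq_zero_or_pos n with rfl | hn
    · simp; positivity
    have hn1 : (1 : ℝ) ≤ n := by exact_mod_cast hn
    have hn0 : (0 : ℝ) < n := by linarith
    have hmain : ∀ r T : ℝ, ‖eC (n * s) - 1‖ ≤ r → ‖eC (-(n * s)) - 1‖ ≤ r → 0 ≤ r →
        (∀ α β : ℝ, ‖∑ m ∈ Icc 1 y, eC (phs d γ α β n ι m)‖ ≤ T) →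
        ‖∑ m ∈ Icc 1 y, w m * ((1 / (n : ℝ) ^ 2 * (cos (2 * π * n * (t m + s)) - cos (2 * π * n * t m)) : ℝ) : ℂ)‖ ≤
          1 / (n : ℝ) ^ 2 * (r * T) := by
      intro r T hr1 hr2 hr0 hT
      have e1 : ∑ m ∈ Icc 1 y, w m * ((1 / (n : ℝ) ^ 2 * (cos (2 * π * n * (t m + s)) - cos (2 * π * n * t m)) : ℝ) : ℂ) =
          ((1 / (n : ℝ) ^ 2 : ℝ) : ℂ) * (((eC (n * s) - 1) * ∑ m ∈ Icc 1 y, eC (-phs d γ (-α) (-β) n ι m) +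
            (eC (-(n * s)) - 1) * ∑ m ∈ Icc 1 y, eC (phs d γ α β n ι m)) / 2) := by
        rw [mul_sum, mul_sum, ← sum_add_distrib, sum_div, mul_sum]
        refine sum_congr rfl fun m _ => ?_
        rw [Complex.ofReal_mul, cos_diff]
        have e2 : eC (-phs d γ (-α) (-β) n ι m) = w m * eC (n * t m) := by
          rw [hw, ← eC_add, ht]; congr 1; unfold phs; ring
        have e3 : eC (phs d γ α β n ι m) = w m * eC (-(n * t m)) := by
          rw [hw, ← eC_add, ht]; congr 1; unfold phs; ring
        rw [e2, e3]; ring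
      rw [e1, norm_mul, Complex.norm_real, norm_of_nonneg (by positivity), norm_div]
      gcongr
      have h3 := hT (-α) (-β)
      rw [← sd_conj] at h3
      have h4 := hT α β
      rw [div_le_iff₀ (by norm_num)]
      refine (norm_add_le _ _).trans ?_
      rw [norm_mul, norm_mul]
      calc _ ≤ r * T + r * T := by gcongr
        _ = _ := by norm_num; ring
    rcases le_or_gt (n : ℝ) ((x : ℝ) ^ (2 * κ)) with hnx | hnx
    · have hr : ‖eC (n * s) - 1‖ ≤ 2 * π * (n * (x : ℝ) ^ (-κ)) ∧ ‖eC (-(n * s)) - 1‖ ≤ 2 * π * (n * (x : ℝ) ^ (-κ)) := by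
        constructor
        · refine (norm_eC_sub_one _).trans (le_of_eq ?_); rw [abs_mul, hs, Nat.abs_cast]
        · refine (norm_eC_sub_one _).trans (le_of_eq ?_); rw [abs_neg, abs_mul, hs, Nat.abs_cast]
      refine (hmain _ _ hr.1 hr.2 (by positivity) fun α β => h1 x y n ι α β hx hy hn hnx hι).trans ?_
      have h5 : (n : ℝ) ^ (ε / 2) ≤ (x : ℝ) ^ (ε / 2) := by
        refine rpow_le_rpow hn0.le (hnx.trans ?_) (by positivity)
        simpa using rpow_le_rpow_of_exponent_le hx1 (show 2 * κ ≤ 1 by linarith)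
      calc 1 / (n : ℝ) ^ 2 * (2 * π * (n * (x : ℝ) ^ (-κ)) * (C1 * (x : ℝ) ^ (1 - κ + ε / 2)))
          = (2 * π * C1) * ((x : ℝ) ^ (-κ) * (x : ℝ) ^ (1 - κ + ε / 2)) * (n : ℝ) ^ (ε / 2) * (1 / (n : ℝ) ^ (1 + ε / 2)) := by
            rw [rpow_add hn0, rpow_one]; field_simp
        _ ≤ (2 * π * C1) * ((x : ℝ) ^ (-κ) * (x : ℝ) ^ (1 - κ + ε / 2)) * (x : ℝ) ^ (ε / 2) * (1 / (n : ℝ) ^ (1 + ε / 2)) := by gcongr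
        _ = (2 * π * C1) * (x : ℝ) ^ (1 - 2 * κ + ε) * (1 / (n : ℝ) ^ (1 + ε / 2)) := by
            rw [← rpow_add hx0, mul_assoc (2 * π * C1), ← rpow_add hx0]; congr 3; ring
        _ ≤ _ := by gcongr; linarith
    · have hr : ∀ u : ℝ, ‖eC u - 1‖ ≤ 2 := fun u => (norm_sub_le _ _).trans (by rw [eC_norm]; norm_num)
      refine (hmain 2 x (hr _) (hr _) (by norm_num) fun α β => (norm_sum_eC_le _ _).trans (by simpa using hy)).trans ?_
      have h5 : (n : ℝ) ^ (ε / 2 - 1) ≤ (x : ℝ) ^ (-(2 * κ) + ε) := by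
        calc (n : ℝ) ^ (ε / 2 - 1) ≤ ((x : ℝ) ^ (2 * κ)) ^ (ε / 2 - 1) := rpow_le_rpow_of_nonpos (by positivity) hnx.le (by linarith)
          _ = (x : ℝ) ^ (2 * κ * (ε / 2 - 1)) := by rw [← rpow_mul hx0.le]
          _ ≤ _ := rpow_le_rpow_of_exponent_le hx1 (by nlinarith)
      calc 1 / (n : ℝ) ^ 2 * (2 * x) = 2 * (x : ℝ) ^ (1 : ℝ) * (n : ℝ) ^ (ε / 2 - 1) * (1 / (n : ℝ) ^ (1 + ε / 2)) := by
            rw [rpow_one, rpow_add hn0, rpow_sub hn0, rpow_one]; field_simp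
        _ ≤ 2 * (x : ℝ) ^ (1 : ℝ) * (x : ℝ) ^ (-(2 * κ) + ε) * (1 / (n : ℝ) ^ (1 + ε / 2)) := by gcongr
        _ = 2 * (x : ℝ) ^ (1 - 2 * κ + ε) * (1 / (n : ℝ) ^ (1 + ε / 2)) := by
            rw [mul_assoc 2, ← rpow_add hx0]; congr 3; ring
        _ ≤ _ := by gcongr; linarith [show 0 ≤ 2 * π * C1 by positivity]
  have hfin := hS.norm_le_of_bounded (hsum.hasSum.mul_left _) hterm
  have e4 : ∑ m ∈ Icc 1 y, w m * ((π ^ 2 * (Q2 (t m + s) - Q2 (t m)) : ℝ) : ℂ) =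
      ((π ^ 2 : ℝ) : ℂ) * ∑ m ∈ Icc 1 y, w m * ((Q2 (t m + s) - Q2 (t m) : ℝ) : ℂ) := by
    rw [mul_sum]; refine sum_congr rfl fun m _ => ?_; push_cast; ring
  rw [e4, norm_mul, Complex.norm_real, norm_of_nonneg (by positivity)] at hfin
  have hpi : 1 ≤ π ^ 2 := by nlinarith [pi_gt_three]
  calc _ ≤ π ^ 2 * ‖∑ m ∈ Icc 1 y, w m * ((Q2 (t m + s) - Q2 (t m) : ℝ) : ℂ)‖ := le_mul_of_one_le_left (norm_nonneg _) hpi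
    _ ≤ _ := hfin
    _ = ((2 * π * C1 + 2) * Z) * (x : ℝ) ^ (1 - 2 * κ + ε) := by rw [hZ]; ring
    _ ≤ _ := by gcongr; linarith

lemma psi_bound {d : ℕ} {γ κ : ℝ} (hB : BB d γ κ) (hκ0 : 0 < κ) (hκ : κ ≤ 1 / 2) (ε : ℝ) (hε : 0 < ε) (hε1 : ε ≤ 1) :
    ∃ C > 0, ∀ x y ι : ℕ, ∀ α β : ℝ, 1 ≤ x → y ≤ x → ι ≤ 1 →
    ‖∑ m ∈ Icc 1 y, eC (α * (m : ℝ) ^ d + β * m) * ((2 * Int.fract (-((m : ℝ) + ι) ^ γ) - 1 : ℝ) : ℂ)‖ ≤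
      C * (x : ℝ) ^ (1 - κ + ε) := by
  obtain ⟨C, hC0, hC⟩ := q_bound hB hκ0 hκ ε hε hε1
  refine ⟨3 * C + 3, by positivity, ?_⟩
  intro x y ι α β hx hy hι
  have hx1 : (1 : ℝ) ≤ x := by exact_mod_cast hx
  have hx0 : (0 : ℝ) < x := by linarith
  set δ : ℝ := (x : ℝ) ^ (-κ) with hδ
  have hδ0 : 0 < δ := by positivity
  set t : ℕ → ℝ := fun m => -((m : ℝ) + ι) ^ γ with ht
  set E : ℝ := C * (x : ℝ) ^ (1 - 2 * κ + ε) with hE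
  have h1 := hC x y ι α β δ hx hy hι (abs_of_pos hδ0)
  have h2 := hC x y ι 0 0 δ hx hy hι (abs_of_pos hδ0)
  have h3 := hC x y ι 0 0 (-δ) hx hy hι (by rw [abs_neg]; exact abs_of_pos hδ0)
  simp only [zero_mul, add_zero, eC_zero, one_mul] at h2 h3
  rw [← Complex.ofReal_sum, Complex.norm_real, norm_eq_abs] at h2 h3
  have h2' := (abs_le.1 h2).1
  have h3' := (abs_le.1 h3).1
  have hyx : (y : ℝ) ≤ x := by exact_mod_cast hy
  have key : ‖(δ : ℂ) * ∑ m ∈ Icc 1 y, eC (α * (m : ℝ) ^ d + β * m) * ((2 * Int.fract (t m) - 1 : ℝ) : ℂ)‖ ≤ 3 * E + 3 * δ ^ 2 * y := by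
    have e1 : (δ : ℂ) * ∑ m ∈ Icc 1 y, eC (α * (m : ℝ) ^ d + β * m) * ((2 * Int.fract (t m) - 1 : ℝ) : ℂ) =
        ∑ m ∈ Icc 1 y, eC (α * (m : ℝ) ^ d + β * m) * ((Q2 (t m + δ) - Q2 (t m) : ℝ) : ℂ) +
        ∑ m ∈ Icc 1 y, eC (α * (m : ℝ) ^ d + β * m) * ((δ * (2 * Int.fract (t m) - 1) - (Q2 (t m + δ) - Q2 (t m)) : ℝ) : ℂ) := by
      rw [← sum_add_distrib, mul_sum]
      refine sum_congr rfl fun m _ => ?_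
      push_cast; ring
    have e2 : ‖∑ m ∈ Icc 1 y, eC (α * (m : ℝ) ^ d + β * m) * ((δ * (2 * Int.fract (t m) - 1) - (Q2 (t m + δ) - Q2 (t m)) : ℝ) : ℂ)‖ ≤
        ∑ m ∈ Icc 1 y, (3 * δ ^ 2 - (Q2 (t m + δ) - Q2 (t m)) - (Q2 (t m + -δ) - Q2 (t m))) := by
      refine norm_sum_le_of_le _ fun m _ => ?_
      rw [norm_mul, eC_norm, one_mul, Complex.norm_real, norm_eq_abs, abs_le]
      have a1 := Q2_ineq (t m) δ
      have a2 := Q2_ineq (t m) (-δ)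
      have a3 : 0 ≤ δ ^ 2 := by positivity
      constructor <;> linarith
    rw [sum_sub_distrib, sum_sub_distrib, sum_const, Nat.card_Icc, nsmul_eq_mul, Nat.add_sub_cancel] at e2
    rw [e1]
    refine (norm_add_le _ _).trans ((add_le_add h1 e2).trans ?_)
    linarith
  rw [norm_mul, Complex.norm_real, norm_of_nonneg hδ0.le] at key
  have hfin : 3 * E + 3 * δ ^ 2 * y ≤ δ * ((3 * C + 3) * (x : ℝ) ^ (1 - κ + ε)) := by
    have e3 : E = δ * (C * (x : ℝ) ^ (1 - κ + ε)) := by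
      rw [hE, hδ, mul_left_comm, ← rpow_add hx0]; congr 2; ring
    have e4 : δ * y ≤ (x : ℝ) ^ (1 - κ + ε) := by
      calc δ * y ≤ (x : ℝ) ^ (-κ) * (x : ℝ) ^ (1 : ℝ) := by rw [rpow_one]; gcongr
        _ = (x : ℝ) ^ (-κ + 1) := by rw [← rpow_add hx0]
        _ ≤ _ := rpow_le_rpow_of_exponent_le hx1 (by linarith)
    have e5 := mul_le_mul_of_nonneg_left e4 hδ0.le
    rw [e3]
    linarith
  exact le_of_mul_le_mul_left (key.trans hfin) hδ0

lemma rpow_tan {γ a b : ℝ} (h0 : 0 ≤ γ) (h1 : γ ≤ 1) (ha : 0 < a) (hb : 0 < b) : b ^ γ ≤ a ^ γ + γ * a ^ (γ - 1) * (b - a) := by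
  have h := rpow_one_add_le_one_add_mul_self (s := (b - a) / a) (by rw [le_div_iff₀ ha]; linarith) h0 h1
  have e : 1 + (b - a) / a = b / a := by field_simp; ring
  rw [e, div_rpow hb.le ha.le, div_le_iff₀ (by positivity)] at h
  refine h.trans (le_of_eq ?_)
  rw [rpow_sub_one ha.ne']; ring

lemma ps_ind {c γ : ℝ} (hc : 1 < c) (hγ : γ = c⁻¹) (m : ℕ) (hm : 1 ≤ m) :
    (if m ∈ PS c then 1 else 0 : ℝ) = ((m : ℝ) + 1) ^ γ - (m : ℝ) ^ γ + Int.fract (-((m : ℝ) + 1) ^ γ) - Int.fract (-(m : ℝ) ^ γ) := by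
  have hc0 : 0 < c := by linarith
  have hγ0 : 0 < γ := by rw [hγ]; positivity
  have hγ1 : γ < 1 := by rw [hγ]; exact inv_lt_one_of_one_lt₀ hc
  have hm1 : (1 : ℝ) ≤ m := by exact_mod_cast hm
  have hiff : ∀ n : ℕ, m = ⌊(n : ℝ) ^ c⌋₊ ↔ (m : ℝ) ^ γ ≤ n ∧ (n : ℝ) < ((m : ℝ) + 1) ^ γ := by
    intro n
    rw [hγ, rpow_inv_le_iff_of_pos (by positivity) (by positivity) hc0, lt_rpow_inv_iff_of_pos (by positivity) (by positivity) hc0,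
      eq_comm, Nat.floor_eq_iff (by positivity)]
  set A := (m : ℝ) ^ γ with hA
  set B := ((m : ℝ) + 1) ^ γ with hB
  have hA1 : 1 ≤ A := one_le_rpow hm1 hγ0.le
  have hAB : A ≤ B := rpow_le_rpow (by positivity) (by linarith) hγ0.le
  have hBA : B < A + 1 := by
    have h1 := rpow_tan hγ0.le hγ1.le (a := m) (b := m + 1) (by positivity) (by positivity)
    have h2 : (m : ℝ) ^ (γ - 1) ≤ 1 := rpow_le_one_of_one_le_of_nonpos hm1 (by linarith)
    have h3 : γ * (m : ℝ) ^ (γ - 1) ≤ γ * 1 := by gcongr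
    rw [add_sub_cancel_left, mul_one] at h1
    linarith
  have hce : B - A + Int.fract (-B) - Int.fract (-A) = ((⌈B⌉ - ⌈A⌉ : ℤ) : ℝ) := by
    rw [Int.fract, Int.fract, Int.floor_neg, Int.floor_neg]; push_cast; ring
  rw [hce]
  have h5 : ⌈B⌉ ≤ ⌈A⌉ + 1 := by
    rw [Int.ceil_le]; push_cast; linarith [Int.le_ceil A]
  have h6 : ⌈A⌉ ≤ ⌈B⌉ := Int.ceil_mono hAB
  split_ifs with hmem
  · obtain ⟨n, _, hn⟩ := hmem
    obtain ⟨h3, h4⟩ := (hiff n).1 hn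
    have h7 : ⌈A⌉ ≤ n := Int.ceil_le.2 (by exact_mod_cast h3)
    have h8 : (n : ℤ) < ⌈B⌉ := Int.lt_ceil.2 (by exact_mod_cast h4)
    have : ⌈B⌉ - ⌈A⌉ = 1 := by omega
    rw [this]; simp
  · have h9 : ⌈B⌉ ≤ ⌈A⌉ := by
      by_contra hcon
      push Not at hcon
      apply hmem
      have h10 : (⌈A⌉₊ : ℤ) = ⌈A⌉ := Int.natCast_ceil_eq_ceil (by linarith)
      refine ⟨⌈A⌉₊, Nat.ceil_pos.2 (by linarith), (hiff _).2 ⟨Nat.le_ceil A, ?_⟩⟩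
      rw [← h10, Int.lt_ceil] at hcon
      exact_mod_cast hcon
    have : ⌈B⌉ - ⌈A⌉ = 0 := by omega
    rw [this]; simp

lemma f_bound {d : ℕ} {γ κ c : ℝ} (hB : BB d γ κ) (hκ0 : 0 < κ) (hκ : κ ≤ 1 / 2) (hc : 1 < c) (hγ : γ = c⁻¹) (ε : ℝ) (hε : 0 < ε) (hε1 : ε ≤ 1) :
    ∃ C > 0, ∀ x y : ℕ, ∀ α β : ℝ, 1 ≤ x → y ≤ x →
    ‖∑ m ∈ Icc 1 y, eC (α * (m : ℝ) ^ d + β * m) * (((if m ∈ PS c then 1 else 0) - γ * (m : ℝ) ^ (γ - 1) : ℝ) : ℂ)‖ ≤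
      C * (x : ℝ) ^ (1 - κ + ε) := by
  obtain ⟨C, hC0, hC⟩ := psi_bound hB hκ0 hκ ε hε hε1
  refine ⟨C + 1, by positivity, ?_⟩
  intro x y α β hx hy
  have hx1 : (1 : ℝ) ≤ x := by exact_mod_cast hx
  have hγ0 : 0 < γ := by rw [hγ]; have : 0 < c := by linarith
                         positivity
  have hγ1 : γ < 1 := by rw [hγ]; exact inv_lt_one_of_one_lt₀ hc
  have h0 := hC x y 0 α β hx hy (by norm_num)
  have h1 := hC x y 1 α β hx hy le_rfl
  simp only [Nat.cast_zero, add_zero, Nat.cast_one] at h0 h1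
  set r : ℕ → ℝ := fun m => ((m : ℝ) + 1) ^ γ - (m : ℝ) ^ γ - γ * (m : ℝ) ^ (γ - 1) with hr
  have hrb : ∀ m ∈ Icc 1 y, ‖eC (α * (m : ℝ) ^ d + β * m) * ((r m : ℝ) : ℂ)‖ ≤ (m : ℝ) ^ (γ - 1) - ((m : ℝ) + 1) ^ (γ - 1) := by
    intro m hm
    have hm0 : (0 : ℝ) < m := by exact_mod_cast (mem_Icc.1 hm).1
    rw [norm_mul, eC_norm, one_mul, Complex.norm_real, norm_eq_abs, abs_le, hr]
    have a1 := rpow_tan hγ0.le hγ1.le (a := m) (b := m + 1) hm0 (by positivity)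
    have a2 := rpow_tan hγ0.le hγ1.le (a := m + 1) (b := m) (by positivity) hm0
    have a3 : ((m : ℝ) + 1) ^ (γ - 1) ≤ (m : ℝ) ^ (γ - 1) := rpow_le_rpow_of_nonpos hm0 (by linarith) (by linarith)
    have a4 : γ * ((m : ℝ) ^ (γ - 1) - ((m : ℝ) + 1) ^ (γ - 1)) ≤ 1 * ((m : ℝ) ^ (γ - 1) - ((m : ℝ) + 1) ^ (γ - 1)) :=
      mul_le_mul_of_nonneg_right hγ1.le (by linarith)
    constructor <;> simp only <;> linarith
  have htel : ∀ y : ℕ, ∑ m ∈ Icc 1 y, ((m : ℝ) ^ (γ - 1) - ((m : ℝ) + 1) ^ (γ - 1)) = 1 - ((y : ℝ) + 1) ^ (γ - 1) := by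
    intro y
    induction y with
    | zero => simp
    | succ y ih => rw [sum_Icc_succ_top (by omega), ih]; push_cast; ring
  have hrs := norm_sum_le_of_le _ hrb
  rw [htel] at hrs
  have e1 : ∑ m ∈ Icc 1 y, eC (α * (m : ℝ) ^ d + β * m) * (((if m ∈ PS c then 1 else 0) - γ * (m : ℝ) ^ (γ - 1) : ℝ) : ℂ) =
      ∑ m ∈ Icc 1 y, eC (α * (m : ℝ) ^ d + β * m) * ((r m : ℝ) : ℂ) +
      (1 / 2) * ∑ m ∈ Icc 1 y, eC (α * (m : ℝ) ^ d + β * m) * ((2 * Int.fract (-((m : ℝ) + 1) ^ γ) - 1 : ℝ) : ℂ) -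
      (1 / 2) * ∑ m ∈ Icc 1 y, eC (α * (m : ℝ) ^ d + β * m) * ((2 * Int.fract (-(m : ℝ) ^ γ) - 1 : ℝ) : ℂ) := by
    rw [mul_sum, mul_sum, ← sum_add_distrib, ← sum_sub_distrib]
    refine sum_congr rfl fun m hm => ?_
    rw [ps_ind hc hγ m (mem_Icc.1 hm).1]
    simp only [hr]; push_cast; ring
  rw [e1]
  have hp : 0 ≤ ((y : ℝ) + 1) ^ (γ - 1) := by positivity
  have hX1 : 1 ≤ (x : ℝ) ^ (1 - κ + ε) := one_le_rpow hx1 (by linarith)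
  refine (norm_sub_le _ _).trans ((add_le_add (norm_add_le _ _) le_rfl).trans ?_)
  rw [norm_mul, norm_mul, show ‖(1 / 2 : ℂ)‖ = 1 / 2 by norm_num]
  linarith

lemma eC_pow (t : ℝ) (j : ℕ) : eC (j * t) = eC t ^ j := by
  unfold eC; rw [← Complex.exp_nat_mul]; congr 1; push_cast; ring

lemma detect_one (W : ℕ) (hW : 1 ≤ W) (u : ℤ) : ∑ j ∈ range W, eC (j * ((u : ℝ) / W)) = if (W : ℤ) ∣ u then (W : ℂ) else 0 := by
  have hW0 : (W : ℝ) ≠ 0 := by positivity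
  simp only [eC_pow]
  split_ifs with h
  · obtain ⟨v, rfl⟩ := h
    have : ((W * v : ℤ) : ℝ) / W = (v : ℝ) := by push_cast; field_simp
    rw [this, eC_int]; simp
  · have h1 : eC ((u : ℝ) / W) ≠ 1 := by
      intro h1
      unfold eC at h1
      obtain ⟨n, hn⟩ := Complex.exp_eq_one_iff.1 h1
      apply h
      have hpi : (2 * Real.pi * Complex.I : ℂ) ≠ 0 := Complex.two_pi_I_ne_zero
      have h2 : (((u : ℝ) / W : ℝ) : ℂ) = ((n : ℝ) : ℂ) := by
        have : (2 * Real.pi * Complex.I : ℂ) * (((u : ℝ) / W : ℝ) : ℂ) = (2 * Real.pi * Complex.I : ℂ) * ((n : ℝ) : ℂ) := by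
          rw [hn]; push_cast; ring
        exact mul_left_cancel₀ hpi this
      have h3 : (u : ℝ) / W = n := by exact_mod_cast h2
      rw [div_eq_iff hW0] at h3
      exact ⟨n, by rw [mul_comm]; exact_mod_cast h3⟩
    rw [geom_sum_eq h1, ← eC_pow, mul_div_cancel₀ _ hW0, eC_int]; simp

lemma detect (d W b y : ℕ) (hW : 1 ≤ W) (g : ℕ → ℂ) (B : ℝ) (hB : ∀ β : ℝ, ‖∑ m ∈ Icc 1 y, eC (β * m) * g m‖ ≤ B) :
    ‖∑ m ∈ Icc 1 y, (if (m ^ d + b) % W = 0 then g m else 0)‖ ≤ sigmaPS d W b * B := by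
  have hW0 : (W : ℂ) ≠ 0 := by exact_mod_cast (by omega : W ≠ 0)
  set R := (Icc 1 W).filter fun z => (z ^ d + b) % W = 0 with hR
  have hpt : ∀ m ∈ Icc 1 y, (if (m ^ d + b) % W = 0 then g m else 0) =
      ∑ z ∈ R, (1 / (W : ℂ)) * ∑ j ∈ range W, eC (j * (((m : ℤ) - z : ℤ) / W : ℝ)) * g m := by
    intro m hm
    have hm1 := (mem_Icc.1 hm).1
    have hz : ∀ z ∈ Icc 1 W, ((W : ℤ) ∣ (m : ℤ) - z ↔ z = (m - 1) % W + 1) := by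
      intro z hz
      obtain ⟨hz1, hz2⟩ := mem_Icc.1 hz
      rw [← Nat.modEq_iff_dvd]
      have e1 : z = (z - 1) + 1 := by omega
      have e2 : m = (m - 1) + 1 := by omega
      constructor
      · intro h
        rw [e1, e2] at h
        have h3 := Nat.ModEq.add_right_cancel' 1 h
        rw [Nat.ModEq, Nat.mod_eq_of_lt (by omega)] at h3
        omega
      · intro h
        rw [h]
        conv_rhs => rw [e2]
        exact (Nat.mod_modEq _ _).add_right 1
    simp only [← sum_mul, detect_one W hW]
    rw [hR, sum_filter]
    have hz0 : (m - 1) % W + 1 ∈ Icc 1 W := mem_Icc.2 ⟨by omega, Nat.mod_lt _ hW⟩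
    have hmod : (((m - 1) % W + 1) ^ d + b) % W = (m ^ d + b) % W := by
      have h1 : (m - 1) % W + 1 ≡ m [MOD W] := by
        have := (Nat.mod_modEq (m - 1) W).add_right 1
        rwa [Nat.sub_add_cancel hm1] at this
      exact (h1.pow d).add_right b
    rw [sum_eq_single ((m - 1) % W + 1)]
    · rw [hmod, if_pos ((hz _ hz0).2 rfl)]
      split_ifs
      · field_simp
      · rfl
    · intro z hzm hne
      rw [if_neg (fun h => hne ((hz z hzm).1 h))]; simp
    · intro h; exact absurd hz0 h
  rw [sum_congr rfl hpt, sum_comm]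
  have hB0 : 0 ≤ B := (norm_nonneg _).trans (hB 0)
  refine (norm_sum_le _ _).trans ((sum_le_sum (g := fun _ => B) fun z _ => ?_).trans (le_of_eq ?_))
  · rw [← mul_sum, sum_comm, norm_mul]
    have h1 : ‖∑ j ∈ range W, ∑ m ∈ Icc 1 y, eC (j * (((m : ℤ) - z : ℤ) / W : ℝ)) * g m‖ ≤ W * B := by
      refine (norm_sum_le _ _).trans ((sum_le_sum (g := fun _ => B) fun j _ => ?_).trans (le_of_eq (by simp)))
      have e : ∑ m ∈ Icc 1 y, eC (j * (((m : ℤ) - z : ℤ) / W : ℝ)) * g m =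
          eC (-(j * z / W)) * ∑ m ∈ Icc 1 y, eC ((j / W : ℝ) * m) * g m := by
        rw [mul_sum]
        refine sum_congr rfl fun m _ => ?_
        rw [← mul_assoc, ← eC_add]; congr 2; push_cast; ring
      rw [e, norm_mul, eC_norm, one_mul]
      exact hB _
    calc _ ≤ ‖1 / (W : ℂ)‖ * (W * B) := by gcongr
      _ = B := by
        rw [norm_div, norm_one, Complex.norm_natCast]
        have : (W : ℝ) ≠ 0 := by positivity
        field_simp
  · rw [sum_const, nsmul_eq_mul]; rfl

lemma abel_bd (w : ℕ → ℝ) (hw0 : 0 ≤ w 0) (hw : ∀ n, w n ≤ w (n + 1)) (a : ℕ → ℂ) (B : ℝ) (N : ℕ)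
    (hB : ∀ y ≤ N, ‖∑ m ∈ Icc 1 y, a m‖ ≤ B) : ‖∑ m ∈ Icc 1 N, (w m : ℂ) * a m‖ ≤ 2 * w N * B := by
  have hB0 : 0 ≤ B := (norm_nonneg _).trans (hB 0 (Nat.zero_le _))
  have hwn : ∀ n, 0 ≤ w n := fun n => by
    induction n with
    | zero => exact hw0
    | succ n ih => exact ih.trans (hw n)
  have key : ∀ n ≤ N, ‖(w n : ℂ) * ∑ m ∈ Icc 1 n, a m - ∑ m ∈ Icc 1 n, (w m : ℂ) * a m‖ ≤ w n * B := by
    intro n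
    induction n with
    | zero => intro _; simp; positivity
    | succ n ih =>
      intro hn
      rw [sum_Icc_succ_top (by omega), sum_Icc_succ_top (by omega)]
      have e : (w (n + 1) : ℂ) * (∑ m ∈ Icc 1 n, a m + a (n + 1)) - (∑ m ∈ Icc 1 n, (w m : ℂ) * a m + (w (n + 1) : ℂ) * a (n + 1)) =
          ((w (n + 1) - w n : ℝ) : ℂ) * (∑ m ∈ Icc 1 n, a m) + ((w n : ℂ) * ∑ m ∈ Icc 1 n, a m - ∑ m ∈ Icc 1 n, (w m : ℂ) * a m) := by
        push_cast; ring
      rw [e]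
      refine (norm_add_le _ _).trans ?_
      rw [norm_mul, Complex.norm_real, norm_of_nonneg (by linarith [hw n])]
      have h1 := mul_le_mul_of_nonneg_left (hB n (by omega)) (sub_nonneg.2 (hw n))
      linarith [ih (by omega)]
  have h1 := key N le_rfl
  have h2 : ‖(w N : ℂ) * ∑ m ∈ Icc 1 N, a m‖ ≤ w N * B := by
    rw [norm_mul, Complex.norm_real, norm_of_nonneg (hwn N)]
    exact mul_le_mul_of_nonneg_left (hB N le_rfl) (hwn N)
  have h3 := norm_sub_le ((w N : ℂ) * ∑ m ∈ Icc 1 N, a m) ((w N : ℂ) * ∑ m ∈ Icc 1 N, a m - ∑ m ∈ Icc 1 N, (w m : ℂ) * a m)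
  rw [sub_sub_cancel] at h3
  linarith

lemma ft_eq (d W b x : ℕ) (hd : d ≠ 0) (hW : 1 ≤ W) (f : ℤ → ℝ) (g : ℕ → ℝ)
    (h1 : ∀ n : ℤ, ∀ m : ℕ, 1 ≤ m → m ≤ x → (W : ℤ) * n - b = (m : ℤ) ^ d → f n = g m)
    (h2 : ∀ n : ℤ, (¬ ∃ m : ℕ, 1 ≤ m ∧ m ≤ x ∧ (W : ℤ) * n - b = (m : ℤ) ^ d) → f n = 0) (α : ℝ) :
    FT (fun n => (f n : ℂ)) α = ∑ m ∈ Icc 1 x, if (m ^ d + b) % W = 0 then (g m : ℂ) * eC (α * (((m : ℝ) ^ d + b) / W)) else 0 := by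
  have hW0 : (W : ℤ) ≠ 0 := by exact_mod_cast (by omega : W ≠ 0)
  set F : ℕ → ℤ := fun m => ((m ^ d + b) / W : ℕ) with hF
  have hFm : ∀ m : ℕ, (m ^ d + b) % W = 0 → (W : ℤ) * F m = (m : ℤ) ^ d + b := by
    intro m hm
    have := Nat.mul_div_cancel' (Nat.dvd_of_mod_eq_zero hm)
    simp only [hF]; exact_mod_cast this
  set s := ((Icc 1 x).filter fun m => (m ^ d + b) % W = 0) with hs
  have hsup : Function.support (fun n : ℤ => (f n : ℂ) * eC (α * n)) ⊆ ↑(s.image F) := by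
    intro n hn
    rw [Function.mem_support] at hn
    by_contra hcon
    apply hn
    rw [h2 n, Complex.ofReal_zero, zero_mul]
    rintro ⟨m, hm1, hmx, hm⟩
    apply hcon
    have hnat : (m ^ d + b) % W = 0 := by
      have : (W : ℤ) ∣ ((m ^ d + b : ℕ) : ℤ) := ⟨n, by push_cast; linarith⟩
      exact Nat.mod_eq_zero_of_dvd (Int.natCast_dvd_natCast.1 this)
    rw [coe_image]
    refine ⟨m, ?_, ?_⟩
    · rw [hs, mem_coe, mem_filter, mem_Icc]; exact ⟨⟨hm1, hmx⟩, hnat⟩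
    · apply mul_left_cancel₀ hW0; rw [hFm m hnat]; linarith
  unfold FT
  rw [finsum_eq_sum_of_support_subset _ hsup, sum_image, hs, sum_filter]
  · refine sum_congr rfl fun m hm => ?_
    split_ifs with h
    · have hm' := mem_Icc.1 hm
      have h3 := hFm m h
      rw [h1 (F m) m hm'.1 hm'.2 (by linarith)]
      congr 3
      rw [eq_div_iff (by positivity), mul_comm]
      exact_mod_cast h3
    · rfl
  · intro m hm m' hm' hmm
    rw [hs, mem_coe, mem_filter] at hm hm'
    have h3 := hFm m hm.2
    have h4 := hFm m' hm'.2
    rw [hmm] at h3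
    have h5 : m ^ d = m' ^ d := by
      have : (m : ℤ) ^ d = (m' : ℤ) ^ d := by linarith
      exact_mod_cast this
    exact Nat.pow_left_injective hd h5

lemma Wps_pos (d x : ℕ) (hd : 2 ≤ d) : 1 ≤ Wps d x := by
  unfold Wps
  have h1 : 0 < ∏ p ∈ filter Nat.Prime (Iic ⌊wps x⌋₊), p :=
    prod_pos fun p hp => (mem_filter.1 hp).2.pos
  have : 0 < d := by omega
  have : 0 < 4 * d ^ 3 := by positivity
  exact Nat.mul_pos this h1

lemma PS_pos {c : ℝ} (hc : 1 < c) {m : ℕ} (hm : m ∈ PS c) : 1 ≤ m := by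
  obtain ⟨n, hn, rfl⟩ := hm
  apply Nat.le_floor
  rw [Nat.cast_one]
  exact one_le_rpow (by exact_mod_cast hn) (by linarith)

lemma main4 {d : ℕ} (hd : 2 ≤ d) {γ κ c : ℝ} (hBB : BB d γ κ) (hκ0 : 0 < κ) (hκ : κ ≤ 1 / 2) (hc : 1 < c) (hγ : γ = c⁻¹) (ε : ℝ) (hε : 0 < ε) (hε1 : ε ≤ 1) :
    ∃ C : ℝ, 0 < C ∧ ∀ x : ℕ, 1 ≤ x → ∀ b : ℕ, ∀ τ : ℤ → ℝ, tauSpec d x c b τ → ∀ μ : ℤ → ℝ, muSpec d x b μ → ∀ α : ℝ,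
      ‖FT (fun n => (τ n : ℂ)) α - FT (fun n => (μ n : ℂ)) α‖ ≤ C * (x : ℝ) ^ ((d : ℝ) - γ + (1 - κ + ε)) := by
  obtain ⟨C, hC0, hC⟩ := f_bound hBB hκ0 hκ hc hγ ε hε hε1
  refine ⟨2 * c * C, by positivity, ?_⟩
  intro x hx b τ hτ μ hμ α
  have hx1 : (1 : ℝ) ≤ x := by exact_mod_cast hx
  have hx0 : (0 : ℝ) < x := by linarith
  have hW := Wps_pos d x hd
  unfold tauSpec at hτ
  unfold muSpec at hμ
  generalize Wps d x = W at *
  have hc0 : 0 < c := by linarith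
  have hγ1 : γ < 1 := by rw [hγ]; exact inv_lt_one_of_one_lt₀ hc
  have hd2 : (2 : ℝ) ≤ d := by exact_mod_cast hd
  set σ : ℝ := (sigmaPS d W b : ℝ) with hσ
  have hσ0 : 0 ≤ σ := by positivity
  rw [ft_eq d W b x (by omega) hW τ (fun m => if m ∈ PS c then c / σ * (m : ℝ) ^ ((d : ℝ) - 1 / c) else 0) ?_ ?_ α,
    ft_eq d W b x (by omega) hW μ (fun m => (m : ℝ) ^ (d - 1) / σ) hμ.1 hμ.2 α, ← sum_sub_distrib]
  · set F : ℕ → ℝ := fun m => (if m ∈ PS c then 1 else 0) - γ * (m : ℝ) ^ (γ - 1) with hF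
    have hpt : ∀ m ∈ Icc 1 x,
        ((if (m ^ d + b) % W = 0 then ((if m ∈ PS c then c / σ * (m : ℝ) ^ ((d : ℝ) - 1 / c) else 0 : ℝ) : ℂ) * eC (α * (((m : ℝ) ^ d + b) / W)) else 0) -
          (if (m ^ d + b) % W = 0 then (((m : ℝ) ^ (d - 1) / σ : ℝ) : ℂ) * eC (α * (((m : ℝ) ^ d + b) / W)) else 0)) =
        (((c / σ : ℝ) : ℂ) * eC (α * b / W)) * ((((m : ℝ) ^ ((d : ℝ) - γ) : ℝ) : ℂ) *
          (if (m ^ d + b) % W = 0 then eC (α / W * (m : ℝ) ^ d) * ((F m : ℝ) : ℂ) else 0)) := by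
      intro m hm
      have hm0 : (0 : ℝ) < m := by exact_mod_cast (mem_Icc.1 hm).1
      by_cases h : (m ^ d + b) % W = 0
      · simp only [if_pos h]
        have e1 : eC (α * (((m : ℝ) ^ d + b) / W)) = eC (α / W * (m : ℝ) ^ d) * eC (α * b / W) := by
          rw [← eC_add]; congr 1; ring
        have e2 : (if m ∈ PS c then c / σ * (m : ℝ) ^ ((d : ℝ) - 1 / c) else 0 : ℝ) - (m : ℝ) ^ (d - 1) / σ = c / σ * ((m : ℝ) ^ ((d : ℝ) - γ) * F m) := by
          have e3 : (m : ℝ) ^ (d - 1) = (m : ℝ) ^ ((d : ℝ) - γ) * (m : ℝ) ^ (γ - 1) := by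
            rw [← rpow_add hm0, ← rpow_natCast, Nat.cast_sub (by omega)]
            ring_nf
          have e4 : (d : ℝ) - 1 / c = d - γ := by rw [hγ, one_div]
          have e5 : c * γ = 1 := by rw [hγ]; field_simp
          rw [e3, e4]
          simp only [hF]
          split_ifs
          · linear_combination ((m : ℝ) ^ ((d : ℝ) - γ) * (m : ℝ) ^ (γ - 1) / σ) * e5
          · linear_combination ((m : ℝ) ^ ((d : ℝ) - γ) * (m : ℝ) ^ (γ - 1) / σ) * e5
        rw [← sub_mul, ← Complex.ofReal_sub, e2, e1]
        push_cast; ring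
      · simp only [if_neg h]; simp
    rw [sum_congr rfl hpt, ← mul_sum, norm_mul, norm_mul, eC_norm, mul_one, Complex.norm_real, norm_of_nonneg (by positivity)]
    have hB0 : 0 ≤ C * (x : ℝ) ^ (1 - κ + ε) := by positivity
    have h1 := abel_bd (fun m => (m : ℝ) ^ ((d : ℝ) - γ)) (by positivity)
      (fun n => rpow_le_rpow (by positivity) (by push_cast; linarith) (by linarith))
      (fun m => if (m ^ d + b) % W = 0 then eC (α / W * (m : ℝ) ^ d) * ((F m : ℝ) : ℂ) else 0)
      (σ * (C * (x : ℝ) ^ (1 - κ + ε))) x (fun y hy => by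
        refine detect d W b y hW (fun m => eC (α / W * (m : ℝ) ^ d) * ((F m : ℝ) : ℂ)) _ fun β => ?_
        refine le_trans (le_of_eq ?_) (hC x y (α / W) β hx hy)
        congr 1
        refine sum_congr rfl fun m _ => ?_
        rw [eC_add, ← mul_assoc, mul_comm (eC (β * m))])
    refine (mul_le_mul_of_nonneg_left h1 (by positivity)).trans ?_
    rw [rpow_add hx0 ((d : ℝ) - γ)]
    have h2 : c / σ * σ ≤ c := by
      rcases eq_or_lt_of_le hσ0 with h | h
      · rw [← h]; simp; linarith
      · rw [div_mul_cancel₀ _ h.ne']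
    have h3 : 0 ≤ 2 * (x : ℝ) ^ ((d : ℝ) - γ) * (C * (x : ℝ) ^ (1 - κ + ε)) := by positivity
    have h4 := mul_le_mul_of_nonneg_right h2 h3
    refine le_trans (le_of_eq ?_) (h4.trans (le_of_eq ?_)) <;> ring
  · intro n m hm1 hmx hm
    split_ifs with h
    · exact hτ.1 n m h hmx hm
    · apply hτ.2 n
      rintro ⟨m', hm', _, h3⟩
      have h5 : m ^ d = m' ^ d := by
        have : (m : ℤ) ^ d = (m' : ℤ) ^ d := by rw [← hm, ← h3]
        exact_mod_cast this
      have := Nat.pow_left_injective (by omega : d ≠ 0) h5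
      exact h (this ▸ hm')
  · intro n hn
    apply hτ.2 n
    rintro ⟨m', hm', h2, h3⟩
    exact hn ⟨m', PS_pos hc hm', h2, h3⟩

lemma p4_num {d : ℕ} {c k S : ℝ} (hc1 : 1 < c) (hk0 : 0 < k) (hk : k ≤ 1 / 99)
    (hk2 : 2 * (d : ℝ) * (d + 1) * k * 61 ≤ 25.2) (hS : 16 ≤ S) (hc2 : c < 1 + 2 * k / (4 * S + 1 - k)) :
    1 - c⁻¹ ≤ 0.01 ∧ 0 < 1 - (1 + c) / 2 * (1 - k) * c⁻¹ ∧ 1 - (1 + c) / 2 * (1 - k) * c⁻¹ ≤ 0.0105 ∧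
      2 * (d : ℝ) * (d + 1) * (1 - (1 + c) / 2 * (1 - k) * c⁻¹) ≤ 0.42 := by
  have hc0 : 0 < c := by linarith
  have h1 : 2 * k / (4 * S + 1 - k) ≤ k / 32 := by
    rw [div_le_div_iff₀ (by linarith) (by norm_num)]
    have := mul_le_mul_of_nonneg_left (by linarith : 64 ≤ 4 * S + 1 - k) hk0.le
    linarith
  have hg1 : c⁻¹ < 1 := inv_lt_one_of_one_lt₀ hc1
  have hg0 : 0 < c⁻¹ := inv_pos.2 hc0
  have hcg : c * c⁻¹ = 1 := mul_inv_cancel₀ hc0.ne'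
  have hη : 1 - c⁻¹ ≤ c - 1 := by nlinarith
  set g := c⁻¹ with hg
  clear_value g
  have e : 1 - (1 + c) / 2 * (1 - k) * g = (1 - g) / 2 + k * (1 + g) / 2 := by
    linear_combination (-(1 - k) / 2) * hcg
  rw [e]
  have h2 : k * (1 + g) ≤ k * 2 := mul_le_mul_of_nonneg_left (by linarith) hk0.le
  have h3 : 0 < k * (1 + g) := by positivity
  have h4 : (1 - g) / 2 + k * (1 + g) / 2 ≤ k * 61 / 60 := by linarith
  refine ⟨by norm_num; linarith, by linarith, by norm_num; linarith, ?_⟩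
  have h5 := mul_le_mul_of_nonneg_left h4 (by positivity : 0 ≤ 2 * (d : ℝ) * (d + 1))
  norm_num at hk2 ⊢
  linarith

lemma k_h {d : ℕ} (hd : 4 ≤ d) : 0 < hD d ∧ hD d ≤ 1 / 99 ∧ 2 * (d : ℝ) * (d + 1) * hD d * 61 ≤ 25.2 := by
  have hd4 : (4 : ℝ) ≤ d := by exact_mod_cast hd
  have hD1 : (20 : ℝ) ≤ d * (d + 1) := by nlinarith
  have hE : (5 : ℝ) * (d * (d + 1)) ≤ d * (d + 1) ^ 2 := by nlinarith
  unfold hD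
  have hpos : (0 : ℝ) < d * (d + 1) ^ 2 - 1 := by linarith
  refine ⟨by positivity, ?_, ?_⟩
  · exact one_div_le_one_div_of_le (by norm_num) (by linarith)
  · rw [show 2 * (d : ℝ) * (d + 1) * (1 / (d * (d + 1) ^ 2 - 1)) * 61 = (122 * (d * (d + 1))) / (d * (d + 1) ^ 2 - 1) by ring, div_le_iff₀ hpos]
    norm_num; linarith

lemma k_kl {d : ℕ} (hd : 12 ≤ d) (k A : ℝ) (hA0 : A ≤ 14) (hA : 0 ≤ A) (hk : k = 2 / (27 * (d : ℝ) ^ 2 - A)) :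
    0 < k ∧ k ≤ 1 / 99 ∧ 2 * (d : ℝ) * (d + 1) * k * 61 ≤ 25.2 := by
  have hd4 : (12 : ℝ) ≤ d := by exact_mod_cast hd
  have hD1 : (12 : ℝ) * d ≤ d ^ 2 := by nlinarith
  have hpos : (0 : ℝ) < 27 * (d : ℝ) ^ 2 - A := by linarith
  subst hk
  refine ⟨by positivity, ?_, ?_⟩
  · rw [div_le_div_iff₀ hpos (by norm_num)]; linarith
  · rw [show 2 * (d : ℝ) * (d + 1) * (2 / (27 * (d : ℝ) ^ 2 - A)) * 61 = (244 * (d ^ 2 + d)) / (27 * (d : ℝ) ^ 2 - A) by ring, div_le_iff₀ hpos]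
    norm_num; linarith

lemma bb_all (d : ℕ) (hd : 2 ≤ d) (c : ℝ) (hc1 : 1 < c) (hc2 : c < 1 + c2ps d) :
    0 < 1 - θdc d c * c⁻¹ ∧ 1 - θdc d c * c⁻¹ ≤ 1 / 2 ∧ ∀ κ : ℝ, 0 < κ → κ ≤ 1 - θdc d c * c⁻¹ → BB d c⁻¹ κ := by
  have hc0 : 0 < c := by linarith
  have hg1 : c⁻¹ < 1 := inv_lt_one_of_one_lt₀ hc1
  have hg0 : 0 < c⁻¹ := inv_pos.2 hc0
  have hcg : c * c⁻¹ = 1 := mul_inv_cancel₀ hc0.ne'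
  have hη : 1 - c⁻¹ ≤ c - 1 := by nlinarith
  by_cases h2 : d = 2
  · subst h2
    simp only [c2ps, θdc, if_true] at hc2 ⊢
    have e : 1 - (4 * c + 7) / 13 * c⁻¹ = (9 - 7 * c⁻¹) / 13 := by linear_combination (-4 / 13) * hcg
    rw [e]
    refine ⟨by linarith, by linarith, fun κ hκ0 hκ => bb_two hg0 hg1 hκ0 (by linarith) (by linarith)⟩
  by_cases h3 : d = 3
  · subst h3
    simp only [c2ps, θdc, if_neg h2, if_true] at hc2 ⊢
    have e : 1 - (15 * c + 14) / 30 * c⁻¹ = (15 - 14 * c⁻¹) / 30 := by linear_combination (-15 / 30) * hcg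
    rw [e]
    refine ⟨by linarith, by linarith, fun κ hκ0 hκ => bb_three hg0 hg1 hκ0 (by linarith) (by linarith)⟩
  have hd4 : 4 ≤ d := by omega
  have hS : (16 : ℝ) ≤ (Sd d : ℝ) := by
    have h1 : 16 ≤ d ^ 2 := by nlinarith
    have : 16 ≤ Sd d := by unfold Sd; omega
    exact_mod_cast this
  obtain ⟨k, hk0, hk1, hk2, hck, hθ⟩ : ∃ k : ℝ, 0 < k ∧ k ≤ 1 / 99 ∧ 2 * (d : ℝ) * (d + 1) * k * 61 ≤ 25.2 ∧
      c < 1 + 2 * k / (4 * (Sd d : ℝ) + 1 - k) ∧ θdc d c = (1 + c) / 2 * (1 - k) := by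
    unfold c2ps at hc2
    unfold θdc
    simp only [if_neg h2, if_neg h3] at hc2 ⊢
    by_cases h11 : d ≤ 11
    · simp only [if_pos h11] at hc2 ⊢
      obtain ⟨a, b, e⟩ := k_h hd4
      exact ⟨hD d, a, b, e, hc2, rfl⟩
    simp only [if_neg h11] at hc2 ⊢
    by_cases hev : 2 ∣ d
    · simp only [if_pos hev] at hc2 ⊢
      obtain ⟨a, b, e⟩ := k_kl (by omega) (kD d) 14 le_rfl (by norm_num) rfl
      exact ⟨kD d, a, b, e, hc2, rfl⟩
    · simp only [if_neg hev] at hc2 ⊢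
      obtain ⟨a, b, e⟩ := k_kl (by omega) (lD d) 5 (by norm_num) (by norm_num) rfl
      exact ⟨lD d, a, b, e, hc2, rfl⟩
  rw [hθ]
  obtain ⟨a1, a2, a3, a4⟩ := p4_num hc1 hk0 hk1 hk2 hS hck
  refine ⟨a2, a3.trans (by norm_num), fun κ hκ0 hκ => ?_⟩
  obtain ⟨e, rfl⟩ : ∃ e, d = e + 2 := ⟨d - 2, by omega⟩
  refine bb_four e (by omega) c⁻¹ κ hg0 hg1 a1 hκ0 (hκ.trans a3) (le_trans ?_ a4)
  have h5 := mul_le_mul_of_nonneg_left hκ (by positivity : 0 ≤ 2 * ((e + 2 : ℕ) : ℝ) * ((e + 2 : ℕ) + 1))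
  refine le_trans (le_of_eq ?_) h5
  push_cast; ring

end Aux

/-- uniformly for `α ∈ [0,1)`,
`τ̂(α) = μ̂(α) + O(x^{d−(1−θ(d,c))/c+ε})`. -/
theorem stmt16 (d : ℕ) (hd : 2 ≤ d) (c : ℝ) (hc1 : 1 < c) (hc2 : c < 1 + c2ps d)
    (ε : ℝ) (hε : 0 < ε) :
    ∃ C : ℝ, 0 < C ∧ ∃ x₀ : ℕ, ∀ x : ℕ, x₀ ≤ x →
      ∀ b : ℕ, bSpec d x b →
        ∀ τ : ℤ → ℝ, tauSpec d x c b τ →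
          ∀ μ : ℤ → ℝ, muSpec d x b μ →
            ∀ α : ℝ, 0 ≤ α → α < 1 →
              ‖FT (fun n => (τ n : ℂ)) α - FT (fun n => (μ n : ℂ)) α‖ ≤
                C * (x : ℝ) ^ ((d : ℝ) - (1 - θdc d c) / c + ε) := by
  obtain ⟨h0, h1, hBB⟩ := bb_all d hd c hc1 hc2
  set K := 1 - θdc d c * c⁻¹ with hK
  have hδ0 : 0 < min (ε / 2) (K / 2) := lt_min (by linarith) (by linarith)
  have hδ1 : min (ε / 2) (K / 2) ≤ ε / 2 := min_le_left _ _
  have hδ2 : min (ε / 2) (K / 2) ≤ K / 2 := min_le_right _ _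
  generalize min (ε / 2) (K / 2) = δ at *
  obtain ⟨C, hC0, hC⟩ := main4 hd (hBB (K - δ) (by linarith) (by linarith)) (by linarith) (by linarith) hc1 rfl δ hδ0 (by linarith)
  refine ⟨C, hC0, 1, ?_⟩
  intro x hx b _ τ hτ μ hμ α _ _
  refine (hC x hx b τ hτ μ hμ α).trans ?_
  have hx1 : (1 : ℝ) ≤ x := by exact_mod_cast hx
  refine mul_le_mul_of_nonneg_left (Real.rpow_le_rpow_of_exponent_le hx1 ?_) hC0.le
  rw [div_eq_mul_inv, hK]
  linarith
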